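/- Let k be a field with char(k) ≠ 3, C ⊂ ℙ² a smooth plane cubic over k, and S_C the blow up of (ℙ²)∨ at the nine points corresponding to the inflection lines of C; if char(k) = 2 assume additionally j(C) ≠ 0. Then the linear system |−2K_{S_C}| is a base-point free pencil, and the associated morphism S_C → ℙ¹ is a rational elliptic surface with a unique multiple fiber, namely twice the unique effective divisor in |−K_{S_C}|. -/

import Mathlib

/-!
STATEMENT 4 (Pacini–Testa, Corollary `sepe`): let `k` be a field with `char k ≠ 3`,
`C ⊂ ℙ²` a smooth plane cubic and `S_C` the blow up of `(ℙ²)∨` at the nine points `T_C`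
dual to the inflection lines of `C`; if `char k = 2` assume moreover `j(C) ≠ 0`.  Then
`|−2K_{S_C}|` is a base-point free pencil, and the associated morphism `S_C → ℙ¹` is a
rational elliptic surface with a unique multiple fiber, namely twice the unique
effective divisor in `|−K_{S_C}|`.

Translation to plane-curve data: sections of `−2K_{S_C}` are the sextics with double
points along `T_C`, and sections of `−K_{S_C}` are the cubics through `T_C`.  The
statement becomes: the space of such sextics has `k`-dimension 2 (a pencil) and has no
base point, in `(ℙ²)∨` outside `T_C` or infinitely near (on the exceptional curves);
the space of cubics through `T_C` has dimension 1 (a unique effective anticanonical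
divisor `H₀` up to scalar); `H₀²` is a member of the pencil, and every multiple member
(a member proportional to `c·H^m` with `m ≥ 2`, `H` nonconstant) is proportional
to `H₀²`.
-/

open MvPolynomial Polynomial

noncomputable section

namespace Infl

variable {K : Type*} [Field K]

def dotv (w p : Fin 3 → K) : K := ∑ i, w i * p i

def lineRestrict (F : MvPolynomial (Fin 3) K) (a b : Fin 3 → K) : Polynomial K :=
  MvPolynomial.aeval (fun i => Polynomial.C (a i) + Polynomial.C (b i) * Polynomial.X) F

def contactAt (F : MvPolynomial (Fin 3) K) (a b : Fin 3 → K) : ℕ :=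
  (lineRestrict F a b).rootMultiplicity 0

def IsSmoothCurve (F : MvPolynomial (Fin 3) K) (d : ℕ) : Prop :=
  F.IsHomogeneous d ∧ F ≠ 0 ∧
    ∀ p : Fin 3 → K, p ≠ 0 → eval p F = 0 → ∃ i, eval p (pderiv i F) ≠ 0

def IsInflLine (F : MvPolynomial (Fin 3) K) (w : Fin 3 → K) : Prop :=
  w ≠ 0 ∧ ∃ a b : Fin 3 → K, dotv w a = 0 ∧ dotv w b = 0 ∧
    LinearIndependent K ![a, b] ∧ lineRestrict F a b ≠ 0 ∧ 3 ≤ contactAt F a b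

def SingAt (F : MvPolynomial (Fin 3) K) (p : Fin 3 → K) : Prop :=
  eval p F = 0 ∧ ∀ i, eval p (pderiv i F) = 0

def planeSubst (F : MvPolynomial (Fin 3) K) (p v u : Fin 3 → K) : MvPolynomial (Fin 2) K :=
  MvPolynomial.aeval
    (fun i => MvPolynomial.C (p i) + MvPolynomial.C (v i) * X 0 + MvPolynomial.C (u i) * X 1) F

variable {k : Type*} [Field k]

def bar (F : MvPolynomial (Fin 3) k) : MvPolynomial (Fin 3) (AlgebraicClosure k) :=
  MvPolynomial.map (algebraMap k (AlgebraicClosure k)) F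

def wpoly (W : WeierstrassCurve K) : MvPolynomial (Fin 3) K :=
  X 1 ^ 2 * X 2 + MvPolynomial.C W.a₁ * X 0 * X 1 * X 2 + MvPolynomial.C W.a₃ * X 1 * X 2 ^ 2
    - X 0 ^ 3 - MvPolynomial.C W.a₂ * X 0 ^ 2 * X 2 - MvPolynomial.C W.a₄ * X 0 * X 2 ^ 2
    - MvPolynomial.C W.a₆ * X 2 ^ 3

def transformPoly (g : Matrix (Fin 3) (Fin 3) K) (F : MvPolynomial (Fin 3) K) :
    MvPolynomial (Fin 3) K :=
  MvPolynomial.aeval (fun i => ∑ j, MvPolynomial.C (g i j) * X j) F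

def HasJZero (F : MvPolynomial (Fin 3) k) : Prop :=
  ∃ (W : WeierstrassCurve (AlgebraicClosure k)) (hW : W.IsElliptic)
    (g : GL (Fin 3) (AlgebraicClosure k)) (c : (AlgebraicClosure k)ˣ),
      (letI := hW; W.j = 0) ∧
      transformPoly (g : Matrix (Fin 3) (Fin 3) (AlgebraicClosure k)) (bar F) =
        (c : AlgebraicClosure k) • wpoly W

/-- The set `T_C` of points of `(ℙ²)∨` dual to the inflection lines of `{F = 0}`. -/
def TC (F : MvPolynomial (Fin 3) k) : Set (Fin 3 → AlgebraicClosure k) :=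
  {w | IsInflLine (bar F) w}

/-- `H⁰(S_C, −K_{S_C})`: the `k`-space of cubics in `(ℙ²)∨` through `T_C`. -/
def antiCanonicalSections (F : MvPolynomial (Fin 3) k) :
    Submodule k (MvPolynomial (Fin 3) k) :=
  (homogeneousSubmodule (Fin 3) k 3) ⊓
    ⨅ w ∈ TC F, LinearMap.ker ((MvPolynomial.aeval (R := k) w).toLinearMap)

/-- `H⁰(S_C, −2K_{S_C})`: the `k`-space of sextics in `(ℙ²)∨` with double points
along `T_C`. -/
def antiBicanonicalSections (F : MvPolynomial (Fin 3) k) :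
    Submodule k (MvPolynomial (Fin 3) k) :=
  (homogeneousSubmodule (Fin 3) k 6) ⊓
    ⨅ w ∈ TC F,
      (LinearMap.ker ((MvPolynomial.aeval (R := k) w).toLinearMap) ⊓
        ⨅ i : Fin 3, LinearMap.ker ((MvPolynomial.aeval (R := k) w).toLinearMap ∘ₗ
          (pderiv i).toLinearMap))

section basics
variable {K : Type*} [Field K]

lemma hom_expand (d : ℕ) (G : MvPolynomial (Fin 3) K) (hG : G.IsHomogeneous d) :
    ∃ c : ℕ → ℕ → K, G = ∑ i ∈ Finset.range (d+1), ∑ j ∈ Finset.range (d+1-i),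
      MvPolynomial.C (c i j) * (X 0 ^ i * X 1 ^ j * X 2 ^ (d - i - j)) := by
  let S : Submodule K (MvPolynomial (Fin 3) K) :=
    { carrier := {G | ∃ c : ℕ → ℕ → K, G = ∑ i ∈ Finset.range (d+1), ∑ j ∈ Finset.range (d+1-i),
        MvPolynomial.C (c i j) * (X 0 ^ i * X 1 ^ j * X 2 ^ (d - i - j))}
      add_mem' := by
        rintro a b ⟨c, rfl⟩ ⟨c', rfl⟩
        refine ⟨fun i j => c i j + c' i j, ?_⟩
        simp only [← Finset.sum_add_distrib, map_add, add_mul]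
      zero_mem' := ⟨fun _ _ => 0, by simp⟩
      smul_mem' := by
        rintro a b ⟨c, rfl⟩
        refine ⟨fun i j => a * c i j, ?_⟩
        simp only [Finset.smul_sum, map_mul, MvPolynomial.smul_eq_C_mul, mul_assoc] }
  change G ∈ S
  rw [G.as_sum]
  refine S.sum_mem fun m hm => ?_
  have hd : m.degree = d := hG.degree_eq_sum_deg_support hm |>.symm ▸ rfl
  have hd' : m 0 + m 1 + m 2 = d := by
    rw [← hd, Finsupp.degree_eq_sum, Fin.sum_univ_three]
  refine ⟨fun i j => if i = m 0 ∧ j = m 1 then coeff m G else 0, ?_⟩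
  rw [Finset.sum_eq_single (m 0), Finset.sum_eq_single (m 1)]
  · have : d - m 0 - m 1 = m 2 := by omega
    simp only [and_self, if_true, this]
    rw [MvPolynomial.monomial_eq, Finsupp.prod_fintype _ _ (by simp), Fin.prod_univ_three]
  · intro j _ hj; simp [hj]
  · intro h; simp at h; omega
  · intro i _ hi; simp [hi]
  · intro h; simp at h; omega

/-- general ternary cubic -/
def cub {R : Type*} [CommRing R] (f : Fin 10 → R) : MvPolynomial (Fin 3) R :=
  MvPolynomial.C (f 0) * X 0 ^ 3 + MvPolynomial.C (f 1) * X 1 ^ 3 + MvPolynomial.C (f 2) * X 2 ^ 3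
  + MvPolynomial.C (f 3) * (X 0 ^ 2 * X 1) + MvPolynomial.C (f 4) * (X 0 ^ 2 * X 2)
  + MvPolynomial.C (f 5) * (X 1 ^ 2 * X 0) + MvPolynomial.C (f 6) * (X 1 ^ 2 * X 2)
  + MvPolynomial.C (f 7) * (X 2 ^ 2 * X 0) + MvPolynomial.C (f 8) * (X 2 ^ 2 * X 1)
  + MvPolynomial.C (f 9) * (X 0 * X 1 * X 2)

/-- value of the cubic -/
def cf {R : Type*} [CommRing R] (f : Fin 10 → R) (a : Fin 3 → R) : R :=
  f 0 * a 0 ^ 3 + f 1 * a 1 ^ 3 + f 2 * a 2 ^ 3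
  + f 3 * (a 0 ^ 2 * a 1) + f 4 * (a 0 ^ 2 * a 2)
  + f 5 * (a 1 ^ 2 * a 0) + f 6 * (a 1 ^ 2 * a 2)
  + f 7 * (a 2 ^ 2 * a 0) + f 8 * (a 2 ^ 2 * a 1)
  + f 9 * (a 0 * a 1 * a 2)

def cf0 {R : Type*} [CommRing R] (f : Fin 10 → R) (a : Fin 3 → R) : R :=
  3 * f 0 * a 0 ^ 2 + 2 * f 3 * (a 0 * a 1) + 2 * f 4 * (a 0 * a 2)
  + f 5 * a 1 ^ 2 + f 7 * a 2 ^ 2 + f 9 * (a 1 * a 2)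

def cf1 {R : Type*} [CommRing R] (f : Fin 10 → R) (a : Fin 3 → R) : R :=
  3 * f 1 * a 1 ^ 2 + f 3 * a 0 ^ 2 + 2 * f 5 * (a 1 * a 0) + 2 * f 6 * (a 1 * a 2)
  + f 8 * a 2 ^ 2 + f 9 * (a 0 * a 2)

def cf2 {R : Type*} [CommRing R] (f : Fin 10 → R) (a : Fin 3 → R) : R :=
  3 * f 2 * a 2 ^ 2 + f 4 * a 0 ^ 2 + f 6 * a 1 ^ 2 + 2 * f 7 * (a 2 * a 0)
  + 2 * f 8 * (a 2 * a 1) + f 9 * (a 0 * a 1)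

/-- polar form -/
def cp {R : Type*} [CommRing R] (f : Fin 10 → R) (a b : Fin 3 → R) : R :=
  cf0 f a * b 0 + cf1 f a * b 1 + cf2 f a * b 2

lemma eval_cub {R : Type*} [CommRing R] (f : Fin 10 → R) (a : Fin 3 → R) :
    eval a (cub f) = cf f a := by
  simp [cub, cf]

lemma pderiv_cub (f : Fin 10 → K) (a : Fin 3 → K) :
    eval a (pderiv 0 (cub f)) = cf0 f a ∧ eval a (pderiv 1 (cub f)) = cf1 f a ∧
    eval a (pderiv 2 (cub f)) = cf2 f a := by
  refine ⟨?_, ?_, ?_⟩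
  · simp [cub, cf0, pderiv_X]; ring
  · simp [cub, cf1, pderiv_X]; ring
  · simp [cub, cf2, pderiv_X]; ring

lemma cub_hom (f : Fin 10 → K) : (cub f).IsHomogeneous 3 := by
  have h : ∀ (c : K) (i j l : Fin 3), (MvPolynomial.C c * (X i * X j * X l) :
      MvPolynomial (Fin 3) K).IsHomogeneous 3 := fun c i j l => by
    have := (((isHomogeneous_X K i).mul (isHomogeneous_X K j)).mul (isHomogeneous_X K l))
    exact this.C_mul c
  unfold cub
  simp only [pow_succ, pow_zero, one_mul]
  repeat' apply IsHomogeneous.add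
  all_goals apply h

lemma exists_cub (F : MvPolynomial (Fin 3) K) (hF : F.IsHomogeneous 3) : ∃ f, F = cub f := by
  obtain ⟨c, rfl⟩ := hom_expand 3 F hF
  refine ⟨![c 3 0, c 0 3, c 0 0, c 2 1, c 2 0, c 1 2, c 0 2, c 1 0, c 0 1, c 1 1], ?_⟩
  simp [Finset.sum_range_succ, cub]
  ring

lemma lineRestrict_cub (f : Fin 10 → K) (a b : Fin 3 → K) :
    lineRestrict (cub f) a b = Polynomial.C (cf f a) + Polynomial.C (cp f a b) * Polynomial.X
      + Polynomial.C (cp f b a) * Polynomial.X ^ 2 + Polynomial.C (cf f b) * Polynomial.X ^ 3 := by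
  simp [lineRestrict, cub, cf, cp, cf0, cf1, cf2, map_ofNat]
  ring

lemma map_cub {R S : Type*} [CommRing R] [CommRing S] (φ : R →+* S) (f : Fin 10 → R) :
    MvPolynomial.map φ (cub f) = cub (fun i => φ (f i)) := by
  simp [cub]

lemma aeval_cub {R S : Type*} [CommRing R] [CommRing S] [Algebra R S] (f : Fin 10 → R)
    (a : Fin 3 → S) :
    MvPolynomial.aeval a (cub f) = cf (fun i => algebraMap R S (f i)) a := by
  simp [cub, cf]

/-- flex line criterion -/
lemma infl_iff (f : Fin 10 → K) (w : Fin 3 → K) :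
    IsInflLine (cub f) w ↔ w ≠ 0 ∧ ∃ a b : Fin 3 → K, dotv w a = 0 ∧ dotv w b = 0 ∧
      LinearIndependent K ![a, b] ∧ cf f a = 0 ∧ cp f a b = 0 ∧ cp f b a = 0 ∧ cf f b ≠ 0 := by
  unfold IsInflLine contactAt
  refine and_congr_right fun hw => exists_congr fun a => exists_congr fun b => ?_
  refine and_congr_right fun _ => and_congr_right fun _ => and_congr_right fun _ => ?_
  constructor
  · rintro ⟨h0, h3⟩
    rw [Polynomial.le_rootMultiplicity_iff h0] at h3
    simp only [map_zero, sub_zero] at h3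
    rw [Polynomial.X_pow_dvd_iff] at h3
    rw [lineRestrict_cub] at h3 h0
    have e0 := h3 0 (by norm_num)
    have e1 := h3 1 (by norm_num)
    have e2 := h3 2 (by norm_num)
    simp [Polynomial.coeff_X, Polynomial.coeff_C, Polynomial.coeff_X_pow] at e0 e1 e2
    refine ⟨e0, e1, e2, ?_⟩
    intro h
    rw [e0, e1, e2, h] at h0
    simp at h0
  · rintro ⟨e0, e1, e2, e3⟩
    have h0 : lineRestrict (cub f) a b ≠ 0 := by
      rw [lineRestrict_cub, e0, e1, e2]; simpa using e3
    refine ⟨h0, ?_⟩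
    rw [Polynomial.le_rootMultiplicity_iff h0, lineRestrict_cub, e0, e1, e2]
    simp

/-- first two coefficients of restriction -/
lemma lineRestrict_coeff (G : MvPolynomial (Fin 3) K) (a b : Fin 3 → K) :
    (lineRestrict G a b).coeff 0 = eval a G ∧
    (lineRestrict G a b).coeff 1 = ∑ i, eval a (pderiv i G) * b i := by
  induction G using MvPolynomial.induction_on with
  | C c => simp [lineRestrict, Polynomial.coeff_C]
  | add p q hp hq =>
    simp only [lineRestrict, map_add, Polynomial.coeff_add, add_mul, Finset.sum_add_distrib] at *
    exact ⟨by rw [hp.1, hq.1], by rw [hp.2, hq.2]⟩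
  | mul_X p i hp =>
    simp only [lineRestrict, map_mul, MvPolynomial.aeval_X, Derivation.leibniz, map_add,
      smul_eq_mul, MvPolynomial.eval_X] at *
    rw [Polynomial.mul_coeff_zero, Polynomial.mul_coeff_one, hp.1, hp.2]
    simp only [Polynomial.coeff_add, Polynomial.coeff_C_zero, Polynomial.coeff_mul_X_zero, add_zero]
    refine ⟨trivial, ?_⟩
    rw [show (Polynomial.C (a i) : Polynomial K).coeff 1 = 0 by simp [Polynomial.coeff_C],
      show (Polynomial.C (b i) * Polynomial.X : Polynomial K).coeff 1 = b i by simp]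
    simp only [pderiv_X, Fin.sum_univ_three]
    fin_cases i <;> simp <;> ring

lemma transform_eval (g : Matrix (Fin 3) (Fin 3) K) (F : MvPolynomial (Fin 3) K) (v : Fin 3 → K) :
    eval v (transformPoly g F) = eval (g.mulVec v) F := by
  induction F using MvPolynomial.induction_on with
  | C c => simp [transformPoly]
  | add p q hp hq => simp only [transformPoly, map_add] at *; rw [hp, hq]
  | mul_X p i hp =>
    simp only [transformPoly, map_mul, MvPolynomial.aeval_X, MvPolynomial.eval_X] at *
    rw [hp]; simp [Matrix.mulVec, dotProduct]

lemma transform_lineRestrict (g : Matrix (Fin 3) (Fin 3) K) (F : MvPolynomial (Fin 3) K)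
    (a b : Fin 3 → K) :
    lineRestrict (transformPoly g F) a b = lineRestrict F (g.mulVec a) (g.mulVec b) := by
  induction F using MvPolynomial.induction_on with
  | C c => simp [transformPoly, lineRestrict]
  | add p q hp hq => simp only [transformPoly, lineRestrict, map_add] at *; rw [hp, hq]
  | mul_X p i hp =>
    simp only [transformPoly, lineRestrict, map_mul, MvPolynomial.aeval_X] at *
    rw [hp]
    congr 1
    simp only [Matrix.mulVec, dotProduct, map_add, map_mul, MvPolynomial.aeval_X,
      MvPolynomial.algHom_C, Polynomial.algebraMap_eq, Fin.sum_univ_three]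
    ring

lemma transform_mul (g h : Matrix (Fin 3) (Fin 3) K) (F : MvPolynomial (Fin 3) K) :
    transformPoly h (transformPoly g F) = transformPoly (g * h) F := by
  induction F using MvPolynomial.induction_on with
  | C c => simp [transformPoly]
  | add p q hp hq => simp only [transformPoly, map_add] at *; rw [hp, hq]
  | mul_X p i hp =>
    simp only [transformPoly, map_mul, MvPolynomial.aeval_X] at *
    rw [hp]
    congr 1
    simp only [Matrix.mul_apply, map_sum, map_mul, MvPolynomial.aeval_X,
      MvPolynomial.algHom_C, MvPolynomial.algebraMap_eq, Fin.sum_univ_three, map_add]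
    ring

lemma transform_one (F : MvPolynomial (Fin 3) K) : transformPoly 1 F = F := by
  induction F using MvPolynomial.induction_on with
  | C c => simp [transformPoly]
  | add p q hp hq => simp only [transformPoly, map_add] at *; rw [hp, hq]
  | mul_X p i hp =>
    simp only [transformPoly, map_mul, MvPolynomial.aeval_X] at *
    rw [hp]
    simp [Matrix.one_apply]

lemma transform_hom (g : Matrix (Fin 3) (Fin 3) K) (F : MvPolynomial (Fin 3) K) (d : ℕ)
    (hF : F.IsHomogeneous d) : (transformPoly g F).IsHomogeneous d := by
  have := hF.aeval (fun i => ∑ j, MvPolynomial.C (g i j) * X j) (n := 1) (fun i => by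
    refine IsHomogeneous.sum _ _ _ fun j _ => ?_
    exact isHomogeneous_C_mul_X _ _)
  simpa [transformPoly] using this

lemma transform_add (g : Matrix (Fin 3) (Fin 3) K) (F G : MvPolynomial (Fin 3) K) :
    transformPoly g (F + G) = transformPoly g F + transformPoly g G := by
  simp [transformPoly]

lemma transform_smul (g : Matrix (Fin 3) (Fin 3) K) (c : K) (F : MvPolynomial (Fin 3) K) :
    transformPoly g (c • F) = c • transformPoly g F := by
  simp [transformPoly]

lemma lineRestrict_smul (c : K) (F : MvPolynomial (Fin 3) K) (a b : Fin 3 → K) :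
    lineRestrict (c • F) a b = c • lineRestrict F a b := by
  simp [lineRestrict]

lemma lineRestrict_add (F G : MvPolynomial (Fin 3) K) (a b : Fin 3 → K) :
    lineRestrict (F + G) a b = lineRestrict F a b + lineRestrict G a b := by
  simp [lineRestrict]

lemma linInd_mulVec (g : GL (Fin 3) K) {n : ℕ} (a : Fin n → Fin 3 → K)
    (h : LinearIndependent K a) :
    LinearIndependent K (fun i => (g : Matrix (Fin 3) (Fin 3) K).mulVec (a i)) := by
  refine h.map' (Matrix.mulVecLin (g : Matrix (Fin 3) (Fin 3) K)) ?_
  rw [LinearMap.ker_eq_bot]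
  intro x y hxy
  have := congrArg ((g⁻¹ : GL (Fin 3) K) : Matrix (Fin 3) (Fin 3) K).mulVec hxy
  simpa [Matrix.mulVec_mulVec, ← Units.val_mul] using this

lemma linInd_mulVec2 (g : GL (Fin 3) K) (a b : Fin 3 → K)
    (h : LinearIndependent K ![a, b]) :
    LinearIndependent K ![(g : Matrix (Fin 3) (Fin 3) K).mulVec a,
      (g : Matrix (Fin 3) (Fin 3) K).mulVec b] := by
  convert linInd_mulVec g _ h using 1
  ext i; fin_cases i <;> rfl

lemma dotv_mulVec (g : Matrix (Fin 3) (Fin 3) K) (w a : Fin 3 → K) :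
    dotv w (g.mulVec a) = dotv (g.transpose.mulVec w) a := by
  simp [dotv, Matrix.mulVec, dotProduct, Fin.sum_univ_three]
  ring

lemma infl_transform_aux (g : GL (Fin 3) K) (F : MvPolynomial (Fin 3) K) (w : Fin 3 → K)
    (h : IsInflLine (transformPoly (g : Matrix (Fin 3) (Fin 3) K) F)
      ((g : Matrix (Fin 3) (Fin 3) K).transpose.mulVec w)) : IsInflLine F w := by
  obtain ⟨h0, a, b, ha, hb, hab, h1, h2⟩ := h
  refine ⟨?_, (g : Matrix (Fin 3) (Fin 3) K).mulVec a, (g : Matrix (Fin 3) (Fin 3) K).mulVec b,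
    ?_, ?_, linInd_mulVec2 g a b hab, ?_, ?_⟩
  · rintro rfl; simp at h0
  · rwa [dotv_mulVec]
  · rwa [dotv_mulVec]
  · rwa [← transform_lineRestrict]
  · unfold contactAt at *
    rwa [← transform_lineRestrict]

lemma infl_transform (g : GL (Fin 3) K) (F : MvPolynomial (Fin 3) K) (w : Fin 3 → K) :
    IsInflLine (transformPoly (g : Matrix (Fin 3) (Fin 3) K) F)
      ((g : Matrix (Fin 3) (Fin 3) K).transpose.mulVec w) ↔ IsInflLine F w := by
  refine ⟨infl_transform_aux g F w, fun h => ?_⟩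
  apply infl_transform_aux g⁻¹
  have h1 : (g : Matrix (Fin 3) (Fin 3) K) * ((g⁻¹ : GL (Fin 3) K) : Matrix (Fin 3) (Fin 3) K) = 1 := by
    rw [← Units.val_mul]; simp
  rw [transform_mul, Matrix.mulVec_mulVec, ← Matrix.transpose_mul, h1]
  simpa [transform_one] using h

lemma infl_smul (c : K) (hc : c ≠ 0) (F : MvPolynomial (Fin 3) K) (w : Fin 3 → K) :
    IsInflLine (c • F) w ↔ IsInflLine F w := by
  unfold IsInflLine contactAt
  simp only [lineRestrict_smul]
  refine and_congr_right fun hw => exists_congr fun a => exists_congr fun b => ?_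
  refine and_congr_right fun _ => and_congr_right fun _ => and_congr_right fun _ => ?_
  have : ∀ p : Polynomial K, (c • p).rootMultiplicity 0 = p.rootMultiplicity 0 := by
    intro p
    by_cases hp : p = 0
    · simp [hp]
    · rw [Polynomial.smul_eq_C_mul, Polynomial.rootMultiplicity_mul (by simp [hc, hp])]
      simp
  simp [this, hc]

end basics

section krull
variable {K : Type*} [Field K] 

def phiHom (K : Type*) [Field K] (n : ℕ) : MvPolynomial (Fin 3) K →ₐ[K] MvPolynomial (Fin 3) K :=
  MvPolynomial.aeval (fun i : Fin 3 => if (i : ℕ) < n then 0 else X i)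

lemma phiHom_comp (n : ℕ) (p : MvPolynomial (Fin 3) K) :
    phiHom K (n+1) (phiHom K n p) = phiHom K (n+1) p := by
  have : (phiHom K (n+1)).comp (phiHom K n) = phiHom K (n+1) := by
    apply MvPolynomial.algHom_ext
    intro i
    simp only [phiHom, AlgHom.comp_apply, MvPolynomial.aeval_X]
    split_ifs with h1 h2
    · simp
    · omega
    · simp [h1] at *; omega
    · simp_all
  exact congrArg (fun f => f p) this

lemma phi_lt (n : ℕ) (hn : n < 3) :
    RingHom.ker (phiHom K n) < RingHom.ker (phiHom K (n+1)) := by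
  refine lt_of_le_of_ne ?_ ?_
  · intro p hp
    rw [RingHom.mem_ker] at *
    rw [← phiHom_comp, hp, map_zero]
  · intro h
    have h1 : (X ⟨n, hn⟩ : MvPolynomial (Fin 3) K) ∈ RingHom.ker (phiHom K (n+1)) := by
      simp [RingHom.mem_ker, phiHom]
    rw [← h] at h1
    simp [RingHom.mem_ker, phiHom] at h1

lemma three_le_height : (3 : ℕ∞) ≤ (RingHom.ker (phiHom K 3)).height := by
  have := RingHom.ker_isPrime (phiHom K 0)
  have := RingHom.ker_isPrime (phiHom K 1)
  have := RingHom.ker_isPrime (phiHom K 2)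
  have := RingHom.ker_isPrime (phiHom K 3)
  have h1 := Ideal.height_add_one_le_of_lt_of_isPrime (phi_lt (K := K) 0 (by norm_num))
  have h2 := Ideal.height_add_one_le_of_lt_of_isPrime (phi_lt (K := K) 1 (by norm_num))
  have h3 := Ideal.height_add_one_le_of_lt_of_isPrime (phi_lt (K := K) 2 (by norm_num))
  calc (3 : ℕ∞) = 0 + 1 + 1 + 1 := by norm_num
    _ ≤ (RingHom.ker (phiHom K 0)).height + 1 + 1 + 1 := by gcongr; exact bot_le
    _ ≤ (RingHom.ker (phiHom K 1)).height + 1 + 1 := by gcongr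
    _ ≤ (RingHom.ker (phiHom K 2)).height + 1 := by gcongr
    _ ≤ _ := h3

lemma common_zero [IsAlgClosed K] (F G : MvPolynomial (Fin 3) K) (hF : eval 0 F = 0)
    (hG : eval 0 G = 0) : ∃ p : Fin 3 → K, p ≠ 0 ∧ eval p F = 0 ∧ eval p G = 0 := by
  by_contra hcon
  push Not at hcon
  set I : Ideal (MvPolynomial (Fin 3) K) := Ideal.span {F, G}
  have hm : ∀ p, p ∈ RingHom.ker (phiHom K 3) ↔ eval 0 p = 0 := by
    intro p
    rw [RingHom.mem_ker]
    have : phiHom K 3 p = MvPolynomial.C (eval 0 p) := by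
      induction p using MvPolynomial.induction_on with
      | C c => simp [phiHom]
      | add p q hp hq => simp [hp, hq]
      | mul_X p i hp => simp [phiHom]
    rw [this]; simp
  have hz : zeroLocus K I = {0} := by
    ext x
    rw [zeroLocus_span]
    simp only [Set.mem_setOf_eq, Set.mem_insert_iff, Set.mem_singleton_iff, forall_eq_or_imp,
      forall_eq, MvPolynomial.coe_aeval_eq_eval, MvPolynomial.aeval_eq_eval]
    constructor
    · rintro ⟨h1, h2⟩
      by_contra hx
      exact hcon x hx h1 h2
    · rintro rfl
      exact ⟨hF, hG⟩
  have hrad : I.radical = RingHom.ker (phiHom K 3) := by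
    rw [← vanishingIdeal_zeroLocus_eq_radical (K := K), hz]
    ext p
    rw [hm, mem_vanishingIdeal_singleton_iff]
    simp [MvPolynomial.aeval_eq_eval]
  have hpr := RingHom.ker_isPrime (phiHom K 3)
  have hmin : RingHom.ker (phiHom K 3) ∈ I.minimalPrimes := by
    refine ⟨⟨hpr, hrad ▸ Ideal.le_radical⟩, ?_⟩
    rintro J ⟨hJ, hIJ⟩ _
    rw [← hrad]
    exact hJ.radical_le_iff.2 hIJ
  have h2 := Ideal.height_le_card_of_mem_minimalPrimes_span (by simp) hmin
  have h3 := (three_le_height (K := K)).trans h2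
  have h4 : ({F, G} : Set (MvPolynomial (Fin 3) K)).ncard ≤ 2 := by
    exact Set.ncard_insert_le F {G} |>.trans (by simp)
  have h5 : 3 ≤ ({F, G} : Set (MvPolynomial (Fin 3) K)).ncard := by exact_mod_cast h3
  omega

end krull

section flex1
variable {K : Type*} [Field K]

/-- integral Hessian covariant of a cubic -/
def hs {R : Type*} [CommRing R] (f : Fin 10 → R) (a : Fin 3 → R) : R :=
  let α := 3 * f 0 * a 0 + f 3 * a 1 + f 4 * a 2
  let β := f 5 * a 0 + 3 * f 1 * a 1 + f 6 * a 2
  let δ := f 7 * a 0 + f 8 * a 1 + 3 * f 2 * a 2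
  let γ3 := f 3 * a 0 + f 5 * a 1
  let γ2 := f 4 * a 0 + f 7 * a 2
  let γ1 := f 6 * a 1 + f 8 * a 2;
  -(α * β * δ + f 9 ^ 3 * (a 0 * a 1 * a 2)
    + f 9 ^ 2 * (γ1 * a 1 * a 2 + γ2 * a 0 * a 2 + γ3 * a 0 * a 1)
    + f 9 * (γ1 * γ2 * a 2 + γ1 * γ3 * a 1 + γ2 * γ3 * a 0) + 2 * γ1 * γ2 * γ3
    - α * (f 9 * a 0 * γ1 + γ1 ^ 2) - β * (f 9 * a 1 * γ2 + γ2 ^ 2)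
    - δ * (f 9 * a 2 * γ3 + γ3 ^ 2))

lemma hs_id2 (f : Fin 10 → K) (a : Fin 3 → K) :
    cp f ![cf1 f a, - cf0 f a, 0] a = a 2 ^ 2 * hs f a + 3 * cf f a *
      ((3 * f 0 * a 0 + f 3 * a 1 + f 4 * a 2) * (f 5 * a 0 + 3 * f 1 * a 1 + f 6 * a 2)
        - (f 3 * a 0 + f 5 * a 1) * f 9 * a 2 - (f 3 * a 0 + f 5 * a 1) ^ 2) := by
  simp only [cp, cf0, cf1, cf2, hs, cf, Matrix.cons_val_zero, Matrix.cons_val_one, Matrix.cons_val]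
  ring

lemma hs_id0 (f : Fin 10 → K) (a : Fin 3 → K) :
    cp f ![0, cf2 f a, - cf1 f a] a = a 0 ^ 2 * hs f a + 3 * cf f a *
      ((f 5 * a 0 + 3 * f 1 * a 1 + f 6 * a 2) * (f 7 * a 0 + f 8 * a 1 + 3 * f 2 * a 2)
        - (f 6 * a 1 + f 8 * a 2) * f 9 * a 0 - (f 6 * a 1 + f 8 * a 2) ^ 2) := by
  simp only [cp, cf0, cf1, cf2, hs, cf, Matrix.cons_val_zero, Matrix.cons_val_one, Matrix.cons_val]
  ring

lemma hs_id1 (f : Fin 10 → K) (a : Fin 3 → K) :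
    cp f ![cf2 f a, 0, - cf0 f a] a = a 1 ^ 2 * hs f a + 3 * cf f a *
      ((3 * f 0 * a 0 + f 3 * a 1 + f 4 * a 2) * (f 7 * a 0 + f 8 * a 1 + 3 * f 2 * a 2)
        - (f 4 * a 0 + f 7 * a 2) * f 9 * a 1 - (f 4 * a 0 + f 7 * a 2) ^ 2) := by
  simp only [cp, cf0, cf1, cf2, hs, cf, Matrix.cons_val_zero, Matrix.cons_val_one, Matrix.cons_val]
  ring

lemma exists_hs_zero [IsAlgClosed K] (f : Fin 10 → K) :
    ∃ p : Fin 3 → K, p ≠ 0 ∧ cf f p = 0 ∧ hs f p = 0 := by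
  have e : ∀ p : Fin 3 → K, eval p (hs (fun i => MvPolynomial.C (f i)) (fun i => X i)) = hs f p := by
    intro p
    simp [hs]
  obtain ⟨p, hp, h1, h2⟩ := common_zero (cub f) (hs (fun i => MvPolynomial.C (f i)) (fun i => X i))
    (by rw [eval_cub]; simp [cf]) (by rw [e]; simp [hs])
  rw [e] at h2
  rw [eval_cub] at h1
  exact ⟨p, hp, h1, h2⟩

lemma euler (f : Fin 10 → K) (a : Fin 3 → K) : cp f a a = 3 * cf f a := by
  simp only [cp, cf0, cf1, cf2, cf]; ring

def Smooth (f : Fin 10 → K) : Prop :=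
  ∀ p : Fin 3 → K, p ≠ 0 → cf f p = 0 → cf0 f p ≠ 0 ∨ cf1 f p ≠ 0 ∨ cf2 f p ≠ 0

lemma quad_root [IsAlgClosed K] (A B C : K) :
    ∃ x y : K, (x ≠ 0 ∨ y ≠ 0) ∧ A * x ^ 2 + B * x * y + C * y ^ 2 = 0 := by
  by_cases hA : A = 0
  · exact ⟨1, 0, by simp, by simp [hA]⟩
  · obtain ⟨x, hx⟩ := IsAlgClosed.exists_root (Polynomial.C A * Polynomial.X ^ 2 +
      Polynomial.C B * Polynomial.X + Polynomial.C C) (by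
        rw [Polynomial.degree_quadratic hA]; norm_num)
    refine ⟨x, 1, by simp, ?_⟩
    simp at hx
    linear_combination hx

lemma linInd_iff (a b : Fin 3 → K) : LinearIndependent K ![a, b] ↔
    (a 1 * b 2 - a 2 * b 1 ≠ 0 ∨ a 2 * b 0 - a 0 * b 2 ≠ 0 ∨ a 0 * b 1 - a 1 * b 0 ≠ 0) := by
  rw [← crossProduct_ne_zero_iff_linearIndependent, cross_apply, Ne, funext_iff]
  simp [Fin.forall_fin_succ]
  tauto

lemma cf_comb (f : Fin 10 → K) (a b : Fin 3 → K) (x y : K) :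
    cf f (x • a + y • b) = x ^ 3 * cf f a + x ^ 2 * y * cp f a b + x * y ^ 2 * cp f b a
      + y ^ 3 * cf f b := by
  simp only [cp, cf0, cf1, cf2, cf, Pi.add_apply, Pi.smul_apply, smul_eq_mul]; ring

lemma cp_comb (f : Fin 10 → K) (a b : Fin 3 → K) (x y : K) :
    cp f (x • a + y • b) a = 3 * x ^ 2 * cf f a + 2 * x * y * cp f a b + y ^ 2 * cp f b a := by
  simp only [cp, cf0, cf1, cf2, cf, Pi.add_apply, Pi.smul_apply, smul_eq_mul]; ring

lemma cp_comb' (f : Fin 10 → K) (a b : Fin 3 → K) (x y : K) :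
    cp f (x • a + y • b) b = x ^ 2 * cp f a b + 2 * x * y * cp f b a + 3 * y ^ 2 * cf f b := by
  simp only [cp, cf0, cf1, cf2, cf, Pi.add_apply, Pi.smul_apply, smul_eq_mul]; ring

lemma comb_ne (a b : Fin 3 → K) (h : LinearIndependent K ![a, b]) (x y : K)
    (hxy : x ≠ 0 ∨ y ≠ 0) : x • a + y • b ≠ 0 := by
  intro h0
  rw [LinearIndependent.pair_iff] at h
  have := h x y h0
  tauto

lemma no_line [IsAlgClosed K] (f : Fin 10 → K) (hs : Smooth f) (a b : Fin 3 → K)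
    (hab : LinearIndependent K ![a, b]) (h0 : cf f a = 0) (h1 : cp f a b = 0)
    (h2 : cp f b a = 0) (h3 : cf f b = 0) : False := by
  have key : ∀ x y : K, (x ≠ 0 ∨ y ≠ 0) → cf0 f (x • a + y • b) ≠ 0 ∨
      cf1 f (x • a + y • b) ≠ 0 ∨ cf2 f (x • a + y • b) ≠ 0 := fun x y hxy =>
    hs _ (comb_ne a b hab x y hxy) (by rw [cf_comb, h0, h1, h2, h3]; ring)
  have ka : ∀ x y : K, cp f (x • a + y • b) a = 0 := fun x y => by
    rw [cp_comb, h0, h1, h2]; ring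
  have kb : ∀ x y : K, cp f (x • a + y • b) b = 0 := fun x y => by
    rw [cp_comb', h3, h1, h2]; ring
  rw [linInd_iff] at hab
  rcases hab with hw | hw | hw
  · obtain ⟨x, y, hxy, hq⟩ := quad_root (cf0 f a) (cf0 f (a+b) - cf0 f a - cf0 f b) (cf0 f b)
    have e : cf0 f (x • a + y • b) = 0 := by
      rw [← hq]; simp only [cf0, Pi.add_apply, Pi.smul_apply, smul_eq_mul]; ring
    have k1 := ka x y
    have k2 := kb x y
    simp only [cp, e, zero_mul, zero_add] at k1 k2
    have z1 : cf1 f (x • a + y • b) = 0 := by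
      apply (mul_eq_zero.1 (?_ : _ * (a 1 * b 2 - a 2 * b 1) = 0)).resolve_right hw
      linear_combination b 2 * k1 - a 2 * k2
    have z2 : cf2 f (x • a + y • b) = 0 := by
      apply (mul_eq_zero.1 (?_ : _ * (a 1 * b 2 - a 2 * b 1) = 0)).resolve_right hw
      linear_combination a 1 * k2 - b 1 * k1
    have := key x y hxy
    simp [e, z1, z2] at this
  · obtain ⟨x, y, hxy, hq⟩ := quad_root (cf1 f a) (cf1 f (a+b) - cf1 f a - cf1 f b) (cf1 f b)
    have e : cf1 f (x • a + y • b) = 0 := by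
      rw [← hq]; simp only [cf1, Pi.add_apply, Pi.smul_apply, smul_eq_mul]; ring
    have k1 := ka x y
    have k2 := kb x y
    simp only [cp, e, zero_mul, add_zero] at k1 k2
    have z1 : cf0 f (x • a + y • b) = 0 := by
      apply (mul_eq_zero.1 (?_ : _ * (a 2 * b 0 - a 0 * b 2) = 0)).resolve_right hw
      linear_combination a 2 * k2 - b 2 * k1
    have z2 : cf2 f (x • a + y • b) = 0 := by
      apply (mul_eq_zero.1 (?_ : _ * (a 2 * b 0 - a 0 * b 2) = 0)).resolve_right hw
      linear_combination b 0 * k1 - a 0 * k2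
    have := key x y hxy
    simp [e, z1, z2] at this
  · obtain ⟨x, y, hxy, hq⟩ := quad_root (cf2 f a) (cf2 f (a+b) - cf2 f a - cf2 f b) (cf2 f b)
    have e : cf2 f (x • a + y • b) = 0 := by
      rw [← hq]; simp only [cf2, Pi.add_apply, Pi.smul_apply, smul_eq_mul]; ring
    have k1 := ka x y
    have k2 := kb x y
    simp only [cp, e, zero_mul, add_zero] at k1 k2
    have z1 : cf0 f (x • a + y • b) = 0 := by
      apply (mul_eq_zero.1 (?_ : _ * (a 0 * b 1 - a 1 * b 0) = 0)).resolve_right hw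
      linear_combination b 1 * k1 - a 1 * k2
    have z2 : cf1 f (x • a + y • b) = 0 := by
      apply (mul_eq_zero.1 (?_ : _ * (a 0 * b 1 - a 1 * b 0) = 0)).resolve_right hw
      linear_combination a 0 * k2 - b 0 * k1
    have := key x y hxy
    simp [e, z1, z2] at this

lemma exists_flex [IsAlgClosed K] (f : Fin 10 → K) (hs : Smooth f) :
    ∃ a b : Fin 3 → K, LinearIndependent K ![a, b] ∧ cf f a = 0 ∧ cp f a b = 0 ∧ cp f b a = 0 ∧
      cf f b ≠ 0 := by
  obtain ⟨a, ha, h0, hh⟩ := exists_hs_zero f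
  have hsm := hs a ha h0
  have eu := euler f a
  rw [h0, mul_zero] at eu
  simp only [cp] at eu
  suffices h : ∃ b : Fin 3 → K, LinearIndependent K ![a, b] ∧ cp f a b = 0 ∧ cp f b a = 0 by
    obtain ⟨b, hab, h1, h2⟩ := h
    exact ⟨a, b, hab, h0, h1, h2, fun h3 => no_line f hs a b hab h0 h1 h2 h3⟩
  have hne : a 0 ≠ 0 ∨ a 1 ≠ 0 ∨ a 2 ≠ 0 := by
    by_contra h
    push Not at h
    apply ha
    ext i; fin_cases i
    · exact h.1
    · exact h.2.1
    · exact h.2.2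
  rcases hne with h | h | h
  · refine ⟨![0, cf2 f a, - cf1 f a], ?_, ?_, ?_⟩
    · rw [linInd_iff]
      simp only [Matrix.cons_val_zero, Matrix.cons_val_one, Matrix.cons_val]
      by_contra hc
      push Not at hc
      obtain ⟨_, c1, c2⟩ := hc
      have d1 : cf1 f a = 0 := by
        apply (mul_eq_zero.1 (?_ : _ * a 0 = 0)).resolve_right h; linear_combination c1
      have d2 : cf2 f a = 0 := by
        apply (mul_eq_zero.1 (?_ : _ * a 0 = 0)).resolve_right h; linear_combination c2
      rw [d1, d2] at eu
      simp [d1, d2, h] at hsm eu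
      exact hsm eu
    · simp [cp]; ring
    · rw [hs_id0, h0, hh]; ring
  · refine ⟨![cf2 f a, 0, - cf0 f a], ?_, ?_, ?_⟩
    · rw [linInd_iff]
      simp only [Matrix.cons_val_zero, Matrix.cons_val_one, Matrix.cons_val]
      by_contra hc
      push Not at hc
      obtain ⟨c1, _, c2⟩ := hc
      have d1 : cf0 f a = 0 := by
        apply (mul_eq_zero.1 (?_ : _ * a 1 = 0)).resolve_right h; linear_combination -c1
      have d2 : cf2 f a = 0 := by
        apply (mul_eq_zero.1 (?_ : _ * a 1 = 0)).resolve_right h; linear_combination -c2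
      rw [d1, d2] at eu
      simp [d1, d2, h] at hsm eu
      exact hsm eu
    · simp [cp]; ring
    · rw [hs_id1, h0, hh]; ring
  · refine ⟨![cf1 f a, - cf0 f a, 0], ?_, ?_, ?_⟩
    · rw [linInd_iff]
      simp only [Matrix.cons_val_zero, Matrix.cons_val_one, Matrix.cons_val]
      by_contra hc
      push Not at hc
      obtain ⟨c1, c2, _⟩ := hc
      have d1 : cf0 f a = 0 := by
        apply (mul_eq_zero.1 (?_ : _ * a 2 = 0)).resolve_right h; linear_combination c1
      have d2 : cf1 f a = 0 := by
        apply (mul_eq_zero.1 (?_ : _ * a 2 = 0)).resolve_right h; linear_combination c2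
      rw [d1, d2] at eu
      simp [d1, d2, h] at hsm eu
      exact hsm eu
    · simp [cp]; ring
    · rw [hs_id2, h0, hh]; ring

end flex1

section normalform
variable {K : Type*} [Field K]

lemma GL_ne (g : GL (Fin 3) K) (p : Fin 3 → K) (hp : p ≠ 0) :
    (g : Matrix (Fin 3) (Fin 3) K).mulVec p ≠ 0 := by
  intro h
  apply hp
  have := congrArg ((g⁻¹ : GL (Fin 3) K) : Matrix (Fin 3) (Fin 3) K).mulVec h
  rw [Matrix.mulVec_mulVec, ← Units.val_mul] at this
  simpa using this

lemma GL_surj (g : GL (Fin 3) K) (p : Fin 3 → K) :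
    ∃ q, (g : Matrix (Fin 3) (Fin 3) K).mulVec q = p := by
  refine ⟨((g⁻¹ : GL (Fin 3) K) : Matrix (Fin 3) (Fin 3) K).mulVec p, ?_⟩
  rw [Matrix.mulVec_mulVec, ← Units.val_mul]
  simp

lemma cp_transform (f f' : Fin 10 → K) (g : Matrix (Fin 3) (Fin 3) K) (c : K)
    (h : transformPoly g (cub f) = c • cub f') (a b : Fin 3 → K) :
    cf f (g.mulVec a) = c * cf f' a ∧ cp f (g.mulVec a) (g.mulVec b) = c * cp f' a b := by
  have h1 := transform_lineRestrict g (cub f) a b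
  rw [h, lineRestrict_smul, lineRestrict_cub, lineRestrict_cub] at h1
  constructor
  · have := congrArg (fun p => Polynomial.coeff p 0) h1
    simpa using this.symm
  · have := congrArg (fun p => Polynomial.coeff p 1) h1
    simpa [Polynomial.coeff_X, Polynomial.coeff_C] using this.symm

lemma smooth_transform (f f' : Fin 10 → K) (g : GL (Fin 3) K) (c : K) (hc : c ≠ 0)
    (h : transformPoly (g : Matrix (Fin 3) (Fin 3) K) (cub f) = c • cub f') (hs : Smooth f) :
    Smooth f' := by
  intro p hp h0
  by_contra hcon
  push Not at hcon
  obtain ⟨h1, h2, h3⟩ := hcon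
  have hz : ∀ b, cp f ((g : Matrix (Fin 3) (Fin 3) K).mulVec p) b = 0 := by
    intro b
    obtain ⟨q, rfl⟩ := GL_surj g b
    rw [(cp_transform f f' g c h p q).2]
    simp [cp, h1, h2, h3]
  have e0 := hz ![1, 0, 0]
  have e1 := hz ![0, 1, 0]
  have e2 := hz ![0, 0, 1]
  simp [cp] at e0 e1 e2
  have := hs _ (GL_ne g p hp) (by rw [(cp_transform f f' g c h p p).1, h0, mul_zero])
  tauto

lemma transform_of_eval [Infinite K] (f f' : Fin 10 → K) (g : Matrix (Fin 3) (Fin 3) K) (c : K)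
    (h : ∀ v, cf f (g.mulVec v) = c * cf f' v) : transformPoly g (cub f) = c • cub f' := by
  apply MvPolynomial.funext
  intro v
  rw [transform_eval, MvPolynomial.smul_eval, eval_cub, eval_cub, h]

lemma step1 [IsAlgClosed K] (f : Fin 10 → K) (hs : Smooth f) :
    ∃ (g : GL (Fin 3) K) (f' : Fin 10 → K),
      transformPoly (g : Matrix (Fin 3) (Fin 3) K) (cub f) = cub f' ∧ Smooth f' ∧
      f' 0 ≠ 0 ∧ f' 1 = 0 ∧ f' 3 = 0 ∧ f' 5 = 0 ∧ f' 6 ≠ 0 := by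
  obtain ⟨a, b, hab, h0, h1, h2, h3⟩ := exists_flex f hs
  obtain ⟨c, hdet⟩ : ∃ c : Fin 3 → K,
      Matrix.det !![b 0, a 0, c 0; b 1, a 1, c 1; b 2, a 2, c 2] ≠ 0 := by
    rw [linInd_iff] at hab
    rcases hab with h | h | h
    · refine ⟨![1, 0, 0], ?_⟩
      contrapose! h
      simp [Matrix.det_fin_three] at h
      linear_combination -h
    · refine ⟨![0, 1, 0], ?_⟩
      contrapose! h
      simp [Matrix.det_fin_three] at h
      linear_combination -h
    · refine ⟨![0, 0, 1], ?_⟩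
      contrapose! h
      simp [Matrix.det_fin_three] at h
      linear_combination -h
  let g := Matrix.GeneralLinearGroup.mkOfDetNeZero _ hdet
  obtain ⟨f', hf'⟩ := exists_cub _ (transform_hom (g : Matrix (Fin 3) (Fin 3) K) (cub f) 3 (cub_hom f))
  have hg : (g : Matrix (Fin 3) (Fin 3) K) = !![b 0, a 0, c 0; b 1, a 1, c 1; b 2, a 2, c 2] := rfl
  have hsm := smooth_transform f f' g 1 one_ne_zero (by rw [hf', one_smul]) hs
  have tr := cp_transform f f' g 1 (by rw [hf', one_smul])
  have g0 : (g : Matrix (Fin 3) (Fin 3) K).mulVec ![1, 0, 0] = b := by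
    rw [hg]; ext i; fin_cases i <;> simp [Matrix.mulVec, dotProduct, Fin.sum_univ_three]
  have g1 : (g : Matrix (Fin 3) (Fin 3) K).mulVec ![0, 1, 0] = a := by
    rw [hg]; ext i; fin_cases i <;> simp [Matrix.mulVec, dotProduct, Fin.sum_univ_three]
  have t0 := (tr ![1, 0, 0] ![0, 1, 0])
  have t1 := (tr ![0, 1, 0] ![1, 0, 0])
  rw [g0, g1] at t0 t1
  rw [h2] at t0
  rw [h0, h1] at t1
  simp [cf, cp, cf0, cf1, cf2] at t0 t1
  refine ⟨g, f', hf', hsm, ?_, t1.1.symm, t0.2.symm, t1.2.symm, ?_⟩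
  · rw [← t0.1]; exact h3
  · have := hsm ![0, 1, 0] (by intro h; have := congrFun h 1; simp at this)
    simp [cf, cf0, cf1, cf2, t1.1.symm, t1.2.symm] at this
    exact this

lemma step2 [IsAlgClosed K] (h3 : (3 : K) ≠ 0) (A α β δ d e f : K) (hA : A ≠ 0) (hα : α ≠ 0) :
    ∃ m n r : K, α * m ^ 2 + β * m + d = -3 * A * r ∧
      2 * α * m * n + β * n + δ * m + e = 3 * A * r ^ 2 ∧
      α * n ^ 2 + δ * n + f = -A * r ^ 3 := by
  let k3 := (3 * A)⁻¹
  have hk3 : k3 * (3 * A) = 1 := inv_mul_cancel₀ (mul_ne_zero h3 hA)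
  have hk0 : k3 ≠ 0 := inv_ne_zero (mul_ne_zero h3 hA)
  let R : Polynomial K := Polynomial.C (-k3 * α) * Polynomial.X ^ 2 +
    Polynomial.C (-k3 * β) * Polynomial.X + Polynomial.C (-k3 * d)
  let N : Polynomial K := Polynomial.C (3 * A) * R ^ 2 - Polynomial.C e - Polynomial.C δ * Polynomial.X
  let T : Polynomial K := Polynomial.C (2 * α) * Polynomial.X + Polynomial.C β
  let P : Polynomial K := Polynomial.C α * N ^ 2 + Polynomial.C δ * N * T +
    (Polynomial.C f + Polynomial.C A * R ^ 3) * T ^ 2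
  have hdeg : P.natDegree = 8 := by
    simp only [P, N, T, R]; compute_degree
    · have : 3 * A * k3 = 1 := by linear_combination hk3
      have e : α * (3 * A * (k3 * α) ^ 2) ^ 2 + A * (-(k3 * α)) ^ 3 * (2 * α) ^ 2
          = - (A * k3 ^ 3 * α ^ 5) := by
        linear_combination (3 * A * k3 ^ 3 * α ^ 5) * this
      rw [e, neg_ne_zero]
      exact mul_ne_zero (mul_ne_zero hA (pow_ne_zero 3 hk0)) (pow_ne_zero 5 hα)
    all_goals norm_num
  obtain ⟨m, hm⟩ := IsAlgClosed.exists_root P (by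
    intro h; rw [Polynomial.natDegree_eq_of_degree_eq_some (n := 0) (by simpa using h)] at hdeg
    omega)
  have hm2 : α * (N.eval m) ^ 2 + δ * N.eval m * (2 * α * m + β) +
      (f + A * (R.eval m) ^ 3) * (2 * α * m + β) ^ 2 = 0 := by
    simp only [P, T, Polynomial.IsRoot, Polynomial.eval_add, Polynomial.eval_mul,
      Polynomial.eval_pow, Polynomial.eval_C, Polynomial.eval_X] at hm
    exact hm
  have hN : N.eval m = 3 * A * (R.eval m) ^ 2 - e - δ * m := by
    simp only [N, Polynomial.eval_sub, Polynomial.eval_mul,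
      Polynomial.eval_pow, Polynomial.eval_C, Polynomial.eval_X]
  have hR : R.eval m = - k3 * (α * m ^ 2 + β * m + d) := by
    simp only [R, Polynomial.eval_add, Polynomial.eval_mul,
      Polynomial.eval_pow, Polynomial.eval_C, Polynomial.eval_X]; ring
  generalize N.eval m = n0 at *
  generalize R.eval m = r at *
  have c1 : α * m ^ 2 + β * m + d = -3 * A * r := by
    rw [hR]; linear_combination (- (α * m ^ 2 + β * m + d)) * hk3
  by_cases ht : 2 * α * m + β = 0
  · rw [ht] at hm2
    have hn0 : n0 = 0 := by
      have : α * n0 ^ 2 = 0 := by linear_combination hm2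
      simpa [hα] using this
    obtain ⟨n, hn⟩ := IsAlgClosed.exists_root (Polynomial.C α * Polynomial.X ^ 2 +
      Polynomial.C δ * Polynomial.X + Polynomial.C (f + A * r ^ 3)) (by
        rw [Polynomial.degree_quadratic hα]; norm_num)
    simp at hn
    exact ⟨m, n, r, c1, by linear_combination n * ht - hn0 + hN, by linear_combination hn⟩
  · obtain ⟨n, hn⟩ : ∃ n, n * (2 * α * m + β) = n0 := ⟨n0 / (2 * α * m + β), div_mul_cancel₀ _ ht⟩
    refine ⟨m, n, r, c1, by linear_combination hn + hN, ?_⟩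
    rw [← hn] at hm2
    have : (α * n ^ 2 + δ * n + f + A * r ^ 3) * (2 * α * m + β) ^ 2 = 0 := by
      linear_combination hm2
    have := (mul_eq_zero.1 this).resolve_right (pow_ne_zero 2 ht)
    linear_combination this

lemma step3 [IsAlgClosed K] (h3 : (3 : K) ≠ 0) (f : Fin 10 → K) (hs : Smooth f)
    (f0 : f 0 ≠ 0) (f1 : f 1 = 0) (f3 : f 3 = 0) (f5 : f 5 = 0) (f6 : f 6 ≠ 0) :
    ∃ (g : GL (Fin 3) K) (A α β γ : K), A ≠ 0 ∧ α ≠ 0 ∧ γ ≠ 0 ∧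
      transformPoly (g : Matrix (Fin 3) (Fin 3) K) (cub f) = cub ![A, 0, 0, 0, 0, 0, α, 0, γ, β] := by
  obtain ⟨m, n, r, e1, e2, e3⟩ := step2 h3 (f 0) (f 6) (f 9) (f 8) (f 4) (f 7) (f 2) f0 f6
  have hdet : Matrix.det !![1, 0, r; m, 1, m * r + n; 0, 0, 1] ≠ 0 := by
    simp [Matrix.det_fin_three]
  let g := Matrix.GeneralLinearGroup.mkOfDetNeZero _ hdet
  have hg : (g : Matrix (Fin 3) (Fin 3) K) = !![1, 0, r; m, 1, m * r + n; 0, 0, 1] := rfl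
  haveI : Infinite K := IsAlgClosed.instInfinite
  have ht : transformPoly (g : Matrix (Fin 3) (Fin 3) K) (cub f) = (1 : K) • cub ![f 0, 0, 0, 0, 0, 0,
      f 6, 0, (2 * f 6 * m + f 9) * r + 2 * f 6 * n + f 8, 2 * f 6 * m + f 9] := by
    apply transform_of_eval
    intro v
    rw [hg]
    simp only [cf, Matrix.mulVec, dotProduct, Fin.sum_univ_three, Matrix.of_apply,
      Matrix.cons_val_zero, Matrix.cons_val_one, Matrix.cons_val, f1, f3, f5]
    linear_combination (v 2 * (v 0 + r * v 2) ^ 2) * e1 + (v 2 ^ 2 * (v 0 + r * v 2)) * e2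
      + v 2 ^ 3 * e3
  refine ⟨g, _, _, _, _, f0, f6, ?_, by rw [ht, one_smul]⟩
  have hsm := smooth_transform _ _ g 1 one_ne_zero ht hs
  have := hsm ![0, 0, 1] (by intro h; have := congrFun h 2; simp at this)
  simp [cf, cf0, cf1, cf2] at this
  exact this

def wc (a : K) : WeierstrassCurve K := ⟨a, 0, 1, 0, 0⟩

lemma wpoly_wc (a : K) : wpoly (wc a) = cub ![-1, 0, 0, 0, 0, 0, 1, 0, 1, a] := by
  simp [wpoly, wc, cub]; ring

lemma step4 [IsAlgClosed K] (A α β γ : K) (hA : A ≠ 0) (hα : α ≠ 0) (hγ : γ ≠ 0) :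
    ∃ (g : GL (Fin 3) K) (c a : K), c ≠ 0 ∧
      transformPoly (g : Matrix (Fin 3) (Fin 3) K) (cub ![A, 0, 0, 0, 0, 0, α, 0, γ, β])
        = c • wpoly (wc a) := by
  obtain ⟨p, hp⟩ := IsAlgClosed.exists_pow_nat_eq (α ^ 2 * γ ^ 2 / A) (n := 3) (by norm_num)
  have hp' : A * p ^ 3 = α ^ 2 * γ ^ 2 := by rw [hp]; field_simp
  have hc : α ^ 2 * γ ^ 2 ≠ 0 := mul_ne_zero (pow_ne_zero 2 hα) (pow_ne_zero 2 hγ)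
  have hp0 : p ≠ 0 := by
    rintro rfl
    apply hc; rw [← hp']; ring
  have hdet : Matrix.det !![-p, 0, 0; 0, γ, 0; 0, 0, α] ≠ 0 := by
    simp [Matrix.det_fin_three, hp0, hα, hγ]
  let g := Matrix.GeneralLinearGroup.mkOfDetNeZero _ hdet
  have hg : (g : Matrix (Fin 3) (Fin 3) K) = !![-p, 0, 0; 0, γ, 0; 0, 0, α] := rfl
  haveI : Infinite K := IsAlgClosed.instInfinite
  obtain ⟨a, ha⟩ : ∃ a, α ^ 2 * γ ^ 2 * a = - β * p * γ * α := ⟨- β * p * γ * α / (α ^ 2 * γ ^ 2),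
    by field_simp⟩
  refine ⟨g, α ^ 2 * γ ^ 2, a, hc, ?_⟩
  rw [wpoly_wc]
  apply transform_of_eval
  intro v
  rw [hg]
  simp only [cf, Matrix.mulVec, dotProduct, Fin.sum_univ_three, Matrix.of_apply,
      Matrix.cons_val_zero, Matrix.cons_val_one, Matrix.cons_val]
  linear_combination - v 0 ^ 3 * hp' - (v 0 * v 1 * v 2) * ha

/-- every smooth cubic is projectively `y z (y + z + a x) = x ^ 3` -/
lemma normal_form [IsAlgClosed K] (h3 : (3 : K) ≠ 0) (f : Fin 10 → K) (hs : Smooth f) :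
    ∃ (g : GL (Fin 3) K) (c a : K), c ≠ 0 ∧ a ^ 3 ≠ 27 ∧
      transformPoly (g : Matrix (Fin 3) (Fin 3) K) (cub f) = c • wpoly (wc a) := by
  obtain ⟨g1, f', h1, hs', f0, f1, f3, f5, f6⟩ := step1 f hs
  obtain ⟨g2, A, α, β, γ, hA, hα, hγ, h2⟩ := step3 h3 f' hs' f0 f1 f3 f5 f6
  obtain ⟨g3, c, a, hc, h⟩ := step4 A α β γ hA hα hγ
  have ht : transformPoly ((g1 * g2 * g3 : GL (Fin 3) K) : Matrix (Fin 3) (Fin 3) K) (cub f) =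
      c • wpoly (wc a) := by
    rw [← h, ← h2, ← h1, transform_mul, transform_mul]
    simp [mul_assoc]
  refine ⟨g1 * g2 * g3, c, a, hc, ?_, ht⟩
  intro ha
  rw [wpoly_wc] at ht
  have hsm := smooth_transform _ _ _ _ hc ht hs ![-3, a, a] (by
    intro h; have := congrFun h 0; simp [h3] at this)
  simp only [cf, cf0, cf1, cf2, Matrix.cons_val_zero, Matrix.cons_val_one, Matrix.cons_val] at hsm
  have := hsm (by linear_combination - ha)
  rcases this with h | h | h
  · exact h (by linear_combination ha)
  · exact h (by ring)
  · exact h (by ring)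

def hes (l : K) : Fin 10 → K := ![1, 1, 1, 0, 0, 0, 0, 0, 0, -3 * l]

lemma to_hesse [IsAlgClosed K] (h3 : (3 : K) ≠ 0) (a : K) (ha : a ^ 3 ≠ 27) (o : K)
    (ho : o ^ 2 + o + 1 = 0) :
    ∃ (g : GL (Fin 3) K) (l : K), l ^ 3 ≠ 1 ∧ (a ≠ 0 → l ≠ 0) ∧
      transformPoly (g : Matrix (Fin 3) (Fin 3) K) (wpoly (wc a)) = (-1 : K) • cub (hes l) := by
  obtain ⟨r, hr⟩ := IsAlgClosed.exists_pow_nat_eq (a ^ 3 - 27) (n := 3) (by norm_num)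
  have hr0 : r ≠ 0 := by
    rintro rfl
    apply ha; linear_combination -hr
  obtain ⟨l, hl⟩ : ∃ l, l * r = a := ⟨a / r, div_mul_cancel₀ _ hr0⟩
  obtain ⟨s, hs⟩ : ∃ s, s * r = -3 := ⟨-3 / r, div_mul_cancel₀ _ hr0⟩
  have hs0 : s ≠ 0 := by rintro rfl; apply h3; linear_combination hs
  have h27 : (27 : K) ≠ 0 := by
    have : (27 : K) = 3 ^ 3 := by norm_num
    rw [this]; exact pow_ne_zero 3 h3
  have hls : l ^ 3 + s ^ 3 = 1 := by
    have : (l ^ 3 + s ^ 3 - 1) * r ^ 3 = 0 := by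
      have e1 : (l * r) ^ 3 = a ^ 3 := by rw [hl]
      have e2 : (s * r) ^ 3 = -27 := by rw [hs]; norm_num
      linear_combination e1 + e2 - hr
    have := (mul_eq_zero.1 this).resolve_right (pow_ne_zero 3 hr0)
    linear_combination this
  have has : a * s = - 3 * l := by
    rw [← hl]; linear_combination l * hs
  have hdet : Matrix.det !![s, 0, 0; l, o, o ^ 2; l, o ^ 2, o] ≠ 0 := by
    have : Matrix.det !![s, 0, 0; l, o, o ^ 2; l, o ^ 2, o] = -(s * (2 * o + 1)) := by
      simp [Matrix.det_fin_three]
      linear_combination (s * (o - o ^ 2 + 1)) * ho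
    rw [this, neg_ne_zero]
    refine mul_ne_zero hs0 ?_
    intro h
    apply h3
    linear_combination 4 * ho - (2 * o + 1) * h
  let g := Matrix.GeneralLinearGroup.mkOfDetNeZero _ hdet
  have hg : (g : Matrix (Fin 3) (Fin 3) K) = !![s, 0, 0; l, o, o ^ 2; l, o ^ 2, o] := rfl
  haveI : Infinite K := IsAlgClosed.instInfinite
  refine ⟨g, l, ?_, ?_, ?_⟩
  · intro h
    apply hs0
    have : s ^ 3 = 0 := by linear_combination hls - h
    simpa using this
  · rintro h rfl; apply h; rw [← hl]; ring
  · rw [wpoly_wc]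
    apply transform_of_eval
    intro v
    rw [hg]
    simp only [cf, hes, Matrix.mulVec, dotProduct, Fin.sum_univ_three, Matrix.of_apply,
      Matrix.cons_val_zero, Matrix.cons_val_one, Matrix.cons_val]
    have o2 : o ^ 2 = - o - 1 := by linear_combination ho
    have hy : (l * v 0 + o * v 1 + o ^ 2 * v 2) * (l * v 0 + o ^ 2 * v 1 + o * v 2)
       = l ^ 2 * v 0 ^ 2 + v 1 ^ 2 + v 2 ^ 2 - l * v 0 * v 1 - l * v 0 * v 2 - v 1 * v 2 := by
      rw [o2]
      linear_combination (- v 1 ^ 2 - v 2 ^ 2 + 2 * v 1 * v 2) * ho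
    have hw : (l * v 0 + o * v 1 + o ^ 2 * v 2) + (l * v 0 + o ^ 2 * v 1 + o * v 2) + a * (s * v 0)
       = - (l * v 0 + v 1 + v 2) := by
      rw [o2]
      linear_combination v 0 * has
    linear_combination ((l * v 0 + o * v 1 + o ^ 2 * v 2) * (l * v 0 + o ^ 2 * v 1 + o * v 2)) * hw
      - (l * v 0 + v 1 + v 2) * hy - v 0 ^ 3 * hls

/-- characteristic two, `a = 0`: the `j`-invariant vanishes -/
lemma wc_zero_j (h3 : (3 : K) ≠ 0) (h2 : (2 : K) = 0) :
    ∃ hW : (wc (0 : K)).IsElliptic, (letI := hW; (wc (0 : K)).j = 0) := by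
  have hD : (wc (0 : K)).Δ = -27 := by
    simp [WeierstrassCurve.Δ, wc, WeierstrassCurve.b₂, WeierstrassCurve.b₄, WeierstrassCurve.b₆,
      WeierstrassCurve.b₈]
  have h27 : (-27 : K) ≠ 0 := by
    have : (-27 : K) = - 3 ^ 3 := by norm_num
    rw [this]; exact neg_ne_zero.2 (pow_ne_zero 3 h3)
  refine ⟨⟨by rw [hD]; exact h27.isUnit⟩, ?_⟩
  simp [WeierstrassCurve.j, WeierstrassCurve.c₄, wc, WeierstrassCurve.b₂, WeierstrassCurve.b₄]
end normalform

section hesseA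
variable {K : Type*} [Field K]

/-- ternary sextic with coefficients `c` -/
def sv {R : Type*} [CommRing R] (c : ℕ → ℕ → ℕ → R) (x y z : R) : R :=
    c 6 0 0 * (x^6) + c 5 1 0 * (x^5*y^1) + c 5 0 1 * (x^5*z^1) + c 4 2 0 * (x^4*y^2)
     + c 4 1 1 * (x^4*y^1*z^1) + c 4 0 2 * (x^4*z^2) + c 3 3 0 * (x^3*y^3)
     + c 3 2 1 * (x^3*y^2*z^1) + c 3 1 2 * (x^3*y^1*z^2) + c 3 0 3 * (x^3*z^3)
     + c 2 4 0 * (x^2*y^4) + c 2 3 1 * (x^2*y^3*z^1) + c 2 2 2 * (x^2*y^2*z^2)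
     + c 2 1 3 * (x^2*y^1*z^3) + c 2 0 4 * (x^2*z^4) + c 1 5 0 * (x^1*y^5)
     + c 1 4 1 * (x^1*y^4*z^1) + c 1 3 2 * (x^1*y^3*z^2) + c 1 2 3 * (x^1*y^2*z^3)
     + c 1 1 4 * (x^1*y^1*z^4) + c 1 0 5 * (x^1*z^5) + c 0 6 0 * (y^6) + c 0 5 1 * (y^5*z^1)
     + c 0 4 2 * (y^4*z^2) + c 0 3 3 * (y^3*z^3) + c 0 2 4 * (y^2*z^4) + c 0 1 5 * (y^1*z^5)
     + c 0 0 6 * (z^6)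

/-- its first partial derivative -/
def s1 {R : Type*} [CommRing R] (c : ℕ → ℕ → ℕ → R) (x y z : R) : R :=
    6 * c 6 0 0 * (x^5) + 5 * c 5 1 0 * (x^4*y^1) + 5 * c 5 0 1 * (x^4*z^1)
     + 4 * c 4 2 0 * (x^3*y^2) + 4 * c 4 1 1 * (x^3*y^1*z^1) + 4 * c 4 0 2 * (x^3*z^2)
     + 3 * c 3 3 0 * (x^2*y^3) + 3 * c 3 2 1 * (x^2*y^2*z^1) + 3 * c 3 1 2 * (x^2*y^1*z^2)
     + 3 * c 3 0 3 * (x^2*z^3) + 2 * c 2 4 0 * (x^1*y^4) + 2 * c 2 3 1 * (x^1*y^3*z^1)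
     + 2 * c 2 2 2 * (x^1*y^2*z^2) + 2 * c 2 1 3 * (x^1*y^1*z^3) + 2 * c 2 0 4 * (x^1*z^4)
     + 1 * c 1 5 0 * (y^5) + 1 * c 1 4 1 * (y^4*z^1) + 1 * c 1 3 2 * (y^3*z^2)
     + 1 * c 1 2 3 * (y^2*z^3) + 1 * c 1 1 4 * (y^1*z^4) + 1 * c 1 0 5 * (z^5)

def rot {R : Type*} (c : ℕ → ℕ → ℕ → R) : ℕ → ℕ → ℕ → R := fun i j k => c k i j
def swp {R : Type*} (c : ℕ → ℕ → ℕ → R) : ℕ → ℕ → ℕ → R := fun i j k => c i k j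

def Hyp (l : K) (c : ℕ → ℕ → ℕ → K) : Prop := ∀ t : K, t ^ 3 = 1 →
  sv c l t (t ^ 2) = 0 ∧ s1 c l t (t ^ 2) = 0 ∧ s1 (rot c) t (t ^ 2) l = 0 ∧
    s1 (rot (rot c)) (t ^ 2) l t = 0

lemma hyp_swp (l : K) (c : ℕ → ℕ → ℕ → K) (h : Hyp l c) : Hyp l (swp c) := by
  intro t ht
  have h4 : (t ^ 2) ^ 2 = t := by linear_combination t * ht
  obtain ⟨h1, h2, h3, h4⟩ := h4 ▸ h (t ^ 2) (by linear_combination (t ^ 3 + 1) * ht)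
  refine ⟨?_, ?_, ?_, ?_⟩
  · rw [← h1]; simp only [sv, swp]; ring
  · rw [← h2]; simp only [s1, swp]; ring
  · rw [← h4]; simp only [s1, swp, rot]; ring
  · rw [← h3]; simp only [s1, swp, rot]; ring

lemma fourier (h3 : (3 : K) ≠ 0) (o : K) (ho : o ^ 2 + o + 1 = 0) (A B C : K)
    (h : ∀ t : K, t ^ 3 = 1 → A + B * t + C * t ^ 2 = 0) : A = 0 ∧ B = 0 ∧ C = 0 := by
  have e0 := h 1 (by ring)
  have e1 := h o (by linear_combination (o - 1) * ho)
  have e2 := h (o ^ 2) (by linear_combination (o ^ 3 + 1) * (o - 1) * ho)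
  have c0 : 3 * A = 0 := by linear_combination e0 + e1 + e2 - (B + C * (o ^ 2 - o + 1)) * ho
  have c1 : 3 * B = 0 := by
    linear_combination e0 + o ^ 2 * e1 + o * e2 - (A + 2 * B * (o - 1) + C * (o ^ 2 + (o-1) * o ^ 2 - (o - 1))) * ho
  have c2 : 3 * C = 0 := by linear_combination 3 * e0 - c0 - c1
  exact ⟨(mul_eq_zero.1 c0).resolve_left h3, (mul_eq_zero.1 c1).resolve_left h3,
    (mul_eq_zero.1 c2).resolve_left h3⟩

lemma four_val (h3 : (3 : K) ≠ 0) (o : K) (ho : o ^ 2 + o + 1 = 0) (l : K) (c : ℕ → ℕ → ℕ → K) (h : Hyp l c) :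
    c 0 0 6 + c 0 3 3 + c 0 6 0 + c 1 1 4 * l + c 1 4 1 * l + c 2 2 2 * l^2 + c 3 0 3 * l^3
     + c 3 3 0 * l^3 + c 4 1 1 * l^4 + c 6 0 0 * l^6 = 0 ∧
    c 0 2 4 + c 0 5 1 + c 1 0 5 * l + c 1 3 2 * l + c 2 1 3 * l^2 + c 2 4 0 * l^2
     + c 3 2 1 * l^3 + c 4 0 2 * l^4 + c 5 1 0 * l^5 = 0 := by
  have := fourier h3 o ho
    (c 0 0 6 + c 0 3 3 + c 0 6 0 + c 1 1 4 * l + c 1 4 1 * l + c 2 2 2 * l^2 + c 3 0 3 * l^3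
      + c 3 3 0 * l^3 + c 4 1 1 * l^4 + c 6 0 0 * l^6)
    (c 0 2 4 + c 0 5 1 + c 1 0 5 * l + c 1 3 2 * l + c 2 1 3 * l^2 + c 2 4 0 * l^2
      + c 3 2 1 * l^3 + c 4 0 2 * l^4 + c 5 1 0 * l^5)
    (c 0 1 5 + c 0 4 2 + c 1 2 3 * l + c 1 5 0 * l + c 2 0 4 * l^2 + c 2 3 1 * l^2
      + c 3 1 2 * l^3 + c 4 2 0 * l^4 + c 5 0 1 * l^5)
    (fun t ht => by
      have h := (h t ht).1
      simp only [sv, s1, rot] at h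
      linear_combination h - (c 0 0 6 + c 0 0 6 * t^3 + c 0 0 6 * t^6 + c 0 0 6 * t^9 + c 0 1 5 * t^2 + c 0 1 5 * t^5
         + c 0 1 5 * t^8 + c 0 2 4 * t + c 0 2 4 * t^4 + c 0 2 4 * t^7 + c 0 3 3
         + c 0 3 3 * t^3 + c 0 3 3 * t^6 + c 0 4 2 * t^2 + c 0 4 2 * t^5 + c 0 5 1 * t
         + c 0 5 1 * t^4 + c 0 6 0 + c 0 6 0 * t^3 + c 1 0 5 * l * t + c 1 0 5 * l * t^4
         + c 1 0 5 * l * t^7 + c 1 1 4 * l + c 1 1 4 * l * t^3 + c 1 1 4 * l * t^6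
         + c 1 2 3 * l * t^2 + c 1 2 3 * l * t^5 + c 1 3 2 * l * t + c 1 3 2 * l * t^4
         + c 1 4 1 * l + c 1 4 1 * l * t^3 + c 1 5 0 * l * t^2 + c 2 0 4 * l^2 * t^2
         + c 2 0 4 * l^2 * t^5 + c 2 1 3 * l^2 * t + c 2 1 3 * l^2 * t^4 + c 2 2 2 * l^2
         + c 2 2 2 * l^2 * t^3 + c 2 3 1 * l^2 * t^2 + c 2 4 0 * l^2 * t + c 3 0 3 * l^3
         + c 3 0 3 * l^3 * t^3 + c 3 1 2 * l^3 * t^2 + c 3 2 1 * l^3 * t + c 3 3 0 * l^3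
         + c 4 0 2 * l^4 * t + c 4 1 1 * l^4) * ht)
  exact ⟨this.1, this.2.1⟩

lemma four_dx (h3 : (3 : K) ≠ 0) (o : K) (ho : o ^ 2 + o + 1 = 0) (l : K) (c : ℕ → ℕ → ℕ → K) (h : Hyp l c) :
    c 1 1 4 + c 1 4 1 + 2 * c 2 2 2 * l + 3 * c 3 0 3 * l^2 + 3 * c 3 3 0 * l^2
     + 4 * c 4 1 1 * l^3 + 6 * c 6 0 0 * l^5 = 0 ∧
    c 1 0 5 + c 1 3 2 + 2 * c 2 1 3 * l + 2 * c 2 4 0 * l + 3 * c 3 2 1 * l^2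
     + 4 * c 4 0 2 * l^3 + 5 * c 5 1 0 * l^4 = 0 := by
  have := fourier h3 o ho
    (c 1 1 4 + c 1 4 1 + 2 * c 2 2 2 * l + 3 * c 3 0 3 * l^2 + 3 * c 3 3 0 * l^2
      + 4 * c 4 1 1 * l^3 + 6 * c 6 0 0 * l^5)
    (c 1 0 5 + c 1 3 2 + 2 * c 2 1 3 * l + 2 * c 2 4 0 * l + 3 * c 3 2 1 * l^2
      + 4 * c 4 0 2 * l^3 + 5 * c 5 1 0 * l^4)
    (c 1 2 3 + c 1 5 0 + 2 * c 2 0 4 * l + 2 * c 2 3 1 * l + 3 * c 3 1 2 * l^2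
      + 4 * c 4 2 0 * l^3 + 5 * c 5 0 1 * l^4)
    (fun t ht => by
      have h := (h t ht).2.1
      simp only [sv, s1, rot] at h
      linear_combination h - (c 1 0 5 * t + c 1 0 5 * t^4 + c 1 0 5 * t^7 + c 1 1 4 + c 1 1 4 * t^3 + c 1 1 4 * t^6
         + c 1 2 3 * t^2 + c 1 2 3 * t^5 + c 1 3 2 * t + c 1 3 2 * t^4 + c 1 4 1
         + c 1 4 1 * t^3 + c 1 5 0 * t^2 + 2 * c 2 0 4 * l * t^2 + 2 * c 2 0 4 * l * t^5
         + 2 * c 2 1 3 * l * t + 2 * c 2 1 3 * l * t^4 + 2 * c 2 2 2 * l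
         + 2 * c 2 2 2 * l * t^3 + 2 * c 2 3 1 * l * t^2 + 2 * c 2 4 0 * l * t
         + 3 * c 3 0 3 * l^2 + 3 * c 3 0 3 * l^2 * t^3 + 3 * c 3 1 2 * l^2 * t^2
         + 3 * c 3 2 1 * l^2 * t + 3 * c 3 3 0 * l^2 + 4 * c 4 0 2 * l^3 * t
         + 4 * c 4 1 1 * l^3) * ht)
  exact ⟨this.1, this.2.1⟩

lemma four_dy (h3 : (3 : K) ≠ 0) (o : K) (ho : o ^ 2 + o + 1 = 0) (l : K) (c : ℕ → ℕ → ℕ → K) (h : Hyp l c) :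
    3 * c 0 3 3 + 6 * c 0 6 0 + c 1 1 4 * l + 4 * c 1 4 1 * l + 2 * c 2 2 2 * l^2
     + 3 * c 3 3 0 * l^3 + c 4 1 1 * l^4 = 0 ∧
    2 * c 0 2 4 + 5 * c 0 5 1 + 3 * c 1 3 2 * l + c 2 1 3 * l^2 + 4 * c 2 4 0 * l^2
     + 2 * c 3 2 1 * l^3 + c 5 1 0 * l^5 = 0 := by
  have := fourier h3 o ho
    (2 * c 0 2 4 + 5 * c 0 5 1 + 3 * c 1 3 2 * l + c 2 1 3 * l^2 + 4 * c 2 4 0 * l^2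
      + 2 * c 3 2 1 * l^3 + c 5 1 0 * l^5)
    (c 0 1 5 + 4 * c 0 4 2 + 2 * c 1 2 3 * l + 5 * c 1 5 0 * l + 3 * c 2 3 1 * l^2
      + c 3 1 2 * l^3 + 2 * c 4 2 0 * l^4)
    (3 * c 0 3 3 + 6 * c 0 6 0 + c 1 1 4 * l + 4 * c 1 4 1 * l + 2 * c 2 2 2 * l^2
      + 3 * c 3 3 0 * l^3 + c 4 1 1 * l^4)
    (fun t ht => by
      have h := (h t ht).2.2.1
      simp only [sv, s1, rot] at h
      linear_combination h - (c 0 1 5 * t + c 0 1 5 * t^4 + c 0 1 5 * t^7 + 2 * c 0 2 4 + 2 * c 0 2 4 * t^3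
         + 2 * c 0 2 4 * t^6 + 3 * c 0 3 3 * t^2 + 3 * c 0 3 3 * t^5 + 4 * c 0 4 2 * t
         + 4 * c 0 4 2 * t^4 + 5 * c 0 5 1 + 5 * c 0 5 1 * t^3 + 6 * c 0 6 0 * t^2
         + c 1 1 4 * l * t^2 + c 1 1 4 * l * t^5 + 2 * c 1 2 3 * l * t + 2 * c 1 2 3 * l * t^4
         + 3 * c 1 3 2 * l + 3 * c 1 3 2 * l * t^3 + 4 * c 1 4 1 * l * t^2
         + 5 * c 1 5 0 * l * t + c 2 1 3 * l^2 + c 2 1 3 * l^2 * t^3 + 2 * c 2 2 2 * l^2 * t^2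
         + 3 * c 2 3 1 * l^2 * t + 4 * c 2 4 0 * l^2 + c 3 1 2 * l^3 * t + 2 * c 3 2 1 * l^3) * ht)
  exact ⟨this.2.2, this.1⟩

lemma four_dz (h3 : (3 : K) ≠ 0) (o : K) (ho : o ^ 2 + o + 1 = 0) (l : K) (c : ℕ → ℕ → ℕ → K) (h : Hyp l c) :
    6 * c 0 0 6 + 3 * c 0 3 3 + 4 * c 1 1 4 * l + c 1 4 1 * l + 2 * c 2 2 2 * l^2
     + 3 * c 3 0 3 * l^3 + c 4 1 1 * l^4 = 0 ∧
    4 * c 0 2 4 + c 0 5 1 + 5 * c 1 0 5 * l + 2 * c 1 3 2 * l + 3 * c 2 1 3 * l^2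
     + c 3 2 1 * l^3 + 2 * c 4 0 2 * l^4 = 0 := by
  have := fourier h3 o ho
    (5 * c 0 1 5 + 2 * c 0 4 2 + 3 * c 1 2 3 * l + 4 * c 2 0 4 * l^2 + c 2 3 1 * l^2
      + 2 * c 3 1 2 * l^3 + c 5 0 1 * l^5)
    (6 * c 0 0 6 + 3 * c 0 3 3 + 4 * c 1 1 4 * l + c 1 4 1 * l + 2 * c 2 2 2 * l^2
      + 3 * c 3 0 3 * l^3 + c 4 1 1 * l^4)
    (4 * c 0 2 4 + c 0 5 1 + 5 * c 1 0 5 * l + 2 * c 1 3 2 * l + 3 * c 2 1 3 * l^2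
      + c 3 2 1 * l^3 + 2 * c 4 0 2 * l^4)
    (fun t ht => by
      have h := (h t ht).2.2.2
      simp only [sv, s1, rot] at h
      linear_combination h - (6 * c 0 0 6 * t + 6 * c 0 0 6 * t^4 + 6 * c 0 0 6 * t^7 + 5 * c 0 1 5
         + 5 * c 0 1 5 * t^3 + 5 * c 0 1 5 * t^6 + 4 * c 0 2 4 * t^2 + 4 * c 0 2 4 * t^5
         + 3 * c 0 3 3 * t + 3 * c 0 3 3 * t^4 + 2 * c 0 4 2 + 2 * c 0 4 2 * t^3
         + c 0 5 1 * t^2 + 5 * c 1 0 5 * l * t^2 + 5 * c 1 0 5 * l * t^5 + 4 * c 1 1 4 * l * t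
         + 4 * c 1 1 4 * l * t^4 + 3 * c 1 2 3 * l + 3 * c 1 2 3 * l * t^3
         + 2 * c 1 3 2 * l * t^2 + c 1 4 1 * l * t + 4 * c 2 0 4 * l^2
         + 4 * c 2 0 4 * l^2 * t^3 + 3 * c 2 1 3 * l^2 * t^2 + 2 * c 2 2 2 * l^2 * t
         + c 2 3 1 * l^2 + 3 * c 3 0 3 * l^3 * t + 2 * c 3 1 2 * l^3) * ht)
  exact ⟨this.2.1, this.2.2⟩

end hesseA

section hesseB
variable {K : Type*} [Field K]

lemma tlem (h3 : (3 : K) ≠ 0) (t : K) (ht : t ^ 3 ≠ 1) (A B C : K)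
    (e0 : A * (t^5 + 1 + t) + B * (t^4 + t^2 + 1) + C * (t^3 + t + t^2) = 0)
    (e1 : A * (5 * t^4 + 1) + B * (4 * t^3 + 2 * t) + C * (3 * t^2 + 1 + 2 * t) = 0)
    (e2 : A * (t^5 + 5) + B * (4 * t^2 + 2) + C * (2 * t^3 + 3 * t + t^2) = 0) :
    A = 0 ∧ B = 0 ∧ C = 0 := by
  have h1 : t ^ 3 - 1 ≠ 0 := sub_ne_zero.2 ht
  have h2 : t ^ 2 + t + 1 ≠ 0 := fun h => h1 (by linear_combination (t - 1) * h)
  have hd : -3 * (t ^ 2 + t + 1) * (t ^ 3 - 1) ^ 3 ≠ 0 :=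
    mul_ne_zero (mul_ne_zero (neg_ne_zero.2 h3) h2) (pow_ne_zero 3 h1)
  refine ⟨?_, ?_, ?_⟩ <;> apply (mul_eq_zero.1 (?_ : (-3 * (t ^ 2 + t + 1) * (t ^ 3 - 1) ^ 3) * _ = 0)).resolve_left hd
  · linear_combination (((4 * t^3 + 2 * t) * (2 * t^3 + 3 * t + t^2) - (3 * t^2 + 1 + 2 * t) * (4 * t^2 + 2))) * e0 + (-((t^4 + t^2 + 1) * (2 * t^3 + 3 * t + t^2) - (t^3 + t + t^2) * (4 * t^2 + 2))) * e1 + (((t^4 + t^2 + 1) * (3 * t^2 + 1 + 2 * t) - (t^3 + t + t^2) * (4 * t^3 + 2 * t))) * e2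
  · linear_combination (-((5 * t^4 + 1) * (2 * t^3 + 3 * t + t^2) - (3 * t^2 + 1 + 2 * t) * (t^5 + 5))) * e0 + (((t^5 + 1 + t) * (2 * t^3 + 3 * t + t^2) - (t^3 + t + t^2) * (t^5 + 5))) * e1 + (-((t^5 + 1 + t) * (3 * t^2 + 1 + 2 * t) - (t^3 + t + t^2) * (5 * t^4 + 1))) * e2
  · linear_combination (((5 * t^4 + 1) * (4 * t^2 + 2) - (4 * t^3 + 2 * t) * (t^5 + 5))) * e0 + (-((t^5 + 1 + t) * (4 * t^2 + 2) - (t^4 + t^2 + 1) * (t^5 + 5))) * e1 + (((t^5 + 1 + t) * (4 * t^3 + 2 * t) - (t^4 + t^2 + 1) * (5 * t^4 + 1))) * e2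

lemma class1 (h3 : (3 : K) ≠ 0) (o : K) (ho : o ^ 2 + o + 1 = 0) (l : K) (hl : l ^ 3 ≠ 1)
    (c : ℕ → ℕ → ℕ → K) (H0 : Hyp l c) (H1 : Hyp l (rot c)) (H2 : Hyp l (rot (rot c))) :
    (c 5 1 0 = 0 ∧ c 1 0 5 = 0 ∧ c 0 5 1 = 0) ∧ (c 4 0 2 = 0 ∧ c 0 2 4 = 0 ∧ c 2 4 0 = 0) ∧
    (c 3 2 1 = 0 ∧ c 2 1 3 = 0 ∧ c 1 3 2 = 0) := by
  have val0 := (four_val h3 o ho l _ H0).2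
  have val1 := (four_val h3 o ho l _ H1).2
  have val2 := (four_val h3 o ho l _ H2).2
  have dx0 := (four_dx h3 o ho l _ H0).2
  have dx1 := (four_dx h3 o ho l _ H1).2
  have dx2 := (four_dx h3 o ho l _ H2).2
  have dy0 := (four_dy h3 o ho l _ H0).2
  have dy1 := (four_dy h3 o ho l _ H1).2
  have dy2 := (four_dy h3 o ho l _ H2).2
  simp only [rot] at val1 val2 dx1 dx2 dy1 dy2
  have key : ∀ s : K, s ^ 3 = 1 → c 5 1 0 + c 1 0 5 * s + c 0 5 1 * s ^ 2 = 0 ∧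
      c 4 0 2 + c 0 2 4 * s + c 2 4 0 * s ^ 2 = 0 ∧ c 3 2 1 + c 2 1 3 * s + c 1 3 2 * s ^ 2 = 0 := by
    intro s hs
    have hs0 : s ≠ 0 := by rintro rfl; simp at hs
    have := tlem h3 (s * l) (by rw [mul_pow, hs, one_mul]; exact hl)
      (s * (c 5 1 0 + c 1 0 5 * s + c 0 5 1 * s ^ 2))
      (s ^ 2 * (c 4 0 2 + c 0 2 4 * s + c 2 4 0 * s ^ 2))
      (c 3 2 1 + c 2 1 3 * s + c 1 3 2 * s ^ 2)
      (by linear_combination s^0 * (val0 + s^2 * val1 + s * val2) + (c 0 2 4 + c 0 2 4 * l^2 * s^2 + c 0 2 4 * l^4 * s + c 0 2 4 * l^4 * s^4 + c 0 5 1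
         + c 0 5 1 * l * s + c 0 5 1 * l^5 * s^2 + c 0 5 1 * l^5 * s^5 + c 1 0 5 * l
         + c 1 0 5 * l^5 * s + c 1 0 5 * l^5 * s^4 + c 1 3 2 * l + c 1 3 2 * l^2 * s
         + c 1 3 2 * l^3 * s^2 + c 2 1 3 * l^2 + c 2 1 3 * l^3 * s + c 2 4 0 * l^2
         + c 2 4 0 * l^2 * s^3 + c 2 4 0 * l^4 * s^2 + c 2 4 0 * l^4 * s^5 + c 2 4 0 * s
         + c 3 2 1 * l^3 + c 4 0 2 * l^2 * s + c 4 0 2 * l^4 + c 4 0 2 * l^4 * s^3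
         + c 5 1 0 * l^5 + c 5 1 0 * l^5 * s^3) * hs)
      (by linear_combination s^2 * (dx0 + s^2 * dx1 + s * dx2) + (4 * c 0 2 4 * l^3 * s^3 + 5 * c 0 5 1 * l^4 * s^4 + 5 * c 1 0 5 * l^4 * s^3
         + (-1) * c 2 1 3 * s + 2 * c 2 4 0 * l * s^2 + 4 * c 2 4 0 * l^3 * s^4
         + (-1) * c 3 2 1 + (-2) * c 3 2 1 * l * s + 4 * c 4 0 2 * l^3 * s^2
         + 5 * c 5 1 0 * l^4 * s^2 + (-1) * c 5 1 0 * s) * hs)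
      (by linear_combination s^0 * (dy0 + s^2 * dy1 + s * dy2) + (2 * c 0 2 4 + 4 * c 0 2 4 * l^2 * s^2 + 5 * c 0 5 1 + c 0 5 1 * l^5 * s^2
         + c 0 5 1 * l^5 * s^5 + c 1 0 5 * l^5 * s + c 1 0 5 * l^5 * s^4 + 3 * c 1 3 2 * l
         + c 1 3 2 * l^2 * s + 2 * c 1 3 2 * l^3 * s^2 + c 2 1 3 * l^2 + 2 * c 2 1 3 * l^3 * s
         + 4 * c 2 4 0 * l^2 + 4 * c 2 4 0 * l^2 * s^3 + 2 * c 2 4 0 * s + 2 * c 3 2 1 * l^3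
         + 4 * c 4 0 2 * l^2 * s + c 5 1 0 * l^5 + c 5 1 0 * l^5 * s^3) * hs)
    exact ⟨(mul_eq_zero.1 this.1).resolve_left hs0,
      (mul_eq_zero.1 this.2.1).resolve_left (pow_ne_zero 2 hs0), this.2.2⟩
  exact ⟨fourier h3 o ho _ _ _ fun s hs => (key s hs).1, fourier h3 o ho _ _ _ fun s hs => (key s hs).2.1,
    fourier h3 o ho _ _ _ fun s hs => (key s hs).2.2⟩

lemma class0aux (h3 : (3 : K) ≠ 0) (s : K) (hs : s ^ 2 + s + 1 = 0) (l : K) (hl : l ^ 3 ≠ 1) (P Q R : K)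
    (e0 : (l ^ 3 - 1) * (P * (l ^ 3 + 1) - Q + R * l) = 0)
    (e1 : 6 * P * l ^ 5 - 3 * Q * l ^ 2 + R * (4 * l ^ 3 - 1) = 0)
    (e2 : 6 * P * s + 3 * Q * (1 + s ^ 2 * l ^ 3) + R * l * (l ^ 3 + 4 * s + s ^ 2) = 0)
    (e3 : 6 * P * s ^ 2 + 3 * Q * (1 + s * l ^ 3) + R * l * (l ^ 3 + s + 4 * s ^ 2) = 0) :
    P = 0 ∧ Q = 0 ∧ R = 0 := by
  have h1 : l ^ 3 - 1 ≠ 0 := sub_ne_zero.2 hl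
  have f0 := (mul_eq_zero.1 e0).resolve_left h1
  have hss : 2 * s + 1 ≠ 0 := by
    intro h
    apply h3
    linear_combination 4 * hs - (2 * s + 1) * h
  have f1 : 3 * (2 * P - Q * l ^ 3 + R * l) = 0 := by
    apply (mul_eq_zero.1 (?_ : (2 * s + 1) * _ = 0)).resolve_left hss
    linear_combination e2 - e3 + (6 * P - 3 * Q * l ^ 3 + 3 * R * l) * hs
  have f2 := (mul_eq_zero.1 f1).resolve_left h3
  have f3 : P + Q = 0 := by
    apply (mul_eq_zero.1 (?_ : (l ^ 3 - 1) * _ = 0)).resolve_left h1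
    linear_combination f0 - f2
  have f4 : Q = 0 := by
    apply (mul_eq_zero.1 (?_ : (l ^ 3 - 1) ^ 2 * _ = 0)).resolve_left (pow_ne_zero 2 h1)
    linear_combination e2 - (l ^ 3 + 4 * s + s ^ 2) * f2 + (2 * (l ^ 3 + 4 * s + s ^ 2) - 6 * s) * f3 - (2 * Q + 4 * Q * l ^ 3) * hs
  have f5 : P = 0 := by linear_combination f3 - f4
  refine ⟨f5, f4, ?_⟩
  rw [f4, f5] at e1 f2
  linear_combination 4 * l ^ 2 * f2 - e1

/-- the invariant class -/
lemma class0 (h3 : (3 : K) ≠ 0) (o : K) (ho : o ^ 2 + o + 1 = 0) (l : K) (hl : l ^ 3 ≠ 1)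
    (h2 : (2 : K) ≠ 0 ∨ l ≠ 0)
    (c : ℕ → ℕ → ℕ → K) (H0 : Hyp l c) (H1 : Hyp l (rot c)) (H2 : Hyp l (rot (rot c))) :
    ∃ a b : K, (c 6 0 0 = a ∧ c 0 6 0 = a ∧ c 0 0 6 = a) ∧
      (c 3 3 0 = a * (4 * l ^ 3 - 2) + b * l ^ 2 ∧ c 3 0 3 = a * (4 * l ^ 3 - 2) + b * l ^ 2 ∧
        c 0 3 3 = a * (4 * l ^ 3 - 2) + b * l ^ 2) ∧
      (c 4 1 1 = a * (-6 * l ^ 2) - b * l ∧ c 1 4 1 = a * (-6 * l ^ 2) - b * l ∧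
        c 1 1 4 = a * (-6 * l ^ 2) - b * l) ∧
      c 2 2 2 = a * (12 * l - 3 * l ^ 4) - b * (l ^ 3 - 1) := by
  have val0 := (four_val h3 o ho l _ H0).1
  have val1 := (four_val h3 o ho l _ H1).1
  have val2 := (four_val h3 o ho l _ H2).1
  have dx0 := (four_dx h3 o ho l _ H0).1
  have dx1 := (four_dx h3 o ho l _ H1).1
  have dx2 := (four_dx h3 o ho l _ H2).1
  have dy0 := (four_dy h3 o ho l _ H0).1
  have dy1 := (four_dy h3 o ho l _ H1).1
  have dy2 := (four_dy h3 o ho l _ H2).1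
  have dz0 := (four_dz h3 o ho l _ H0).1
  have dz1 := (four_dz h3 o ho l _ H1).1
  have dz2 := (four_dz h3 o ho l _ H2).1
  simp only [rot] at val1 val2 dx1 dx2 dy1 dy2 dz1 dz2
  have key : ∀ s : K, s ^ 2 + s + 1 = 0 → c 6 0 0 + c 0 0 6 * s + c 0 6 0 * s ^ 2 = 0 ∧
      c 0 3 3 + c 3 3 0 * s + c 3 0 3 * s ^ 2 = 0 ∧ c 4 1 1 + c 1 1 4 * s + c 1 4 1 * s ^ 2 = 0 := by
    intro s hs
    exact class0aux h3 s hs l hl _ _ _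
      (by linear_combination s^0 * (val0 + s^2 * val1 + s * val2) + ((-1) * c 0 0 6 + (-1) * c 0 3 3 * l^3 + (-1) * c 0 6 0 + (-1) * c 1 1 4 * l
         + (-1) * c 1 4 1 * l + (-1) * c 2 2 2 * l^2 + (-1) * c 3 0 3 * l^3
         + (-1) * c 3 3 0 * l^3 + (-1) * c 4 1 1 * l + (-1) * c 6 0 0) * hs)
      (by linear_combination s^0 * (dx0 + s^2 * dx1 + s * dx2) + ((-3) * c 0 3 3 * l^2 + (-1) * c 1 1 4 + (-1) * c 1 4 1 + (-2) * c 2 2 2 * l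
         + (-3) * c 3 0 3 * l^2 + (-3) * c 3 3 0 * l^2 + (-1) * c 4 1 1) * hs)
      (by linear_combination s^0 * (dy0 + s^2 * dy1 + s * dy2) + ((-6) * c 0 6 0 + 6 * c 0 6 0 * s + (-1) * c 1 1 4 * l + c 1 1 4 * l * s
         + (-4) * c 1 4 1 * l + 3 * c 1 4 1 * l * s + c 1 4 1 * l * s^2 + (-2) * c 2 2 2 * l^2
         + (-3) * c 3 0 3 * l^3 * s + 3 * c 3 0 3 * l^3 * s^2 + (-3) * c 3 3 0 * l^3
         + 3 * c 3 3 0 * l^3 * s) * hs)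
      (by linear_combination s^0 * (dz0 + s^2 * dz1 + s * dz2) + ((-6) * c 0 0 6 + 6 * c 0 0 6 * s + (-6) * c 0 6 0 * s + 6 * c 0 6 0 * s^2
         + (-4) * c 1 1 4 * l + 4 * c 1 1 4 * l * s + (-1) * c 1 4 1 * l
         + (-3) * c 1 4 1 * l * s + 4 * c 1 4 1 * l * s^2 + (-2) * c 2 2 2 * l^2
         + (-3) * c 3 0 3 * l^3 + 3 * c 3 0 3 * l^3 * s) * hs)
  have k1 := key o ho
  have k2 := key (o ^ 2) (by linear_combination (o ^ 2 - o + 1) * ho)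
  have hoo : 2 * o + 1 ≠ 0 := by
    intro h
    apply h3
    linear_combination 4 * ho - (2 * o + 1) * h
  have eqs : ∀ X Y Z : K, X + Y * o + Z * o ^ 2 = 0 → X + Y * o ^ 2 + Z * (o ^ 2) ^ 2 = 0 → Y = X ∧ Z = X := by
    intro X Y Z e f
    have g : Y - Z = 0 := by
      apply (mul_eq_zero.1 (?_ : (2 * o + 1) * _ = 0)).resolve_left hoo
      linear_combination e - f + (Y + Z * (o ^ 2 - o - 1)) * ho
    have g2 : X - Z = 0 := by linear_combination e - o * g - Z * ho
    exact ⟨by linear_combination g - g2, by linear_combination -g2⟩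
  obtain ⟨p1, p2⟩ := eqs _ _ _ k1.1 k2.1
  obtain ⟨q1, q2⟩ := eqs _ _ _ k1.2.1 k2.2.1
  obtain ⟨r1, r2⟩ := eqs _ _ _ k1.2.2 k2.2.2
  have h1 : l ^ 3 - 1 ≠ 0 := sub_ne_zero.2 hl
  simp only [p1, p2, q1, q2, r1, r2] at val0 dx0 dy0 ⊢
  obtain ⟨b, hb⟩ : ∃ b, c 2 2 2 = c 6 0 0 * (12 * l - 3 * l ^ 4) - b * (l ^ 3 - 1) :=
    ⟨(c 6 0 0 * (12 * l - 3 * l ^ 4) - c 2 2 2) / (l ^ 3 - 1), by field_simp; ring⟩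
  obtain ⟨Q, hQ⟩ : ∃ Q, Q = c 0 3 3 - (c 6 0 0 * (4 * l ^ 3 - 2) + b * l ^ 2) := ⟨_, rfl⟩
  obtain ⟨R, hR⟩ : ∃ R, R = c 4 1 1 - (c 6 0 0 * (-6 * l ^ 2) - b * l) := ⟨_, rfl⟩
  have e0 : Q * (1 + 2 * l ^ 3) + R * l * (l ^ 3 + 2) = 0 := by
    rw [hQ, hR]; rw [hb] at val0; linear_combination val0
  have e1 : 6 * Q * l ^ 2 + R * (4 * l ^ 3 + 2) = 0 := by
    rw [hQ, hR]; rw [hb] at dx0; linear_combination dx0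
  have e2 : 3 * Q * (1 + l ^ 3) + R * l * (l ^ 3 + 5) = 0 := by
    rw [hQ, hR]; rw [hb] at dy0; linear_combination dy0
  have Q0 : Q = 0 := by
    apply (mul_eq_zero.1 (?_ : (l ^ 3 - 1) ^ 2 * _ = 0)).resolve_left (pow_ne_zero 2 h1)
    linear_combination (l ^ 3 + 2) * e2 - (l ^ 3 + 5) * e0
  have R0 : R = 0 := by
    rw [Q0] at e0 e1 e2
    have f1 : R * l = 0 := by
      apply (mul_eq_zero.1 (?_ : (3 : K) * _ = 0)).resolve_left h3
      linear_combination e2 - e0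
    have f2 : R * 2 = 0 := by linear_combination e1 - 4 * l ^ 2 * f1
    rcases h2 with h | h
    · exact (mul_eq_zero.1 f2).resolve_right h
    · exact (mul_eq_zero.1 f1).resolve_right h
  have hq : c 0 3 3 = c 6 0 0 * (4 * l ^ 3 - 2) + b * l ^ 2 := by linear_combination Q0 - hQ
  have hr : c 4 1 1 = c 6 0 0 * (-6 * l ^ 2) - b * l := by linear_combination R0 - hR
  exact ⟨c 6 0 0, b, ⟨rfl, rfl, rfl⟩, ⟨hq, hq, hq⟩, ⟨hr, hr, hr⟩, hb⟩

end hesseB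

section hesseC
variable {K : Type*} [Field K]

def pc {R : Type*} [CommRing R] (a b l X Y Z p : R) : R :=
  a * (X ^ 2 + Y ^ 2 + Z ^ 2 + (4 * l ^ 3 - 2) * (X * Y + Y * Z + Z * X) - 6 * l ^ 2 * p * (X + Y + Z)
    + (12 * l - 3 * l ^ 4) * p ^ 2) +
  b * (l ^ 2 * (X * Y + Y * Z + Z * X) - l * p * (X + Y + Z) - (l ^ 3 - 1) * p ^ 2)

def pv {R : Type*} [CommRing R] (a b l x y z : R) : R := pc a b l (x ^ 3) (y ^ 3) (z ^ 3) (x * y * z)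

def pq {R : Type*} [CommRing R] (a b l X Y Z p X' Y' Z' p' : R) : R :=
  pc a b l (X + X') (Y + Y') (Z + Z') (p + p') - pc a b l X Y Z p - pc a b l X' Y' Z' p'

lemma pc_expand {R : Type*} [CommRing R] (a b l T X0 X1 X2 X3 Y0 Y1 Y2 Y3 Z0 Z1 Z2 Z3 p0 p1 p2 p3 : R) :
    ∃ r, pc a b l (X0 + X1 * T + X2 * T ^ 2 + X3 * T ^ 3) (Y0 + Y1 * T + Y2 * T ^ 2 + Y3 * T ^ 3)
      (Z0 + Z1 * T + Z2 * T ^ 2 + Z3 * T ^ 3) (p0 + p1 * T + p2 * T ^ 2 + p3 * T ^ 3) =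
      pc a b l X0 Y0 Z0 p0 + pq a b l X0 Y0 Z0 p0 X1 Y1 Z1 p1 * T +
      (pc a b l X1 Y1 Z1 p1 + pq a b l X0 Y0 Z0 p0 X2 Y2 Z2 p2) * T ^ 2 + T ^ 3 * r := by
  refine ⟨pq a b l X1 Y1 Z1 p1 X2 Y2 Z2 p2 + pc a b l X2 Y2 Z2 p2 * T +
    pq a b l X0 Y0 Z0 p0 X3 Y3 Z3 p3 + pq a b l X1 Y1 Z1 p1 X3 Y3 Z3 p3 * T
    + pq a b l X2 Y2 Z2 p2 X3 Y3 Z3 p3 * T ^ 2 + pc a b l X3 Y3 Z3 p3 * T ^ 3, ?_⟩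
  simp only [pq, pc]
  ring

lemma pv_expand {R : Type*} [CommRing R] (a b l v0 v1 v2 T : R) :
    ∃ r, pv a b l (l + v0 * T) (1 + v1 * T) (1 + v2 * T) =
      (a * (9 * (l ^ 3 - 1) ^ 2 * (v1 - v2) ^ 2) +
      b * ((1 - l ^ 3) * ((v0 - l * v1) ^ 2 + l * (v0 - l * v1) * (v1 - v2) - 2 * l ^ 2 * (v1 - v2) ^ 2)))
      * T ^ 2 + T ^ 3 * r := by
  obtain ⟨r, hr⟩ := pc_expand a b l T (l ^ 3) (3 * l ^ 2 * v0) (3 * l * v0 ^ 2) (v0 ^ 3)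
    1 (3 * v1) (3 * v1 ^ 2) (v1 ^ 3) 1 (3 * v2) (3 * v2 ^ 2) (v2 ^ 3)
    l (v0 + l * v1 + l * v2) (v0 * v1 + v0 * v2 + l * v1 * v2) (v0 * v1 * v2)
  refine ⟨r, ?_⟩
  have e0 : pc a b l (l ^ 3) 1 1 l = 0 := by simp only [pc]; ring
  have e1 : pq a b l (l ^ 3) 1 1 l (3 * l ^ 2 * v0) (3 * v1) (3 * v2) (v0 + l * v1 + l * v2) = 0 := by
    simp only [pc, pq]; ring
  have e2 : pc a b l (3 * l ^ 2 * v0) (3 * v1) (3 * v2) (v0 + l * v1 + l * v2) +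
      pq a b l (l ^ 3) 1 1 l (3 * l * v0 ^ 2) (3 * v1 ^ 2) (3 * v2 ^ 2) (v0 * v1 + v0 * v2 + l * v1 * v2) =
      a * (9 * (l ^ 3 - 1) ^ 2 * (v1 - v2) ^ 2) +
      b * ((1 - l ^ 3) * ((v0 - l * v1) ^ 2 + l * (v0 - l * v1) * (v1 - v2) - 2 * l ^ 2 * (v1 - v2) ^ 2)) := by
    simp only [pc, pq]; ring
  rw [e0, e1, e2] at hr
  simp only [pv]
  rw [show (l + v0 * T) ^ 3 = l ^ 3 + 3 * l ^ 2 * v0 * T + 3 * l * v0 ^ 2 * T ^ 2 + v0 ^ 3 * T ^ 3 by ring,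
    show (1 + v1 * T) ^ 3 = 1 + 3 * v1 * T + 3 * v1 ^ 2 * T ^ 2 + v1 ^ 3 * T ^ 3 by ring,
    show (1 + v2 * T) ^ 3 = 1 + 3 * v2 * T + 3 * v2 ^ 2 * T ^ 2 + v2 ^ 3 * T ^ 3 by ring,
    show (l + v0 * T) * (1 + v1 * T) * (1 + v2 * T) = l + (v0 + l * v1 + l * v2) * T +
      (v0 * v1 + v0 * v2 + l * v1 * v2) * T ^ 2 + v0 * v1 * v2 * T ^ 3 by ring, hr]
  ring

/-- member of the pencil -/
def pen (a b l : K) : MvPolynomial (Fin 3) K :=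
  pv (MvPolynomial.C a) (MvPolynomial.C b) (MvPolynomial.C l) (X 0) (X 1) (X 2)

lemma eval_pen (a b l : K) (w : Fin 3 → K) : eval w (pen a b l) = pv a b l (w 0) (w 1) (w 2) := by
  simp [pen, pv, pc]

lemma lineRestrict_pen (a b l : K) (w v : Fin 3 → K) : lineRestrict (pen a b l) w v =
    pv (Polynomial.C a) (Polynomial.C b) (Polynomial.C l)
      (Polynomial.C (w 0) + Polynomial.C (v 0) * Polynomial.X)
      (Polynomial.C (w 1) + Polynomial.C (v 1) * Polynomial.X)
      (Polynomial.C (w 2) + Polynomial.C (v 2) * Polynomial.X) := by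
  simp [lineRestrict, pen, pv, pc, Polynomial.C_eq_algebraMap]

lemma coeffs_aux (q : K) (r : Polynomial K) :
    (Polynomial.C q * Polynomial.X ^ 2 + Polynomial.X ^ 3 * r).coeff 0 = 0 ∧
    (Polynomial.C q * Polynomial.X ^ 2 + Polynomial.X ^ 3 * r).coeff 1 = 0 ∧
    (Polynomial.C q * Polynomial.X ^ 2 + Polynomial.X ^ 3 * r).coeff 2 = q := by
  refine ⟨?_, ?_, ?_⟩ <;> simp [Polynomial.coeff_X_pow, Polynomial.coeff_X_pow_mul']

lemma lineD (l : K) (v : Fin 3 → K) : ∃ r, lineRestrict (pen 1 0 l) ![l, 1, 1] v =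
    Polynomial.C (9 * (l ^ 3 - 1) ^ 2 * (v 1 - v 2) ^ 2) * Polynomial.X ^ 2 + Polynomial.X ^ 3 * r := by
  rw [lineRestrict_pen]
  obtain ⟨r, hr⟩ := pv_expand 1 0 (Polynomial.C l) (Polynomial.C (v 0)) (Polynomial.C (v 1))
    (Polynomial.C (v 2)) Polynomial.X
  refine ⟨r, ?_⟩
  simp only [Polynomial.C_1, Polynomial.C_0, Matrix.cons_val_zero, Matrix.cons_val_one, Matrix.cons_val]
  rw [hr]
  simp only [map_mul, map_pow, map_sub, map_ofNat, map_one]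
  ring

lemma lineE (l : K) (v : Fin 3 → K) : ∃ r, lineRestrict (pen 0 1 l) ![l, 1, 1] v =
    Polynomial.C ((1 - l ^ 3) * ((v 0 - l * v 1) ^ 2 + l * (v 0 - l * v 1) * (v 1 - v 2)
      - 2 * l ^ 2 * (v 1 - v 2) ^ 2)) * Polynomial.X ^ 2 + Polynomial.X ^ 3 * r := by
  rw [lineRestrict_pen]
  obtain ⟨r, hr⟩ := pv_expand 0 1 (Polynomial.C l) (Polynomial.C (v 0)) (Polynomial.C (v 1))
    (Polynomial.C (v 2)) Polynomial.X
  refine ⟨r, ?_⟩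
  simp only [Polynomial.C_1, Polynomial.C_0, Matrix.cons_val_zero, Matrix.cons_val_one, Matrix.cons_val]
  rw [hr]
  simp only [map_mul, map_pow, map_sub, map_add, map_ofNat, map_one]
  ring

lemma singAt_iff (G : MvPolynomial (Fin 3) K) (w : Fin 3 → K) : SingAt G w ↔
    ∀ v, (lineRestrict G w v).coeff 0 = 0 ∧ (lineRestrict G w v).coeff 1 = 0 := by
  constructor
  · rintro ⟨h0, h1⟩ v
    rw [(lineRestrict_coeff G w v).1, (lineRestrict_coeff G w v).2]
    simp [h0, h1]
  · intro h
    refine ⟨by rw [← (lineRestrict_coeff G w w).1]; exact (h w).1, fun i => ?_⟩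
    have := (h (Pi.single i 1)).2
    rw [(lineRestrict_coeff G w _).2] at this
    simpa [Pi.single_apply] using this

def isPt (l : K) (w : Fin 3 → K) : Prop := ∃ t m : K, t ^ 3 = 1 ∧ m ≠ 0 ∧
  (w = ![m * l, m * t, m * t ^ 2] ∨ w = ![m * t ^ 2, m * l, m * t] ∨ w = ![m * t, m * t ^ 2, m * l])

lemma isPt_sym [Infinite K] (l : K) (w : Fin 3 → K) (hw : isPt l w) : ∃ (g : GL (Fin 3) K) (k : K), k ≠ 0 ∧
    (g : Matrix (Fin 3) (Fin 3) K).mulVec ![l, 1, 1] = w ∧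
    ∀ a b, transformPoly (g : Matrix (Fin 3) (Fin 3) K) (pen a b l) = k • pen a b l := by
  obtain ⟨t, m, ht, hm, hw⟩ := hw
  have ht0 : t ≠ 0 := by rintro rfl; simp at ht
  have t6 : t ^ 6 = 1 := by linear_combination (t ^ 3 + 1) * ht
  rcases hw with rfl | rfl | rfl
  · have hdet : Matrix.det !![m, 0, 0; 0, m * t, 0; 0, 0, m * t ^ 2] ≠ 0 := by
      simp [Matrix.det_fin_three, hm, ht0]
    refine ⟨Matrix.GeneralLinearGroup.mkOfDetNeZero _ hdet, m ^ 6, pow_ne_zero 6 hm, ?_, ?_⟩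
    · change Matrix.mulVec !![m, 0, 0; 0, m * t, 0; 0, 0, m * t ^ 2] _ = _
      ext i; fin_cases i <;> simp [Matrix.mulVec, dotProduct, Fin.sum_univ_three]
    · intro a b
      change transformPoly !![m, 0, 0; 0, m * t, 0; 0, 0, m * t ^ 2] _ = _
      apply MvPolynomial.funext
      intro v
      rw [transform_eval, MvPolynomial.smul_eval, eval_pen, eval_pen]
      simp only [pv, Matrix.mulVec, dotProduct, Fin.sum_univ_three, Matrix.of_apply,
        Matrix.cons_val_zero, Matrix.cons_val_one, Matrix.cons_val, zero_mul, add_zero, zero_add]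
      have e1 : (m * v 0) ^ 3 = m ^ 3 * v 0 ^ 3 := by ring
      have e2 : (m * t * v 1) ^ 3 = m ^ 3 * v 1 ^ 3 := by linear_combination (m ^ 3 * v 1 ^ 3) * ht
      have e3 : (m * t ^ 2 * v 2) ^ 3 = m ^ 3 * v 2 ^ 3 := by linear_combination (m ^ 3 * v 2 ^ 3) * t6
      have e4 : m * v 0 * (m * t * v 1) * (m * t ^ 2 * v 2) = m ^ 3 * (v 0 * v 1 * v 2) := by
        linear_combination (m ^ 3 * v 0 * v 1 * v 2) * ht
      rw [e1, e2, e3, e4]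
      simp only [pc]; ring
  · have hdet : Matrix.det !![0, 0, m * t ^ 2; m, 0, 0; 0, m * t, 0] ≠ 0 := by
      simp [Matrix.det_fin_three, hm, ht0]
    refine ⟨Matrix.GeneralLinearGroup.mkOfDetNeZero _ hdet, m ^ 6, pow_ne_zero 6 hm, ?_, ?_⟩
    · change Matrix.mulVec !![0, 0, m * t ^ 2; m, 0, 0; 0, m * t, 0] _ = _
      ext i; fin_cases i <;> simp [Matrix.mulVec, dotProduct, Fin.sum_univ_three]
    · intro a b
      change transformPoly !![0, 0, m * t ^ 2; m, 0, 0; 0, m * t, 0] _ = _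
      apply MvPolynomial.funext
      intro v
      rw [transform_eval, MvPolynomial.smul_eval, eval_pen, eval_pen]
      simp only [pv, Matrix.mulVec, dotProduct, Fin.sum_univ_three, Matrix.of_apply,
        Matrix.cons_val_zero, Matrix.cons_val_one, Matrix.cons_val, zero_mul, add_zero, zero_add]
      have e1 : (m * v 0) ^ 3 = m ^ 3 * v 0 ^ 3 := by ring
      have e2 : (m * t * v 1) ^ 3 = m ^ 3 * v 1 ^ 3 := by linear_combination (m ^ 3 * v 1 ^ 3) * ht
      have e3 : (m * t ^ 2 * v 2) ^ 3 = m ^ 3 * v 2 ^ 3 := by linear_combination (m ^ 3 * v 2 ^ 3) * t6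
      have e4 : m * t ^ 2 * v 2 * (m * v 0) * (m * t * v 1) = m ^ 3 * (v 0 * v 1 * v 2) := by
        linear_combination (m ^ 3 * v 0 * v 1 * v 2) * ht
      rw [e1, e2, e3, e4]
      simp only [pc]; ring
  · have hdet : Matrix.det !![0, m * t, 0; 0, 0, m * t ^ 2; m, 0, 0] ≠ 0 := by
      simp [Matrix.det_fin_three, hm, ht0]
    refine ⟨Matrix.GeneralLinearGroup.mkOfDetNeZero _ hdet, m ^ 6, pow_ne_zero 6 hm, ?_, ?_⟩
    · change Matrix.mulVec !![0, m * t, 0; 0, 0, m * t ^ 2; m, 0, 0] _ = _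
      ext i; fin_cases i <;> simp [Matrix.mulVec, dotProduct, Fin.sum_univ_three]
    · intro a b
      change transformPoly !![0, m * t, 0; 0, 0, m * t ^ 2; m, 0, 0] _ = _
      apply MvPolynomial.funext
      intro v
      rw [transform_eval, MvPolynomial.smul_eval, eval_pen, eval_pen]
      simp only [pv, Matrix.mulVec, dotProduct, Fin.sum_univ_three, Matrix.of_apply,
        Matrix.cons_val_zero, Matrix.cons_val_one, Matrix.cons_val, zero_mul, add_zero, zero_add]
      have e1 : (m * v 0) ^ 3 = m ^ 3 * v 0 ^ 3 := by ring
      have e2 : (m * t * v 1) ^ 3 = m ^ 3 * v 1 ^ 3 := by linear_combination (m ^ 3 * v 1 ^ 3) * ht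
      have e3 : (m * t ^ 2 * v 2) ^ 3 = m ^ 3 * v 2 ^ 3 := by linear_combination (m ^ 3 * v 2 ^ 3) * t6
      have e4 : m * t * v 1 * (m * t ^ 2 * v 2) * (m * v 0) = m ^ 3 * (v 0 * v 1 * v 2) := by
        linear_combination (m ^ 3 * v 0 * v 1 * v 2) * ht
      rw [e1, e2, e3, e4]
      simp only [pc]; ring

lemma pen_sing [Infinite K] (l : K) (w : Fin 3 → K) (hw : isPt l w) :
    SingAt (pen 1 0 l) w ∧ SingAt (pen 0 1 l) w := by
  obtain ⟨g, k, hk, rfl, hg⟩ := isPt_sym l w hw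
  constructor <;> rw [singAt_iff] <;> intro v <;> obtain ⟨v', rfl⟩ := GL_surj g v <;>
    rw [← transform_lineRestrict, hg, lineRestrict_smul]
  · obtain ⟨r, hr⟩ := lineD l v'
    rw [hr]
    simp only [Polynomial.coeff_smul]
    rw [(coeffs_aux _ r).1, (coeffs_aux _ r).2.1]; simp
  · obtain ⟨r, hr⟩ := lineE l v'
    rw [hr]
    simp only [Polynomial.coeff_smul]
    rw [(coeffs_aux _ r).1, (coeffs_aux _ r).2.1]; simp

lemma pen_exc [Infinite K] (h3 : (3 : K) ≠ 0) (l : K) (hl : l ^ 3 ≠ 1) (w v : Fin 3 → K) (hw : isPt l w)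
    (hv : LinearIndependent K ![w, v]) : (lineRestrict (pen 1 0 l) w v).coeff 2 ≠ 0 ∨
      (lineRestrict (pen 0 1 l) w v).coeff 2 ≠ 0 := by
  by_contra hcon
  push Not at hcon
  obtain ⟨c1, c2⟩ := hcon
  obtain ⟨g, k, hk, rfl, hg⟩ := isPt_sym l w hw
  obtain ⟨v', rfl⟩ := GL_surj g v
  rw [← transform_lineRestrict, hg, lineRestrict_smul] at c1 c2
  obtain ⟨r, hr⟩ := lineD l v'
  obtain ⟨r', hr'⟩ := lineE l v'
  rw [hr, Polynomial.coeff_smul, (coeffs_aux _ r).2.2, smul_eq_mul] at c1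
  rw [hr', Polynomial.coeff_smul, (coeffs_aux _ r').2.2, smul_eq_mul] at c2
  have h1 : l ^ 3 - 1 ≠ 0 := sub_ne_zero.2 hl
  have h1' : 1 - l ^ 3 ≠ 0 := sub_ne_zero.2 hl.symm
  have h9 : (9 : K) ≠ 0 := by
    have : (9 : K) = 3 ^ 2 := by norm_num
    rw [this]; exact pow_ne_zero 2 h3
  have s0 : v' 1 - v' 2 = 0 := by simpa [hk, h9, h1] using c1
  rw [s0] at c2
  have m0 : v' 0 - l * v' 1 = 0 := by simpa [hk, h1'] using c2
  rw [LinearIndependent.pair_iff] at hv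
  have e : v' = v' 1 • ![l, 1, 1] := by
    ext i; fin_cases i
    · simp; linear_combination m0
    · simp
    · simp; linear_combination -s0
  have := hv (v' 1) (-1) (by
    nth_rewrite 2 [e]
    rw [Matrix.mulVec_smul]; simp)
  simp at this

lemma pen_add (a b l : K) : pen a b l = a • pen 1 0 l + b • pen 0 1 l := by
  simp only [pen, pv, pc, MvPolynomial.smul_eq_C_mul, map_one, map_zero]; ring

end hesseC

section hesseD
variable {K : Type*} [Field K]

def crs (a b : Fin 3 → K) : Fin 3 → K :=
  ![a 1 * b 2 - a 2 * b 1, a 2 * b 0 - a 0 * b 2, a 0 * b 1 - a 1 * b 0]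

lemma orth_cross (a b G : Fin 3 → K) (hab : LinearIndependent K ![a, b])
    (h1 : G 0 * a 0 + G 1 * a 1 + G 2 * a 2 = 0) (h2 : G 0 * b 0 + G 1 * b 1 + G 2 * b 2 = 0) :
    ∃ μ : K, G = μ • crs a b := by
  rw [linInd_iff] at hab
  rcases hab with h | h | h
  · refine ⟨G 0 / (a 1 * b 2 - a 2 * b 1), ?_⟩
    ext i; fin_cases i <;> simp [crs] <;> field_simp
    · linear_combination -a 2 * h2 + b 2 * h1
    · linear_combination a 1 * h2 - b 1 * h1
  · refine ⟨G 1 / (a 2 * b 0 - a 0 * b 2), ?_⟩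
    ext i; fin_cases i <;> simp [crs] <;> field_simp
    · linear_combination a 2 * h2 - b 2 * h1
    · linear_combination -a 0 * h2 + b 0 * h1
  · refine ⟨G 2 / (a 0 * b 1 - a 1 * b 0), ?_⟩
    ext i; fin_cases i <;> simp [crs] <;> field_simp
    · linear_combination -a 1 * h2 + b 1 * h1
    · linear_combination a 0 * h2 - b 0 * h1

lemma flex_hs (f : Fin 10 → K) (a b : Fin 3 → K) (hab : LinearIndependent K ![a, b])
    (h0 : cf f a = 0) (h1 : cp f a b = 0) (h2 : cp f b a = 0) : hs f a = 0 ∧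
    ∃ μ : K, ![cf0 f a, cf1 f a, cf2 f a] = μ • crs a b := by
  obtain ⟨μ, hμ⟩ := orth_cross a b ![cf0 f a, cf1 f a, cf2 f a] hab
    (by have := euler f a; rw [h0] at this; simpa [cp] using this) (by simpa [cp] using h1)
  refine ⟨?_, μ, hμ⟩
  have g0 : cf0 f a = μ * (a 1 * b 2 - a 2 * b 1) := by simpa [crs] using congrFun hμ 0
  have g1 : cf1 f a = μ * (a 2 * b 0 - a 0 * b 2) := by simpa [crs] using congrFun hμ 1
  have g2 : cf2 f a = μ * (a 0 * b 1 - a 1 * b 0) := by simpa [crs] using congrFun hμ 2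
  have key : ∀ x y : K, cp f (x • a + y • b) a = 0 := fun x y => by
    rw [cp_comb, h0, h1, h2]; ring
  have i0 := hs_id0 f a
  have i1 := hs_id1 f a
  have i2 := hs_id2 f a
  rw [show ![0, cf2 f a, - cf1 f a] = (-μ * b 0) • a + (μ * a 0) • b by
    rw [g1, g2]; ext i; fin_cases i <;> simp <;> ring, key, h0] at i0
  rw [show ![cf2 f a, 0, - cf0 f a] = (μ * b 1) • a + (-μ * a 1) • b by
    rw [g0, g2]; ext i; fin_cases i <;> simp <;> ring, key, h0] at i1
  rw [show ![cf1 f a, - cf0 f a, 0] = (-μ * b 2) • a + (μ * a 2) • b by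
    rw [g0, g1]; ext i; fin_cases i <;> simp <;> ring, key, h0] at i2
  by_contra hne
  simp [hne] at i0 i1 i2
  rw [linInd_iff] at hab
  simp [i0, i1, i2] at hab

lemma hs_hes (l : K) (a : Fin 3 → K) : hs (hes l) a = 27 * (l ^ 3 - 1) * (a 0 * a 1 * a 2) := by
  simp [hs, hes]; ring

lemma grad_hes (l : K) (a : Fin 3 → K) : cf0 (hes l) a = 3 * (a 0 ^ 2 - l * (a 1 * a 2)) ∧
    cf1 (hes l) a = 3 * (a 1 ^ 2 - l * (a 0 * a 2)) ∧ cf2 (hes l) a = 3 * (a 2 ^ 2 - l * (a 0 * a 1)) := by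
  refine ⟨?_, ?_, ?_⟩ <;> simp [cf0, cf1, cf2, hes] <;> ring

lemma isPt_smul (l : K) (w : Fin 3 → K) (m : K) (hm : m ≠ 0) (hw : isPt l w) : isPt l (m • w) := by
  obtain ⟨t, n, ht, hn, hw⟩ := hw
  refine ⟨t, m * n, ht, mul_ne_zero hm hn, ?_⟩
  rcases hw with rfl | rfl | rfl
  · left; simp [mul_assoc]
  · right; left; simp [mul_assoc]
  · right; right; simp [mul_assoc]

lemma isPt_of_infl (h3 : (3 : K) ≠ 0) (l : K) (hl : l ^ 3 ≠ 1) (w : Fin 3 → K)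
    (hw : IsInflLine (cub (hes l)) w) : isPt l w := by
  rw [infl_iff] at hw
  obtain ⟨hw0, a, b, ha, hb, hab, h0, h1, h2, -⟩ := hw
  obtain ⟨hh, μ, hμ⟩ := flex_hs _ a b hab h0 h1 h2
  obtain ⟨ν, rfl⟩ := orth_cross a b w hab (by simpa [dotv, Fin.sum_univ_three] using ha)
    (by simpa [dotv, Fin.sum_univ_three] using hb)
  have hν : ν ≠ 0 := by rintro rfl; simp at hw0
  have h27 : (27 : K) ≠ 0 := by
    have : (27 : K) = 3 ^ 3 := by norm_num
    rw [this]; exact pow_ne_zero 3 h3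
  rw [hs_hes] at hh
  have hprod : a 0 * a 1 * a 2 = 0 :=
    (mul_eq_zero.1 hh).resolve_left (mul_ne_zero h27 (sub_ne_zero.2 hl))
  have hne : ¬ (a 0 = 0 ∧ a 1 = 0 ∧ a 2 = 0) := by
    rintro ⟨e0, e1, e2⟩
    rw [linInd_iff] at hab
    simp [e0, e1, e2] at hab
  obtain ⟨G0, G1, G2⟩ := grad_hes l a
  rw [G0, G1, G2] at hμ
  simp only [cf, hes] at h0
  simp at h0
  have fin : ∀ v : Fin 3 → K, v ≠ 0 → isPt l v → v = μ • crs a b → isPt l (ν • crs a b) := by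
    intro v hv hp e
    have hμ0 : μ ≠ 0 := by rintro rfl; simp at e; exact hv e
    have : ν • crs a b = (ν / μ) • v := by rw [e, smul_smul]; field_simp
    rw [this]; exact isPt_smul l v _ (div_ne_zero hν hμ0) hp
  rcases mul_eq_zero.1 hprod with hp | e2
  · rcases mul_eq_zero.1 hp with e0 | e1
    · have ha1 : a 1 ≠ 0 := fun e1 => hne ⟨e0, e1, by simpa [e0, e1] using h0⟩
      obtain ⟨z, hz⟩ : ∃ z, a 2 = -z * a 1 := ⟨-a 2 / a 1, by field_simp⟩
      rw [e0, hz] at h0 hμ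
      have hz3 : z ^ 3 = 1 := by
        have : a 1 ^ 3 * (1 - z ^ 3) = 0 := by linear_combination h0
        have := (mul_eq_zero.1 this).resolve_left (pow_ne_zero 3 ha1)
        linear_combination -this
      have hz0 : z ≠ 0 := by rintro rfl; simp at hz3
      refine fin _ ?_ ?_ hμ
      · intro h
        have := congrFun h 1
        simp [h3, ha1] at this
      · refine ⟨z ^ 2, 3 * a 1 ^ 2 * z, by linear_combination (z ^ 3 + 1) * hz3,
          mul_ne_zero (mul_ne_zero h3 (pow_ne_zero 2 ha1)) hz0, Or.inl ?_⟩
        ext i; fin_cases i <;> simp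
        · ring
        · linear_combination -3 * a 1 ^ 2 * hz3
        · linear_combination -3 * a 1 ^ 2 * z ^ 2 * hz3
    · have ha1 : a 2 ≠ 0 := fun e2 => hne ⟨by simpa [e2, e1] using h0, e1, e2⟩
      obtain ⟨z, hz⟩ : ∃ z, a 0 = -z * a 2 := ⟨-a 0 / a 2, by field_simp⟩
      rw [e1, hz] at h0 hμ
      have hz3 : z ^ 3 = 1 := by
        have : a 2 ^ 3 * (1 - z ^ 3) = 0 := by linear_combination h0
        have := (mul_eq_zero.1 this).resolve_left (pow_ne_zero 3 ha1)
        linear_combination -this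
      have hz0 : z ≠ 0 := by rintro rfl; simp at hz3
      refine fin _ ?_ ?_ hμ
      · intro h
        have := congrFun h 2
        simp [h3, ha1] at this
      · refine ⟨z ^ 2, 3 * a 2 ^ 2 * z, by linear_combination (z ^ 3 + 1) * hz3,
          mul_ne_zero (mul_ne_zero h3 (pow_ne_zero 2 ha1)) hz0, Or.inr (Or.inl ?_)⟩
        ext i; fin_cases i <;> simp
        · linear_combination -3 * a 2 ^ 2 * z ^ 2 * hz3
        · ring
        · linear_combination -3 * a 2 ^ 2 * hz3
  · have ha1 : a 0 ≠ 0 := fun e0 => hne ⟨e0, by simpa [e2, e0] using h0, e2⟩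
    obtain ⟨z, hz⟩ : ∃ z, a 1 = -z * a 0 := ⟨-a 1 / a 0, by field_simp⟩
    rw [e2, hz] at h0 hμ
    have hz3 : z ^ 3 = 1 := by
      have : a 0 ^ 3 * (1 - z ^ 3) = 0 := by linear_combination h0
      have := (mul_eq_zero.1 this).resolve_left (pow_ne_zero 3 ha1)
      linear_combination -this
    have hz0 : z ≠ 0 := by rintro rfl; simp at hz3
    refine fin _ ?_ ?_ hμ
    · intro h
      have := congrFun h 0
      simp [h3, ha1] at this
    · refine ⟨z ^ 2, 3 * a 0 ^ 2 * z, by linear_combination (z ^ 3 + 1) * hz3,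
        mul_ne_zero (mul_ne_zero h3 (pow_ne_zero 2 ha1)) hz0, Or.inr (Or.inr ?_)⟩
      ext i; fin_cases i <;> simp
      · linear_combination -3 * a 0 ^ 2 * hz3
      · linear_combination -3 * a 0 ^ 2 * z ^ 2 * hz3
      · ring

lemma infl_of_isPt (l : K) (hl : l ^ 3 ≠ 1) (w : Fin 3 → K)
    (hw : isPt l w) : IsInflLine (cub (hes l)) w := by
  rw [infl_iff]
  obtain ⟨t, m, ht, hm, hw⟩ := hw
  have ht0 : t ≠ 0 := by rintro rfl; simp at ht
  have t6 : t ^ 6 = 1 := by linear_combination (t ^ 3 + 1) * ht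
  have h1 : 1 - l ^ 3 ≠ 0 := sub_ne_zero.2 (Ne.symm hl)
  rcases hw with rfl | rfl | rfl
  · refine ⟨fun h => by simpa [hm, ht0] using congrFun h 1, ![0, 1, -t ^ 2], ![1, -l * t ^ 2, 0],
      ?_, ?_, ?_, ?_, ?_, ?_, ?_⟩
    · simp [dotv, Fin.sum_univ_three]; linear_combination -m * t * ht
    · simp [dotv, Fin.sum_univ_three]; linear_combination -m * l * ht
    · rw [linInd_iff]; simp
    · simp [cf, hes]; linear_combination -t6
    · simp [cp, cf0, cf1, cf2, hes]; ring
    · simp [cp, cf0, cf1, cf2, hes]; linear_combination 0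
    · simp [cf, hes]
      intro h; apply h1; linear_combination h + l ^ 3 * t6
  · refine ⟨fun h => by simpa [hm, ht0] using congrFun h 2, ![-t ^ 2, 0, 1], ![0, 1, -l * t ^ 2],
      ?_, ?_, ?_, ?_, ?_, ?_, ?_⟩
    · simp [dotv, Fin.sum_univ_three]; linear_combination -m * t * ht
    · simp [dotv, Fin.sum_univ_three]; linear_combination -m * l * ht
    · rw [linInd_iff]; simp
    · simp [cf, hes]; linear_combination -t6
    · simp [cp, cf0, cf1, cf2, hes]; ring
    · simp [cp, cf0, cf1, cf2, hes]; linear_combination 0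
    · simp [cf, hes]
      intro h; apply h1; linear_combination h + l ^ 3 * t6
  · refine ⟨fun h => by simpa [hm, ht0] using congrFun h 0, ![1, -t ^ 2, 0], ![-l * t ^ 2, 0, 1],
      ?_, ?_, ?_, ?_, ?_, ?_, ?_⟩
    · simp [dotv, Fin.sum_univ_three]; linear_combination -m * t * ht
    · simp [dotv, Fin.sum_univ_three]; linear_combination -m * l * ht
    · rw [linInd_iff]; simp
    · simp [cf, hes]; linear_combination -t6
    · simp [cp, cf0, cf1, cf2, hes]; ring
    · simp [cp, cf0, cf1, cf2, hes]; linear_combination 0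
    · simp [cf, hes]
      intro h; apply h1; linear_combination h + l ^ 3 * t6

lemma infl_hes_iff (h3 : (3 : K) ≠ 0) (l : K) (hl : l ^ 3 ≠ 1) (w : Fin 3 → K) :
    IsInflLine (cub (hes l)) w ↔ isPt l w := ⟨isPt_of_infl h3 l hl w, infl_of_isPt l hl w⟩

end hesseD

section hesseE
variable {K : Type*} [Field K]

def sx (c : ℕ → ℕ → ℕ → K) : MvPolynomial (Fin 3) K :=
  sv (fun i j k => MvPolynomial.C (c i j k)) (X 0) (X 1) (X 2)

lemma eval_sx (c : ℕ → ℕ → ℕ → K) (w : Fin 3 → K) : eval w (sx c) = sv c (w 0) (w 1) (w 2) := by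
  simp [sx, sv]

lemma pd_term (c : K) (a b d : ℕ) (w : Fin 3 → K) (i : Fin 3) :
    eval w (pderiv i (MvPolynomial.C c * (X 0 ^ a * X 1 ^ b * X 2 ^ d))) =
    c * (a * w 0 ^ (a - 1) * w 1 ^ b * w 2 ^ d * (if i = 0 then 1 else 0)
      + b * w 0 ^ a * w 1 ^ (b - 1) * w 2 ^ d * (if i = 1 then 1 else 0)
      + d * w 0 ^ a * w 1 ^ b * w 2 ^ (d - 1) * (if i = 2 then 1 else 0)) := by
  fin_cases i <;> simp [pderiv_X, Derivation.leibniz, Derivation.leibniz_pow] <;> left <;> ring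

lemma pd_sx (c : ℕ → ℕ → ℕ → K) (w : Fin 3 → K) :
    eval w (pderiv 0 (sx c)) = s1 c (w 0) (w 1) (w 2) ∧
    eval w (pderiv 1 (sx c)) = s1 (rot c) (w 1) (w 2) (w 0) ∧
    eval w (pderiv 2 (sx c)) = s1 (rot (rot c)) (w 2) (w 0) (w 1) := by
  have e : sx c = ∑ i ∈ Finset.range 7, ∑ j ∈ Finset.range (7 - i),
      MvPolynomial.C (c i j (6 - i - j)) * (X 0 ^ i * X 1 ^ j * X 2 ^ (6 - i - j)) := by
    simp [Finset.sum_range_succ, sx, sv]; ring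
  rw [e]
  simp only [map_sum, pd_term]
  refine ⟨?_, ?_, ?_⟩
  · simp [Finset.sum_range_succ, s1]; ring
  · simp [Finset.sum_range_succ, s1, rot]; ring
  · simp [Finset.sum_range_succ, s1, rot]; ring

lemma exists_sx (G : MvPolynomial (Fin 3) K) (hG : G.IsHomogeneous 6) : ∃ c, G = sx c := by
  obtain ⟨c, rfl⟩ := hom_expand 6 G hG
  refine ⟨fun i j _ => c i j, ?_⟩
  simp [Finset.sum_range_succ, sx, sv]; ring

lemma sextic_ub (h3 : (3 : K) ≠ 0) (o : K) (ho : o ^ 2 + o + 1 = 0) (l : K) (hl : l ^ 3 ≠ 1)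
    (h2 : (2 : K) ≠ 0 ∨ l ≠ 0) (G : MvPolynomial (Fin 3) K) (hG : G.IsHomogeneous 6)
    (hs : ∀ w, isPt l w → SingAt G w) : ∃ a b : K, G = pen a b l := by
  obtain ⟨c, rfl⟩ := exists_sx G hG
  have H : ∀ w, isPt l w → sv c (w 0) (w 1) (w 2) = 0 ∧ s1 c (w 0) (w 1) (w 2) = 0 ∧
      s1 (rot c) (w 1) (w 2) (w 0) = 0 ∧ s1 (rot (rot c)) (w 2) (w 0) (w 1) = 0 := by
    intro w hw
    obtain ⟨e, e'⟩ := hs w hw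
    obtain ⟨p0, p1, p2⟩ := pd_sx c w
    rw [eval_sx] at e
    exact ⟨e, p0 ▸ e' 0, p1 ▸ e' 1, p2 ▸ e' 2⟩
  have H0 : Hyp l c := by
    intro t ht
    simpa using H ![l, t, t ^ 2] ⟨t, 1, ht, one_ne_zero, by simp⟩
  have H1 : Hyp l (rot c) := by
    intro t ht
    obtain ⟨e0, e1, e2, e3⟩ := by simpa using H ![t ^ 2, l, t] ⟨t, 1, ht, one_ne_zero, by simp⟩
    refine ⟨?_, e2, e3, e1⟩
    rw [← e0]; simp only [sv, rot]; ring
  have H2 : Hyp l (rot (rot c)) := by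
    intro t ht
    obtain ⟨e0, e1, e2, e3⟩ := by simpa using H ![t, t ^ 2, l] ⟨t, 1, ht, one_ne_zero, by simp⟩
    refine ⟨?_, e3, e1, e2⟩
    rw [← e0]; simp only [sv, rot]; ring
  obtain ⟨⟨a1, a2, a3⟩, ⟨a4, a5, a6⟩, ⟨a7, a8, a9⟩⟩ := class1 h3 o ho l hl c H0 H1 H2
  obtain ⟨⟨b1, b2, b3⟩, ⟨b4, b5, b6⟩, ⟨b7, b8, b9⟩⟩ := class1 h3 o ho l hl (swp c) (hyp_swp l _ H0)
    (hyp_swp l _ H2) (hyp_swp l _ H1)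
  obtain ⟨a, b, ⟨c1, c2, c3⟩, ⟨c4, c5, c6⟩, ⟨c7, c8, c9⟩, c10⟩ := class0 h3 o ho l hl h2 c H0 H1 H2
  refine ⟨a, b, ?_⟩
  simp only [swp] at b1 b2 b3 b4 b5 b6 b7 b8 b9
  simp only [sx, sv, pen, pv, pc, a1, a2, a3, a4, a5, a6, a7, a8, a9, b1, b2, b3, b4, b5, b6, b7, b8, b9,
    c1, c2, c3, c4, c5, c6, c7, c8, c9, c10, map_zero, map_add, map_mul, map_sub, map_pow, map_ofNat,
    map_neg, map_one]
  ring

def hcub (l : K) : Fin 10 → K := ![l, l, l, 0, 0, 0, 0, 0, 0, -(l ^ 3 + 2)]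

lemma cubic_ub (h3 : (3 : K) ≠ 0) (o : K) (ho : o ^ 2 + o + 1 = 0) (l : K) (hl : l ^ 3 ≠ 1)
    (h2 : (2 : K) ≠ 0 ∨ l ≠ 0) (G : MvPolynomial (Fin 3) K) (hG : G.IsHomogeneous 3)
    (hs : ∀ w, isPt l w → eval w G = 0) : ∃ a : K, G = a • cub (hcub l) := by
  obtain ⟨f, rfl⟩ := exists_cub G hG
  have h1 : l ^ 3 - 1 ≠ 0 := sub_ne_zero.2 hl
  obtain ⟨A0, B0, C0⟩ := fourier h3 o ho (f 0 * l ^ 3 + f 1 + f 2 + f 9 * l)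
    (f 3 * l ^ 2 + f 6 + f 7 * l) (f 4 * l ^ 2 + f 5 * l + f 8) (fun t ht => by
      have e := hs ![l, t, t ^ 2] ⟨t, 1, ht, one_ne_zero, by simp⟩
      rw [eval_cub] at e
      simp [cf] at e
      linear_combination e - (f 1 + f 2 * (t ^ 3 + 1) + f 6 * t + f 7 * l * t + f 8 * t ^ 2 + f 9 * l) * ht)
  obtain ⟨A1, B1, C1⟩ := fourier h3 o ho (f 0 + f 1 * l ^ 3 + f 2 + f 9 * l)
    (f 3 * l + f 6 * l ^ 2 + f 7) (f 4 + f 5 * l ^ 2 + f 8 * l) (fun t ht => by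
      have e := hs ![t ^ 2, l, t] ⟨t, 1, ht, one_ne_zero, by simp⟩
      rw [eval_cub] at e
      simp [cf] at e
      linear_combination e - (f 0 * (t ^ 3 + 1) + f 2 + f 3 * l * t + f 4 * t ^ 2 + f 7 * t + f 9 * l) * ht)
  obtain ⟨A2, B2, C2⟩ := fourier h3 o ho (f 0 + f 1 + f 2 * l ^ 3 + f 9 * l)
    (f 3 + f 6 * l + f 7 * l ^ 2) (f 4 * l + f 5 + f 8 * l ^ 2) (fun t ht => by
      have e := hs ![t, t ^ 2, l] ⟨t, 1, ht, one_ne_zero, by simp⟩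
      rw [eval_cub] at e
      simp [cf] at e
      linear_combination e - (f 0 + f 1 * (t ^ 3 + 1) + f 3 * t + f 5 * t ^ 2 + f 6 * l * t + f 9 * l) * ht)
  have z : ∀ x : K, (l ^ 3 - 1) * x = 0 → x = 0 := fun x hx => (mul_eq_zero.1 hx).resolve_left h1
  have f3 : f 3 = 0 := z _ (by linear_combination l * B0 - B2)
  have f6 : f 6 = 0 := z _ (by linear_combination l * B1 - B0)
  have f7 : f 7 = 0 := z _ (by linear_combination l * B2 - B1)
  have f4 : f 4 = 0 := z _ (by linear_combination l * C0 - C1)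
  have f5 : f 5 = 0 := z _ (by linear_combination l * C1 - C2)
  have f8 : f 8 = 0 := z _ (by linear_combination l * C2 - C0)
  have f01 : f 1 = f 0 := sub_eq_zero.1 (z _ (by linear_combination A1 - A0))
  have f02 : f 2 = f 0 := sub_eq_zero.1 (z _ (by linear_combination A2 - A0))
  rw [f01, f02] at A0
  obtain ⟨a, ha0, ha9⟩ : ∃ a, f 0 = a * l ∧ f 9 = - a * (l ^ 3 + 2) := by
    by_cases hl0 : l = 0
    · subst hl0
      have h2' : (2 : K) ≠ 0 := by simpa using h2
      have : f 0 = 0 := by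
        have : 2 * f 0 = 0 := by linear_combination A0
        exact (mul_eq_zero.1 this).resolve_left h2'
      exact ⟨-f 9 / 2, by simp [this], by field_simp; ring⟩
    · refine ⟨f 0 / l, by field_simp, ?_⟩
      field_simp
      linear_combination A0
  refine ⟨a, ?_⟩
  simp only [cub, hcub, f3, f4, f5, f6, f7, f8, f01, f02, ha0, ha9, MvPolynomial.smul_eq_C_mul]
  simp
  ring

lemma eval_hcub (l : K) (w : Fin 3 → K) :
    eval w (cub (hcub l)) = l * (w 0 ^ 3 + w 1 ^ 3 + w 2 ^ 3) - (l ^ 3 + 2) * (w 0 * w 1 * w 2) := by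
  rw [eval_cub]; simp [cf, hcub]; ring

lemma hcub_van (l : K) (w : Fin 3 → K) (hw : isPt l w) : eval w (cub (hcub l)) = 0 := by
  rw [eval_hcub]
  obtain ⟨t, m, ht, hm, rfl | rfl | rfl⟩ := hw
  all_goals
    simp
    linear_combination m ^ 3 * (l + l * (t ^ 3 + 1) - (l ^ 3 + 2) * l) * ht

lemma hcub_ne (l : K) (hl : l ^ 3 ≠ 1) (h2 : (2 : K) ≠ 0 ∨ l ≠ 0) : cub (hcub l) ≠ 0 := by
  intro h
  have e0 := eval_hcub l ![1, 0, 0]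
  have e1 := eval_hcub l ![1, 1, 1]
  rw [h] at e0 e1
  simp at e0 e1
  subst e0
  simp at e1 h2
  exact h2 (by linear_combination e1)

lemma pen_indep (l : K) (hl : l ^ 3 ≠ 1) (a b : K) (h : a • pen 1 0 l + b • pen 0 1 l = 0) : a = 0 ∧ b = 0 := by
  rw [← pen_add] at h
  have e0 := eval_pen a b l ![1, 0, 0]
  have e1 := eval_pen a b l ![1, 1, 1]
  rw [h] at e0 e1
  simp [pv, pc] at e0 e1
  subst e0
  have : (1 - l) ≠ 0 := fun h => hl (by rw [← sub_eq_zero.1 h]; ring)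
  have e : b * (1 - l) ^ 3 = 0 := by linear_combination -e1
  exact ⟨rfl, (mul_eq_zero.1 e).resolve_right (pow_ne_zero 3 this)⟩

lemma pen_hom (a b l : K) : (pen a b l).IsHomogeneous 6 := by
  have hX : ∀ i : Fin 3, (X i ^ 3 : MvPolynomial (Fin 3) K).IsHomogeneous 3 := fun i => by
    simpa using (isHomogeneous_X K i).pow 3
  have hp : (X 0 * X 1 * X 2 : MvPolynomial (Fin 3) K).IsHomogeneous 3 :=
    ((isHomogeneous_X K 0).mul (isHomogeneous_X K 1)).mul (isHomogeneous_X K 2)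
  have hC : ∀ x : K, (MvPolynomial.C x : MvPolynomial (Fin 3) K).IsHomogeneous 0 := fun x => isHomogeneous_C _ x
  have e6 : pen a b l = MvPolynomial.C a * (X 0 ^ 3 * X 0 ^ 3 + X 1 ^ 3 * X 1 ^ 3 + X 2 ^ 3 * X 2 ^ 3
      + MvPolynomial.C (4 * l ^ 3 - 2) * (X 0 ^ 3 * X 1 ^ 3 + X 1 ^ 3 * X 2 ^ 3 + X 2 ^ 3 * X 0 ^ 3)
      - MvPolynomial.C (6 * l ^ 2) * ((X 0 * X 1 * X 2) * (X 0 ^ 3 + X 1 ^ 3 + X 2 ^ 3))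
      + MvPolynomial.C (12 * l - 3 * l ^ 4) * ((X 0 * X 1 * X 2) * (X 0 * X 1 * X 2)))
      + MvPolynomial.C b * (MvPolynomial.C (l ^ 2) * (X 0 ^ 3 * X 1 ^ 3 + X 1 ^ 3 * X 2 ^ 3 + X 2 ^ 3 * X 0 ^ 3)
      - MvPolynomial.C l * ((X 0 * X 1 * X 2) * (X 0 ^ 3 + X 1 ^ 3 + X 2 ^ 3))
      - MvPolynomial.C (l ^ 3 - 1) * ((X 0 * X 1 * X 2) * (X 0 * X 1 * X 2))) := by
    simp only [pen, pv, pc, map_add, map_mul, map_sub, map_pow, map_ofNat, map_one]; ring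
  rw [e6]
  have q : ((X 0 ^ 3 * X 1 ^ 3 + X 1 ^ 3 * X 2 ^ 3 + X 2 ^ 3 * X 0 ^ 3) : MvPolynomial (Fin 3) K).IsHomogeneous 6 :=
    (((hX 0).mul (hX 1)).add ((hX 1).mul (hX 2))).add ((hX 2).mul (hX 0))
  have s : ((X 0 * X 1 * X 2) * (X 0 ^ 3 + X 1 ^ 3 + X 2 ^ 3) : MvPolynomial (Fin 3) K).IsHomogeneous 6 :=
    hp.mul (((hX 0).add (hX 1)).add (hX 2))
  have pp := hp.mul hp
  exact (((((((hX 0).mul (hX 0)).add ((hX 1).mul (hX 1))).add ((hX 2).mul (hX 2))).add (q.C_mul _)).sub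
    (s.C_mul _)).add (pp.C_mul _)).C_mul _ |>.add ((((q.C_mul _).sub (s.C_mul _)).sub (pp.C_mul _)).C_mul _)

lemma bp_aux (l x y z τ : K) (hx : x ^ 3 = l ^ 3 * τ) (hy : y ^ 3 = τ) (hz : z ^ 3 = τ) (hτ : τ ≠ 0)
    (hp : x * y * z = l * τ) : ∃ t m : K, t ^ 3 = 1 ∧ m ≠ 0 ∧ x = m * l ∧ y = m * t ∧ z = m * t ^ 2 := by
  have hy0 : y ≠ 0 := by rintro rfl; apply hτ; rw [← hy]; ring
  have hz0 : z ≠ 0 := by rintro rfl; apply hτ; rw [← hz]; ring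
  refine ⟨z / y, y ^ 2 / z, ?_, div_ne_zero (pow_ne_zero 2 hy0) hz0, ?_, ?_, ?_⟩
  · field_simp; rw [hy, hz]
  · field_simp
    have : y * (z * x) = y * (y ^ 2 * l) := by linear_combination hp - l * hy
    have := mul_left_cancel₀ hy0 this
    linear_combination this
  · field_simp
  · field_simp

lemma pc_van (l X Y Z p : K) (hl : l ^ 3 ≠ 1) (h2 : (2 : K) ≠ 0 ∨ l ≠ 0) (hXYZ : X * Y * Z = p ^ 3)
    (hD : pc 1 0 l X Y Z p = 0) (hE : pc 0 1 l X Y Z p = 0) :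
    ∃ τ, p = l * τ ∧ ((X = l ^ 3 * τ ∧ Y = τ ∧ Z = τ) ∨ (Y = l ^ 3 * τ ∧ Z = τ ∧ X = τ) ∨
      (Z = l ^ 3 * τ ∧ X = τ ∧ Y = τ)) := by
  simp only [pc] at hD hE
  have hH : l * (X + Y + Z) - (l ^ 3 + 2) * p = 0 := by
    have : (l * (X + Y + Z) - (l ^ 3 + 2) * p) ^ 2 = 0 := by
      linear_combination l ^ 2 * hD - 4 * (l ^ 3 - 1) * hE
    exact pow_eq_zero_iff (two_ne_zero) |>.1 this
  by_cases hl0 : l = 0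
  · subst hl0
    have h2' : (2 : K) ≠ 0 := by simpa using h2
    have hp : p = 0 := by
      have : 2 * p = 0 := by linear_combination -hH
      exact (mul_eq_zero.1 this).resolve_left h2'
    subst hp
    have sq : ∀ a b : K, (a - b) ^ 2 = 0 → a = b := fun a b h =>
      sub_eq_zero.1 (pow_eq_zero_iff (two_ne_zero) |>.1 h)
    have h0 : X * Y * Z = 0 := by rw [hXYZ]; ring
    rcases mul_eq_zero.1 h0 with h | hZ
    · rcases mul_eq_zero.1 h with hX | hY
      · subst hX
        refine ⟨Y, by simp, Or.inl ⟨by simp, rfl, (sq _ _ ?_)⟩⟩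
        linear_combination hD
      · subst hY
        refine ⟨Z, by simp, Or.inr (Or.inl ⟨by simp, rfl, (sq _ _ ?_)⟩)⟩
        linear_combination hD
    · subst hZ
      refine ⟨X, by simp, Or.inr (Or.inr ⟨by simp, rfl, (sq _ _ ?_)⟩)⟩
      linear_combination hD
  · obtain ⟨τ, rfl⟩ : ∃ τ, p = l * τ := ⟨p / l, by field_simp⟩
    refine ⟨τ, rfl, ?_⟩
    have s1 : X + Y + Z = (l ^ 3 + 2) * τ := mul_left_cancel₀ hl0 (by linear_combination hH)
    have s2 : X * Y + Y * Z + Z * X = (2 * l ^ 3 + 1) * τ ^ 2 :=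
      mul_left_cancel₀ (pow_ne_zero 2 hl0) (by linear_combination hE + l ^ 2 * τ * s1)
    have key : ∀ A B C : K, A + B + C = (l ^ 3 + 2) * τ → A * B + B * C + C * A = (2 * l ^ 3 + 1) * τ ^ 2 →
        A = l ^ 3 * τ → B = τ ∧ C = τ := by
      intro A B C e1 e2 e3
      have : (B - τ) ^ 2 = 0 := by
        subst e3; linear_combination B * e1 - e2 + l ^ 3 * τ * (e1) - l ^ 3 * τ * B * 0
      have hB : B = τ := sub_eq_zero.1 (pow_eq_zero_iff (two_ne_zero) |>.1 this)
      exact ⟨hB, by linear_combination e1 - e3 - hB⟩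
    have cube : ∀ A B C : K, A + B + C = (l ^ 3 + 2) * τ → A * B + B * C + C * A = (2 * l ^ 3 + 1) * τ ^ 2 →
        A * B * C = l ^ 3 * τ ^ 3 → A = l ^ 3 * τ ∨ A = τ := by
      intro A B C e1 e2 e3
      have : (A - l ^ 3 * τ) * (A - τ) ^ 2 = 0 := by
        linear_combination A ^ 2 * e1 - A * e2 + e3
      rcases mul_eq_zero.1 this with h | h
      · left; exact sub_eq_zero.1 h
      · right; exact sub_eq_zero.1 (pow_eq_zero_iff (two_ne_zero) |>.1 h)
    have s3 : X * Y * Z = l ^ 3 * τ ^ 3 := by rw [hXYZ]; ring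
    rcases cube X Y Z s1 s2 s3 with h | h
    · left; exact ⟨h, key X Y Z s1 s2 h⟩
    · rcases cube Y Z X (by linear_combination s1) (by linear_combination s2) (by linear_combination s3) with h' | h'
      · right; left; exact ⟨h', key Y Z X (by linear_combination s1) (by linear_combination s2) h'⟩
      · right; right; exact ⟨by linear_combination s1 - h - h', h, h'⟩

lemma base_pt (l : K) (hl : l ^ 3 ≠ 1) (h2 : (2 : K) ≠ 0 ∨ l ≠ 0) (z : Fin 3 → K) (hz : z ≠ 0)
    (hD : eval z (pen 1 0 l) = 0) (hE : eval z (pen 0 1 l) = 0) : isPt l z := by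
  rw [eval_pen] at hD hE
  obtain ⟨τ, hp, h⟩ := pc_van l _ _ _ _ hl h2 (by ring) hD hE
  have hτ : τ ≠ 0 := by
    rintro rfl
    apply hz
    have : z 0 ^ 3 = 0 ∧ z 1 ^ 3 = 0 ∧ z 2 ^ 3 = 0 := by
      rcases h with ⟨e1, e2, e3⟩ | ⟨e1, e2, e3⟩ | ⟨e1, e2, e3⟩ <;> simp [e1, e2, e3]
    obtain ⟨e0, e1, e2⟩ := this
    ext i; fin_cases i
    · exact pow_eq_zero_iff (three_ne_zero) |>.1 e0
    · exact pow_eq_zero_iff (three_ne_zero) |>.1 e1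
    · exact pow_eq_zero_iff (three_ne_zero) |>.1 e2
  rcases h with ⟨e1, e2, e3⟩ | ⟨e1, e2, e3⟩ | ⟨e1, e2, e3⟩
  · obtain ⟨t, m, ht, hm, a1, a2, a3⟩ := bp_aux l _ _ _ τ e1 e2 e3 hτ (by linear_combination hp)
    refine ⟨t, m, ht, hm, Or.inl ?_⟩
    ext i; fin_cases i <;> simp [a1, a2, a3]
  · obtain ⟨t, m, ht, hm, a1, a2, a3⟩ := bp_aux l _ _ _ τ e1 e2 e3 hτ (by linear_combination hp)
    refine ⟨t, m, ht, hm, Or.inr (Or.inl ?_)⟩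
    ext i; fin_cases i <;> simp [a1, a2, a3]
  · obtain ⟨t, m, ht, hm, a1, a2, a3⟩ := bp_aux l _ _ _ τ e1 e2 e3 hτ (by linear_combination hp)
    refine ⟨t, m, ht, hm, Or.inr (Or.inr ?_)⟩
    ext i; fin_cases i <;> simp [a1, a2, a3]

end hesseE

section transport
variable {K : Type*} [Field K]

def Main (F : MvPolynomial (Fin 3) K) : Prop := ∃ D E H : MvPolynomial (Fin 3) K,
  D.IsHomogeneous 6 ∧ E.IsHomogeneous 6 ∧ H.IsHomogeneous 3 ∧ H ≠ 0 ∧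
  (∀ w, IsInflLine F w → SingAt D w ∧ SingAt E w ∧ eval w H = 0) ∧
  (∀ G : MvPolynomial (Fin 3) K, G.IsHomogeneous 6 → (∀ w, IsInflLine F w → SingAt G w) →
    ∃ a b : K, G = a • D + b • E) ∧
  (∀ a b : K, a • D + b • E = 0 → a = 0 ∧ b = 0) ∧
  (∀ G : MvPolynomial (Fin 3) K, G.IsHomogeneous 3 → (∀ w, IsInflLine F w → eval w G = 0) →
    ∃ a : K, G = a • H) ∧
  (∀ z : Fin 3 → K, z ≠ 0 → ¬ IsInflLine F z → eval z D ≠ 0 ∨ eval z E ≠ 0) ∧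
  (∀ w v : Fin 3 → K, IsInflLine F w → LinearIndependent K ![w, v] →
    (lineRestrict D w v).coeff 2 ≠ 0 ∨ (lineRestrict E w v).coeff 2 ≠ 0)

lemma main_hes [Infinite K] (h3 : (3 : K) ≠ 0) (o : K) (ho : o ^ 2 + o + 1 = 0) (l : K) (hl : l ^ 3 ≠ 1)
    (h2 : (2 : K) ≠ 0 ∨ l ≠ 0) : Main (cub (hes l)) := by
  refine ⟨pen 1 0 l, pen 0 1 l, cub (hcub l), pen_hom _ _ _, pen_hom _ _ _, cub_hom _, hcub_ne l hl h2, ?_, ?_,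
    pen_indep l hl, ?_, ?_, ?_⟩ <;> simp only [infl_hes_iff h3 l hl]
  · exact fun w hw => ⟨(pen_sing l w hw).1, (pen_sing l w hw).2, hcub_van l w hw⟩
  · intro G hG hs
    obtain ⟨a, b, h⟩ := sextic_ub h3 o ho l hl h2 G hG hs
    exact ⟨a, b, by rw [h, pen_add]⟩
  · exact fun G hG hs => cubic_ub h3 o ho l hl h2 G hG hs
  · intro z hz hn
    by_contra hcon
    push Not at hcon
    exact hn (base_pt l hl h2 z hz hcon.1 hcon.2)
  · exact fun w v hw hv => pen_exc h3 l hl w v hw hv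

lemma sing_transform (g : GL (Fin 3) K) (G : MvPolynomial (Fin 3) K) (w : Fin 3 → K) :
    SingAt (transformPoly (g : Matrix (Fin 3) (Fin 3) K) G) w ↔
      SingAt G ((g : Matrix (Fin 3) (Fin 3) K).mulVec w) := by
  rw [singAt_iff, singAt_iff]
  constructor
  · intro h v
    obtain ⟨v', rfl⟩ := GL_surj g v
    rw [← transform_lineRestrict]; exact h v'
  · intro h v
    rw [transform_lineRestrict]; exact h _

lemma transform_inv (g : GL (Fin 3) K) (F : MvPolynomial (Fin 3) K) :
    transformPoly (g : Matrix (Fin 3) (Fin 3) K)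
      (transformPoly ((g⁻¹ : GL (Fin 3) K) : Matrix (Fin 3) (Fin 3) K) F) = F := by
  rw [transform_mul, ← Units.val_mul, inv_mul_cancel]
  exact transform_one F

lemma transform_inv' (g : GL (Fin 3) K) (F : MvPolynomial (Fin 3) K) :
    transformPoly ((g⁻¹ : GL (Fin 3) K) : Matrix (Fin 3) (Fin 3) K)
      (transformPoly (g : Matrix (Fin 3) (Fin 3) K) F) = F := by
  rw [transform_mul, ← Units.val_mul, mul_inv_cancel]
  exact transform_one F

lemma main_transport (g : GL (Fin 3) K) (F F' : MvPolynomial (Fin 3) K)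
    (h : ∀ w, IsInflLine F w ↔ IsInflLine F' ((g : Matrix (Fin 3) (Fin 3) K).mulVec w)) (hM : Main F') :
    Main F := by
  obtain ⟨D, E, H, hD, hE, hH, hH0, i1, i2, i3, i4, i5, i6⟩ := hM
  have inv_mul : ∀ w, (g : Matrix (Fin 3) (Fin 3) K).mulVec
      (((g⁻¹ : GL (Fin 3) K) : Matrix (Fin 3) (Fin 3) K).mulVec w) = w := fun w => by
    rw [Matrix.mulVec_mulVec, ← Units.val_mul, mul_inv_cancel]; simp
  have h' : ∀ w, IsInflLine F' w ↔
      IsInflLine F (((g⁻¹ : GL (Fin 3) K) : Matrix (Fin 3) (Fin 3) K).mulVec w) := fun w => by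
    rw [h, inv_mul]
  have hinj : ∀ G, transformPoly (g : Matrix (Fin 3) (Fin 3) K) G = 0 → G = 0 := fun G hG => by
    rw [← transform_inv' g G, hG]; simp [transformPoly]
  refine ⟨transformPoly g.1 D, transformPoly g.1 E, transformPoly g.1 H, transform_hom _ _ _ hD,
    transform_hom _ _ _ hE, transform_hom _ _ _ hH, fun e => hH0 (hinj _ e), ?_, ?_, ?_, ?_, ?_, ?_⟩
  · intro w hw
    rw [sing_transform, sing_transform, transform_eval]
    exact i1 _ ((h w).1 hw)
  · intro G hG hs
    obtain ⟨a, b, e⟩ := i2 (transformPoly (g⁻¹ : GL (Fin 3) K).1 G) (transform_hom _ _ _ hG) (fun w hw => by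
      rw [sing_transform]; exact hs _ ((h' w).1 hw))
    refine ⟨a, b, ?_⟩
    rw [← transform_smul, ← transform_smul, ← transform_add, ← e, transform_inv]
  · intro a b e
    rw [← transform_smul, ← transform_smul, ← transform_add] at e
    exact i3 a b (hinj _ e)
  · intro G hG hs
    obtain ⟨a, e⟩ := i4 (transformPoly (g⁻¹ : GL (Fin 3) K).1 G) (transform_hom _ _ _ hG) (fun w hw => by
      rw [transform_eval]; exact hs _ ((h' w).1 hw))
    exact ⟨a, by rw [← transform_smul, ← e, transform_inv]⟩
  · intro z hz hn
    rw [transform_eval, transform_eval]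
    exact i5 _ (GL_ne g z hz) (fun hh => hn ((h z).2 hh))
  · intro w v hw hv
    rw [transform_lineRestrict, transform_lineRestrict]
    exact i6 _ _ ((h w).1 hw) (linInd_mulVec2 g _ _ hv)

lemma main_of_transform (g : GL (Fin 3) K) (c : K) (hc : c ≠ 0) (F F' : MvPolynomial (Fin 3) K)
    (h : transformPoly (g : Matrix (Fin 3) (Fin 3) K) F = c • F') (hM : Main F') : Main F := by
  obtain ⟨g', hg'⟩ : ∃ g' : GL (Fin 3) K, (g' : Matrix (Fin 3) (Fin 3) K) =
      (g : Matrix (Fin 3) (Fin 3) K).transpose := by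
    refine ⟨⟨(g : Matrix (Fin 3) (Fin 3) K).transpose,
      ((g⁻¹ : GL (Fin 3) K) : Matrix (Fin 3) (Fin 3) K).transpose, ?_, ?_⟩, rfl⟩
    · rw [← Matrix.transpose_mul, ← Units.val_mul, inv_mul_cancel]; simp
    · rw [← Matrix.transpose_mul, ← Units.val_mul, mul_inv_cancel]; simp
  refine main_transport g' F F' (fun w => ?_) hM
  rw [hg', ← infl_transform g F w, h, infl_smul c hc]

lemma bar_hom {k : Type*} [Field k] (F : MvPolynomial (Fin 3) k) (d : ℕ) :
    (bar F).IsHomogeneous d ↔ F.IsHomogeneous d := by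
  constructor
  · intro h m hm
    apply h (d := m)
    simp only [bar, MvPolynomial.coeff_map]
    simpa using hm
  · intro h; exact h.map _

lemma main_bar {k : Type*} [Field k] (h3 : (3 : k) ≠ 0)
    (F : MvPolynomial (Fin 3) k) (hF : IsSmoothCurve (bar F) 3)
    (hj : (2 : k) = 0 → ¬ HasJZero F) : Main (bar F) := by
  have h3' : (3 : AlgebraicClosure k) ≠ 0 := by
    intro h
    apply h3
    apply (algebraMap k (AlgebraicClosure k)).injective
    rw [map_ofNat, map_zero]
    exact h
  haveI : Infinite (AlgebraicClosure k) := IsAlgClosed.instInfinite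
  obtain ⟨f, hf⟩ := exists_cub (bar F) hF.1
  have hs : Smooth f := by
    intro p hp h0
    obtain ⟨i, hi⟩ := hF.2.2 p hp (by rw [hf, eval_cub, h0])
    obtain ⟨p0, p1, p2⟩ := pderiv_cub f p
    rw [hf] at hi
    fin_cases i
    · left; rw [← p0]; exact hi
    · right; left; rw [← p1]; exact hi
    · right; right; rw [← p2]; exact hi
  obtain ⟨g, c, a, hc, ha, h⟩ := normal_form h3' f hs
  obtain ⟨o, ho⟩ : ∃ o : AlgebraicClosure k, o ^ 2 + o + 1 = 0 := by
    obtain ⟨x, y, hxy, e⟩ := quad_root (1 : AlgebraicClosure k) 1 1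
    have hy : y ≠ 0 := by
      rintro rfl
      simp at e hxy
      exact hxy e
    refine ⟨x / y, ?_⟩
    field_simp
    linear_combination e
  obtain ⟨g', l, hl, hal, h'⟩ := to_hesse h3' a ha o ho
  have h2 : (2 : AlgebraicClosure k) ≠ 0 ∨ l ≠ 0 := by
    by_contra hcon
    push Not at hcon
    have ha0 : a = 0 := by
      by_contra hne
      exact hal hne hcon.2
    subst ha0
    have h2k : (2 : k) = 0 := by
      apply (algebraMap k (AlgebraicClosure k)).injective
      rw [map_ofNat, map_zero]
      exact hcon.1
    obtain ⟨hW, hjj⟩ := wc_zero_j h3' hcon.1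
    exact hj h2k ⟨wc 0, hW, g, Units.mk0 c hc, hjj, by rw [hf, h]; rfl⟩
  rw [hf]
  refine main_of_transform g c hc _ _ h ?_
  refine main_of_transform g' (-1) (by simp) _ _ h' ?_
  exact main_hes h3' o ho l hl h2

end transport

section sep

lemma map_cf {R S : Type*} [CommRing R] [CommRing S] (φ : R →+* S) (f : Fin 10 → R)
    (a : Fin 3 → R) : φ (cf f a) = cf (fun i => φ (f i)) (fun i => φ (a i)) := by
  simp [cf]

lemma map_cp {R S : Type*} [CommRing R] [CommRing S] (φ : R →+* S) (f : Fin 10 → R)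
    (a b : Fin 3 → R) :
    φ (cp f a b) = cp (fun i => φ (f i)) (fun i => φ (a i)) (fun i => φ (b i)) := by
  have h2 : φ 2 = 2 := map_ofNat φ 2
  have h3 : φ 3 = 3 := map_ofNat φ 3
  simp [cp, cf0, cf1, cf2, h2, h3]

/-- the polarised cubic form (second derivatives at `p` applied to `q`, `r`) -/
def cb {R : Type*} [CommRing R] (f : Fin 10 → R) (p q r : Fin 3 → R) : R :=
  (6 * f 0 * p 0 + 2 * f 3 * p 1 + 2 * f 4 * p 2) * (q 0 * r 0)
  + (6 * f 1 * p 1 + 2 * f 5 * p 0 + 2 * f 6 * p 2) * (q 1 * r 1)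
  + (6 * f 2 * p 2 + 2 * f 7 * p 0 + 2 * f 8 * p 1) * (q 2 * r 2)
  + (2 * f 3 * p 0 + 2 * f 5 * p 1 + f 9 * p 2) * (q 0 * r 1 + q 1 * r 0)
  + (2 * f 4 * p 0 + 2 * f 7 * p 2 + f 9 * p 1) * (q 0 * r 2 + q 2 * r 0)
  + (2 * f 6 * p 1 + 2 * f 8 * p 2 + f 9 * p 0) * (q 1 * r 2 + q 2 * r 1)

lemma der_cf {k L : Type*} [Field k] [Field L] [Algebra k L] (δ : Derivation k L L)
    (f : Fin 10 → k) (a : Fin 3 → L) :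
    δ (cf (fun i => algebraMap k L (f i)) a) =
      cp (fun i => algebraMap k L (f i)) a (fun i => δ (a i)) := by
  simp [cf, cp, cf0, cf1, cf2, Derivation.leibniz, Derivation.leibniz_pow]
  ring

lemma der_cp {k L : Type*} [Field k] [Field L] [Algebra k L] (δ : Derivation k L L)
    (f : Fin 10 → k) (a b : Fin 3 → L) :
    δ (cp (fun i => algebraMap k L (f i)) a b) =
      cp (fun i => algebraMap k L (f i)) a (fun i => δ (b i)) +
      cb (fun i => algebraMap k L (f i)) a b (fun i => δ (a i)) := by
  have h2 : δ (2 : L) = 0 := by simpa using δ.map_natCast 2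
  have h3 : δ (3 : L) = 0 := by simpa using δ.map_natCast 3
  simp [cb, cp, cf0, cf1, cf2, Derivation.leibniz, Derivation.leibniz_pow, h2, h3]
  ring

lemma span_of_orth {K : Type*} [Field K] (a b G u : Fin 3 → K)
    (hab : LinearIndependent K ![a, b]) (hG : G ≠ 0)
    (h1 : G 0 * a 0 + G 1 * a 1 + G 2 * a 2 = 0) (h2 : G 0 * b 0 + G 1 * b 1 + G 2 * b 2 = 0)
    (h3 : G 0 * u 0 + G 1 * u 1 + G 2 * u 2 = 0) :
    ∃ x y : K, ∀ i, u i = x * a i + y * b i := by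
  obtain ⟨μ, rfl⟩ := orth_cross a b G hab h1 h2
  have hμ : μ ≠ 0 := by rintro rfl; simp at hG
  have h : (a 1 * b 2 - a 2 * b 1) * u 0 + (a 2 * b 0 - a 0 * b 2) * u 1
      + (a 0 * b 1 - a 1 * b 0) * u 2 = 0 := by
    apply mul_left_cancel₀ hμ
    simp [crs] at h3
    linear_combination h3
  have key : ∀ c X Y : K, c ≠ 0 → (∀ i, c * u i = X * a i + Y * b i) →
      ∃ x y : K, ∀ i, u i = x * a i + y * b i := by
    intro c X Y hc h
    refine ⟨c⁻¹ * X, c⁻¹ * Y, fun i => ?_⟩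
    have := h i
    calc u i = c⁻¹ * (c * u i) := by rw [inv_mul_cancel_left₀ hc]
      _ = _ := by rw [this]; ring
  have hc3 : a 1 * b 2 - a 2 * b 1 ≠ 0 ∨ a 0 * b 2 - a 2 * b 0 ≠ 0 ∨
      a 0 * b 1 - a 1 * b 0 ≠ 0 := by
    rw [linInd_iff] at hab
    by_contra hcon
    push Not at hcon
    obtain ⟨q0, q1, q2⟩ := hcon
    rcases hab with hc | hc | hc
    · exact hc q0
    · apply hc
      linear_combination (-1 : K) * q1
    · exact hc q2
  rcases hc3 with hc | hc | hc
  · refine key _ (u 1 * b 2 - u 2 * b 1) (a 1 * u 2 - a 2 * u 1) hc fun i => ?_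
    fin_cases i <;> simp <;> first | ring1 | linear_combination h
  · refine key _ (u 0 * b 2 - u 2 * b 0) (a 0 * u 2 - a 2 * u 0) hc fun i => ?_
    fin_cases i <;> simp <;> first | ring1 | linear_combination h | linear_combination (-1 : K) * h
  · refine key _ (u 0 * b 1 - u 1 * b 0) (a 0 * u 1 - a 1 * u 0) hc fun i => ?_
    fin_cases i <;> simp <;> first | ring1 | linear_combination h

lemma flex_der {k L : Type*} [Field k] [Field L] [Algebra k L] (h3 : (3 : L) ≠ 0)
    (f : Fin 10 → k) (a b : Fin 3 → L) (hs : Smooth (fun i => algebraMap k L (f i)))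
    (hab : LinearIndependent L ![a, b])
    (h0 : cf (fun i => algebraMap k L (f i)) a = 0)
    (h1 : cp (fun i => algebraMap k L (f i)) a b = 0)
    (h2 : cp (fun i => algebraMap k L (f i)) b a = 0)
    (hb : cf (fun i => algebraMap k L (f i)) b ≠ 0)
    (j l : Fin 3) (haj : a j = 1) (hbj : b j = 0) (hbl : b l = 1)
    (δ : Derivation k L L) : (∀ i, δ (a i) = 0) ∧ ∀ i, δ (b i) = 0 := by
  have e0 := der_cf δ f a
  have e1 := der_cp δ f a b
  have e2 := der_cp δ f b a
  rw [h0, map_zero] at e0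
  rw [h1, map_zero] at e1
  rw [h2, map_zero] at e2
  have hE := euler (fun i => algebraMap k L (f i)) a
  have hEb := euler (fun i => algebraMap k L (f i)) b
  rw [h0] at hE
  set g : Fin 10 → L := fun i => algebraMap k L (f i) with hg
  have ha0 : a ≠ 0 := by
    rintro rfl
    simp at haj
  have hG : ![cf0 g a, cf1 g a, cf2 g a] ≠ 0 := by
    intro h
    have q0 := congrFun h 0
    have q1 := congrFun h 1
    have q2 := congrFun h 2
    simp at q0 q1 q2
    rcases hs a ha0 h0 with h | h | h
    · exact h q0
    · exact h q1
    · exact h q2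
  obtain ⟨x, y, hu⟩ := span_of_orth a b _ (fun i => δ (a i)) hab hG
    (by simpa [cp] using hE) (by simpa [cp] using h1) (by simpa [cp] using e0.symm)
  have hu' : (fun i => δ (a i)) = fun i => x * a i + y * b i := funext hu
  have i1 : cb g a b (fun i => x * a i + y * b i) = 2 * x * cp g a b + 2 * y * cp g b a := by
    simp [cb, cp, cf0, cf1, cf2]; ring
  rw [hu', i1, h1, h2] at e1
  obtain ⟨x', y', hv⟩ := span_of_orth a b _ (fun i => δ (b i)) hab hG
    (by simpa [cp] using hE) (by simpa [cp] using h1)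
    (by simp [cp] at e1; simpa using e1.symm)
  have hv' : (fun i => δ (b i)) = fun i => x' * a i + y' * b i := funext hv
  have i2 : cb g b a (fun i => x' * a i + y' * b i) = 2 * x' * cp g a b + 2 * y' * cp g b a := by
    simp [cb, cp, cf0, cf1, cf2]; ring
  have i3 : cp g b (fun i => x * a i + y * b i) = x * cp g b a + y * cp g b b := by
    simp [cp]; ring
  rw [hu', hv', i2, i3, h1, h2, hEb] at e2
  have hy : y = 0 := by
    have : y * (3 * cf g b) = 0 := by linear_combination -e2
    rcases mul_eq_zero.1 this with h | h
    · exact h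
    · exact absurd h (mul_ne_zero h3 hb)
  have hx : x = 0 := by
    have := hu j
    rw [haj, hbj, hy] at this
    simpa using this.symm
  have hx' : x' = 0 := by
    have := hv j
    rw [haj, hbj] at this
    simpa using this.symm
  have hy' : y' = 0 := by
    have := hv l
    rw [hbl, hx'] at this
    simpa using this.symm
  refine ⟨fun i => ?_, fun i => ?_⟩
  · have := hu i; simpa [hx, hy] using this
  · have := hv i; simpa [hx', hy'] using this

lemma unram_of_der {k L : Type*} [Field k] [Field L] [Algebra k L]
    (h : ∀ δ : Derivation k L L, δ = 0) : Algebra.FormallyUnramified k L := by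
  rw [Algebra.formallyUnramified_iff]
  refine ⟨fun x y => ?_⟩
  rw [← sub_eq_zero]
  rw [← Module.forall_dual_apply_eq_zero_iff L]
  intro φ
  have hφ : φ = 0 := by
    apply Derivation.liftKaehlerDifferential_unique
    rw [h (φ.compDer _), h (LinearMap.compDer 0 _)]
  rw [hφ]; rfl

lemma der_adjoin {k E : Type*} [Field k] [Field E] [Algebra k E] (S : Set E)
    (δ : Derivation k (IntermediateField.adjoin k S) (IntermediateField.adjoin k S))
    (h : ∀ s (hs : s ∈ S), δ ⟨s, IntermediateField.subset_adjoin k S hs⟩ = 0) : δ = 0 := by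
  ext1 ⟨x, hx⟩
  show δ ⟨x, hx⟩ = 0
  induction hx using IntermediateField.adjoin_induction with
  | mem x hx => exact h x hx
  | algebraMap x => exact δ.map_algebraMap x
  | add x y hx hy h1 h2 =>
    have := δ.map_add ⟨x, hx⟩ ⟨y, hy⟩
    rw [h1, h2, add_zero] at this
    exact this
  | inv x hx h1 =>
    have := δ.leibniz_inv (⟨x, hx⟩ : IntermediateField.adjoin k S)
    rw [h1, smul_zero] at this
    exact this
  | mul x y hx hy h1 h2 =>
    have := δ.leibniz ⟨x, hx⟩ ⟨y, hy⟩
    rw [h1, h2, smul_zero, smul_zero, add_zero] at this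
    exact this

end sep

section sepfield

variable {k E : Type*} [Field k] [Field E] [Algebra k E]

lemma flex_norm {K : Type*} [Field K] (f : Fin 10 → K) (a b : Fin 3 → K)
    (hab : LinearIndependent K ![a, b]) (h0 : cf f a = 0) (h1 : cp f a b = 0)
    (h2 : cp f b a = 0) (hb : cf f b ≠ 0) :
    ∃ (a' b' : Fin 3 → K) (j l : Fin 3), LinearIndependent K ![a', b'] ∧ cf f a' = 0 ∧
      cp f a' b' = 0 ∧ cp f b' a' = 0 ∧ cf f b' ≠ 0 ∧ a' j = 1 ∧ b' j = 0 ∧ b' l = 1 ∧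
      ∃ ν : K, crs a b = ν • crs a' b' := by
  have ha : a ≠ 0 := by
    have := hab.ne_zero 0
    simpa using this
  obtain ⟨j, hj⟩ := Function.ne_iff.1 ha
  simp only [Pi.zero_apply] at hj
  have hb0 : ∃ l, b l - b j / a j * a l ≠ 0 := by
    by_contra hcon
    push Not at hcon
    have := (LinearIndependent.pair_iff.1 hab) (-(b j / a j)) 1 (by
      ext l
      have := hcon l
      simp only [Pi.add_apply, Pi.smul_apply, smul_eq_mul, Pi.zero_apply]
      linear_combination this)
    exact one_ne_zero this.2
  obtain ⟨l, hl⟩ := hb0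
  set r := b j / a j with hr
  set t := b l - r * a l with ht
  have hrj : b j - r * a j = 0 := by rw [hr]; field_simp; ring
  refine ⟨fun i => (a j)⁻¹ * a i, fun i => t⁻¹ * (b i - r * a i), j, l, ?_, ?_, ?_, ?_, ?_, ?_, ?_,
    ?_, a j * t, ?_⟩
  · rw [linInd_iff] at hab ⊢
    have hn : (a j)⁻¹ * t⁻¹ ≠ 0 := mul_ne_zero (inv_ne_zero hj) (inv_ne_zero hl)
    rcases hab with h | h | h
    · left
      intro h'; apply h
      apply mul_left_cancel₀ hn
      linear_combination h'
    · right; left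
      intro h'; apply h
      apply mul_left_cancel₀ hn
      linear_combination h'
    · right; right
      intro h'; apply h
      apply mul_left_cancel₀ hn
      linear_combination h'
  · have : cf f (fun i => (a j)⁻¹ * a i) = (a j)⁻¹ ^ 3 * cf f a := by
      simp only [cf]; ring
    rw [this, h0, mul_zero]
  · have : cp f (fun i => (a j)⁻¹ * a i) (fun i => t⁻¹ * (b i - r * a i)) =
        (a j)⁻¹ ^ 2 * t⁻¹ * (cp f a b - r * (3 * cf f a)) := by
      simp only [cp, cf, cf0, cf1, cf2]; ring
    rw [this, h0, h1]; ring
  · have : cp f (fun i => t⁻¹ * (b i - r * a i)) (fun i => (a j)⁻¹ * a i) =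
        (a j)⁻¹ * t⁻¹ ^ 2 * (cp f b a - 2 * r * cp f a b + 3 * r ^ 2 * cf f a) := by
      simp only [cp, cf, cf0, cf1, cf2]; ring
    rw [this, h0, h1, h2]; ring
  · have : cf f (fun i => t⁻¹ * (b i - r * a i)) =
        t⁻¹ ^ 3 * (cf f b - r * cp f b a + r ^ 2 * cp f a b - r ^ 3 * cf f a) := by
      simp only [cp, cf, cf0, cf1, cf2]; ring
    rw [this, h0, h1, h2]
    simpa using ⟨hl, hb⟩
  · exact inv_mul_cancel₀ hj
  · simp only []
    rw [hrj, mul_zero]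
  · exact inv_mul_cancel₀ hl
  · have e : (a j * t) * ((a j)⁻¹ * t⁻¹) = 1 := by field_simp
    ext i
    fin_cases i
    · simp [crs]; linear_combination -(a 1 * b 2 - a 2 * b 1) * e
    · simp [crs]; linear_combination -(a 2 * b 0 - a 0 * b 2) * e
    · simp [crs]; linear_combination -(a 0 * b 1 - a 1 * b 0) * e

lemma infl_crs {K : Type*} [Field K] (f : Fin 10 → K) (a b : Fin 3 → K)
    (hab : LinearIndependent K ![a, b]) (h0 : cf f a = 0) (h1 : cp f a b = 0)
    (h2 : cp f b a = 0) (hb : cf f b ≠ 0) : IsInflLine (cub f) (crs a b) := by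
  rw [infl_iff]
  refine ⟨?_, a, b, ?_, ?_, hab, h0, h1, h2, hb⟩
  · intro h
    have q0 := congrFun h 0
    have q1 := congrFun h 1
    have q2 := congrFun h 2
    simp [crs] at q0 q1 q2
    rw [linInd_iff] at hab
    rcases hab with h | h | h
    · exact h q0
    · exact h q1
    · exact h q2
  · simp [dotv, crs, Fin.sum_univ_three]; ring
  · simp [dotv, crs, Fin.sum_univ_three]; ring

lemma linInd_map {K L : Type*} [Field K] [Field L] (φ : K →+* L) (a b : Fin 3 → K) :
    LinearIndependent L ![fun i => φ (a i), fun i => φ (b i)] ↔ LinearIndependent K ![a, b] := by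
  rw [linInd_iff, linInd_iff]
  simp only [← map_mul, ← map_sub, _root_.map_ne_zero]

lemma smooth_map {K L : Type*} [Field K] [Field L] (φ : K →+* L) (f : Fin 10 → K)
    (hs : Smooth (fun i => φ (f i))) : Smooth f := by
  intro p hp h0
  have hp' : (fun i => φ (p i)) ≠ 0 := by
    intro h
    apply hp
    ext i
    exact (map_eq_zero φ).1 (congrFun h i)
  have := hs _ hp' (by rw [← map_cf, h0, map_zero])
  have h2 : φ 2 = 2 := map_ofNat φ 2
  have h3 : φ 3 = 3 := map_ofNat φ 3
  have m0 : cf0 (fun i => φ (f i)) (fun i => φ (p i)) = φ (cf0 f p) := by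
    simp [cf0, h2, h3]
  have m1 : cf1 (fun i => φ (f i)) (fun i => φ (p i)) = φ (cf1 f p) := by
    simp [cf1, h2, h3]
  have m2 : cf2 (fun i => φ (f i)) (fun i => φ (p i)) = φ (cf2 f p) := by
    simp [cf2, h2, h3]
  rw [m0, m1, m2] at this
  simpa only [_root_.map_ne_zero] using this

lemma infl_field [Algebra.IsAlgebraic k E] (h3 : (3 : k) ≠ 0) (f : Fin 10 → k)
    (hs : Smooth (fun i => algebraMap k E (f i))) (w : Fin 3 → E)
    (hw : IsInflLine (cub (fun i => algebraMap k E (f i))) w) :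
    ∃ (L : IntermediateField k E) (_ : FiniteDimensional k L) (_ : Algebra.IsSeparable k L)
      (p : Fin 3 → L) (ν : E), (w = ν • fun i => (p i : E)) ∧
      ∀ τ : L →ₐ[k] E, IsInflLine (cub (fun i => algebraMap k E (f i))) (fun i => τ (p i)) := by
  rw [infl_iff] at hw
  obtain ⟨hw0, a0, b0, hwa, hwb, hab0, q0, q1, q2, qb⟩ := hw
  obtain ⟨a, b, j, l, hab, h0, h1, h2, hb, haj, hbj, hbl, ν, hν⟩ :=
    flex_norm _ a0 b0 hab0 q0 q1 q2 qb
  obtain ⟨μ, hμ⟩ := orth_cross a0 b0 w hab0 (by simpa [dotv, Fin.sum_univ_three] using hwa)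
    (by simpa [dotv, Fin.sum_univ_three] using hwb)
  set S : Set E := Set.range a ∪ Set.range b with hS
  have hSf : S.Finite := (Set.finite_range a).union (Set.finite_range b)
  have hfd : FiniteDimensional k (IntermediateField.adjoin k S) :=
    IntermediateField.finiteDimensional_adjoin
      (K := k) (L := E) (S := S) (fun x _ => Algebra.IsIntegral.isIntegral x)
  let A : Fin 3 → IntermediateField.adjoin k S := fun i =>
    ⟨a i, IntermediateField.subset_adjoin k S (Or.inl ⟨i, rfl⟩)⟩
  let B : Fin 3 → IntermediateField.adjoin k S := fun i =>
    ⟨b i, IntermediateField.subset_adjoin k S (Or.inr ⟨i, rfl⟩)⟩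
  have hinc : ∀ x : k, (algebraMap (IntermediateField.adjoin k S) E)
      (algebraMap k (IntermediateField.adjoin k S) x) = algebraMap k E x := fun x => rfl
  have hAB : LinearIndependent (IntermediateField.adjoin k S) ![A, B] := by
    rw [← linInd_map (algebraMap (IntermediateField.adjoin k S) E)]
    exact hab
  have H0 : cf (fun i => algebraMap k (IntermediateField.adjoin k S) (f i)) A = 0 := by
    apply (algebraMap (IntermediateField.adjoin k S) E).injective
    rw [map_cf, map_zero]; exact h0
  have H1 : cp (fun i => algebraMap k (IntermediateField.adjoin k S) (f i)) A B = 0 := by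
    apply (algebraMap (IntermediateField.adjoin k S) E).injective
    rw [map_cp, map_zero]; exact h1
  have H2 : cp (fun i => algebraMap k (IntermediateField.adjoin k S) (f i)) B A = 0 := by
    apply (algebraMap (IntermediateField.adjoin k S) E).injective
    rw [map_cp, map_zero]; exact h2
  have HB : cf (fun i => algebraMap k (IntermediateField.adjoin k S) (f i)) B ≠ 0 := by
    intro h
    apply hb
    have := congrArg (algebraMap (IntermediateField.adjoin k S) E) h
    rw [map_cf, map_zero] at this; exact this
  have h3' : (3 : IntermediateField.adjoin k S) ≠ 0 := by
    intro h
    apply h3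
    apply (algebraMap k (IntermediateField.adjoin k S)).injective
    rw [map_ofNat, map_zero]
    exact h
  have hder : ∀ δ : Derivation k (IntermediateField.adjoin k S) (IntermediateField.adjoin k S),
      δ = 0 := by
    intro δ
    obtain ⟨d1, d2⟩ := flex_der h3' f A B
      (smooth_map (algebraMap (IntermediateField.adjoin k S) E) _ hs) hAB H0 H1 H2 HB j l
      (Subtype.ext haj) (Subtype.ext hbj) (Subtype.ext hbl) δ
    apply der_adjoin
    rintro s (⟨i, rfl⟩ | ⟨i, rfl⟩)
    · exact d1 i
    · exact d2 i
  have hun := unram_of_der hder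
  have hsep : Algebra.IsSeparable k (IntermediateField.adjoin k S) :=
    Algebra.FormallyUnramified.isSeparable k _
  refine ⟨IntermediateField.adjoin k S, hfd, hsep, crs A B, μ * ν, ?_, ?_⟩
  · rw [hμ, hν, smul_smul]
    congr 1
    ext i
    fin_cases i <;> simp [crs, A, B]
  · intro τ
    have hτ : ∀ x : k, τ (algebraMap k (IntermediateField.adjoin k S) x) = algebraMap k E x :=
      fun x => τ.commutes x
    have hc : (fun i => τ (crs A B i)) = crs (fun i => τ (A i)) (fun i => τ (B i)) := by
      ext i
      fin_cases i <;> simp [crs]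
    rw [hc]
    have hτ' : (fun i => algebraMap k E (f i)) =
      fun i => (τ : IntermediateField.adjoin k S →+* E)
        (algebraMap k (IntermediateField.adjoin k S) (f i)) := by
      ext i; exact (hτ _).symm
    apply infl_crs
    · exact (linInd_map (τ : IntermediateField.adjoin k S →+* E) A B).2 hAB
    · have := congrArg (τ : IntermediateField.adjoin k S →+* E) H0
      rw [map_cf, map_zero] at this
      rw [hτ']; exact this
    · have := congrArg (τ : IntermediateField.adjoin k S →+* E) H1
      rw [map_cp, map_zero] at this
      rw [hτ']; exact this
    · have := congrArg (τ : IntermediateField.adjoin k S →+* E) H2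
      rw [map_cp, map_zero] at this
      rw [hτ']; exact this
    · intro h
      apply HB
      apply (τ : IntermediateField.adjoin k S →+* E).injective
      rw [map_cf, map_zero]
      rw [hτ'] at h; exact h

end sepfield

section descent

variable {k E : Type*} [Field k] [Field E] [Algebra k E] {σ : Type*}

/-- apply a `k`-linear functional to the coefficients of a polynomial -/
def cm (φ : E →ₗ[k] k) (G : MvPolynomial σ E) : MvPolynomial σ k :=
  ∑ m ∈ G.support, monomial m (φ (coeff m G))

lemma coeff_cm (φ : E →ₗ[k] k) (G : MvPolynomial σ E) (m : σ →₀ ℕ) :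
    coeff m (cm φ G) = φ (coeff m G) := by
  classical
  simp only [cm, MvPolynomial.coeff_sum, MvPolynomial.coeff_monomial]
  rw [Finset.sum_ite_eq']
  split_ifs with h
  · rfl
  · rw [notMem_support_iff.1 h, map_zero]

lemma cm_add (φ : E →ₗ[k] k) (G H : MvPolynomial σ E) : cm φ (G + H) = cm φ G + cm φ H := by
  ext m
  simp only [coeff_cm, MvPolynomial.coeff_add, map_add]

lemma cm_monomial (φ : E →ₗ[k] k) (m : σ →₀ ℕ) (c : E) :
    cm φ (monomial m c) = monomial m (φ c) := by
  classical
  ext m'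
  simp only [coeff_cm, MvPolynomial.coeff_monomial]
  split_ifs <;> simp

lemma cm_smul_map (φ : E →ₗ[k] k) (c : E) (G : MvPolynomial σ k) :
    cm φ (c • MvPolynomial.map (algebraMap k E) G) = φ c • G := by
  ext m
  rw [coeff_cm, MvPolynomial.coeff_smul, MvPolynomial.coeff_smul, MvPolynomial.coeff_map, smul_eq_mul, smul_eq_mul, mul_comm,
    ← Algebra.smul_def, map_smul, smul_eq_mul, mul_comm]

lemma cm_hom (φ : E →ₗ[k] k) (G : MvPolynomial σ E) (d : ℕ) (hG : G.IsHomogeneous d) :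
    (cm φ G).IsHomogeneous d := by
  intro m hm
  apply hG
  intro h
  apply hm
  rw [coeff_cm, h, map_zero]

lemma cm_pderiv (φ : E →ₗ[k] k) (i : σ) (G : MvPolynomial σ E) :
    pderiv i (cm φ G) = cm φ (pderiv i G) := by
  induction G using MvPolynomial.monomial_add_induction_on with
  | C a =>
    rw [← monomial_zero', cm_monomial, pderiv_monomial, pderiv_monomial]
    simp [cm]
  | monomial_add m c f _ _ h =>
    rw [cm_add, map_add, map_add, cm_add, h, cm_monomial, pderiv_monomial, pderiv_monomial,
      cm_monomial]
    congr 2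
    rw [mul_comm c, ← nsmul_eq_mul, map_nsmul, nsmul_eq_mul, mul_comm]

lemma trace_cm [IsAlgClosed E] {L : Type*} [Field L] [Algebra k L] [FiniteDimensional k L]
    [Algebra.IsSeparable k L] (φ : E →ₗ[k] k) (p : σ → L) (y : L) (G : MvPolynomial σ E) :
    Algebra.trace k L (y * MvPolynomial.aeval p (cm φ G)) =
      φ (∑ τ : L →ₐ[k] E, τ y * eval (fun i => τ (p i)) G) := by
  induction G using MvPolynomial.induction_on' with
  | monomial m c =>
    rw [cm_monomial, MvPolynomial.aeval_monomial]
    have e1 : y * (algebraMap k L (φ c) * m.prod fun i n => p i ^ n) =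
        φ c • (y * m.prod fun i n => p i ^ n) := by
      rw [Algebra.smul_def]; ring
    have e2 : ∑ τ : L →ₐ[k] E, τ y * eval (fun i => τ (p i)) (monomial m c) =
        Algebra.trace k L (y * m.prod fun i n => p i ^ n) • c := by
      rw [Algebra.smul_def, trace_eq_sum_embeddings E, Finset.sum_mul]
      refine Finset.sum_congr rfl fun τ _ => ?_
      rw [MvPolynomial.eval_monomial, map_mul, Finsupp.prod, Finsupp.prod, map_prod]
      simp only [map_pow]
      ring
    rw [e1, e2, map_smul, map_smul, smul_eq_mul, smul_eq_mul, mul_comm]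
  | add p q hp hq =>
    simp only [cm_add, map_add, mul_add, Finset.sum_add_distrib, hp, hq]

lemma cm_vanish [IsAlgClosed E] {L : Type*} [Field L] [Algebra k L] [FiniteDimensional k L]
    [Algebra.IsSeparable k L] (φ : E →ₗ[k] k) (p : σ → L) (G : MvPolynomial σ E)
    (h : ∀ τ : L →ₐ[k] E, eval (fun i => τ (p i)) G = 0) :
    MvPolynomial.aeval p (cm φ G) = 0 := by
  apply (traceForm_nondegenerate k L).1
  intro y
  rw [Algebra.traceForm_apply, mul_comm, trace_cm]
  simp [h]

lemma mem_span_map (W : Submodule k (MvPolynomial σ k)) (G : MvPolynomial σ E)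
    (h : ∀ φ : E →ₗ[k] k, cm φ G ∈ W) :
    G ∈ Submodule.span E ((fun P => MvPolynomial.map (algebraMap k E) P) '' (W : Set _)) := by
  classical
  let B := Module.Basis.ofVectorSpace k E
  let S := G.support.biUnion fun m => (B.repr (coeff m G)).support
  have hG : G = ∑ i ∈ S, B i • MvPolynomial.map (algebraMap k E) (cm (B.coord i) G) := by
    ext m
    rw [MvPolynomial.coeff_sum]
    simp only [MvPolynomial.coeff_smul, MvPolynomial.coeff_map, coeff_cm]
    by_cases hm : m ∈ G.support
    · have h1 : coeff m G = ∑ i ∈ S, B.repr (coeff m G) i • B i := by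
        conv_lhs => rw [← B.linearCombination_repr (coeff m G), Finsupp.linearCombination_apply]
        apply Finsupp.sum_of_support_subset
        · exact Finset.subset_biUnion_of_mem (fun m => (B.repr (coeff m G)).support) hm
        · simp
      conv_lhs => rw [h1]
      refine Finset.sum_congr rfl fun i _ => ?_
      rw [Algebra.smul_def, smul_eq_mul, mul_comm]
      rfl
    · rw [notMem_support_iff.1 hm]
      simp
  rw [hG]
  refine Submodule.sum_mem _ fun i _ => Submodule.smul_mem _ _ (Submodule.subset_span ?_)
  exact ⟨_, h _, rfl⟩

lemma finrank_descent (W : Submodule k (MvPolynomial σ k)) :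
    Module.finrank k W = Module.finrank E (Submodule.span E
      ((fun P => MvPolynomial.map (algebraMap k E) P) '' (W : Set (MvPolynomial σ k)))) := by
  obtain ⟨b, hb, hspan, hli⟩ := exists_linearIndependent E
    ((fun P => MvPolynomial.map (algebraMap k E) P) '' (W : Set (MvPolynomial σ k)))
  have hch : ∀ x : b, ∃ g : W, MvPolynomial.map (algebraMap k E) (g : MvPolynomial σ k) = x := by
    intro x
    obtain ⟨g, hg, e⟩ := hb x.2
    exact ⟨⟨g, hg⟩, e⟩
  choose g hg using hch
  obtain ⟨φ, hφ⟩ : ∃ φ : E →ₗ[k] k, φ 1 = 1 := by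
    obtain ⟨φ, hφ⟩ := LinearMap.exists_leftInverse_of_injective (Algebra.linearMap k E)
      (LinearMap.ker_eq_bot.2 (algebraMap k E).injective)
    refine ⟨φ, ?_⟩
    have := LinearMap.congr_fun hφ 1
    simpa using this
  have hgli : LinearIndependent k g := by
    rw [linearIndependent_iff']
    intro s c hc i hi
    have h1 : ∑ i ∈ s, algebraMap k E (c i) • (i : MvPolynomial σ E) = 0 := by
      have h2 := congrArg (fun x : W => MvPolynomial.map (algebraMap k E) (x : MvPolynomial σ k)) hc
      simp only [Submodule.coe_sum, Submodule.coe_smul, map_sum, ZeroMemClass.coe_zero,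
        map_zero] at h2
      rw [← h2]
      refine Finset.sum_congr rfl fun i _ => ?_
      rw [← hg i, MvPolynomial.smul_eq_C_mul, MvPolynomial.smul_eq_C_mul, map_mul,
        MvPolynomial.map_C]
    have := linearIndependent_iff'.1 hli s (fun i => algebraMap k E (c i)) h1 i hi
    exact (map_eq_zero _).1 this
  have hgsp : ⊤ ≤ Submodule.span k (Set.range g) := by
    rintro ⟨x, hx⟩ -
    have hx' : MvPolynomial.map (algebraMap k E) x ∈ Submodule.span E b := by
      rw [hspan]; exact Submodule.subset_span ⟨x, hx, rfl⟩
    rw [← Subtype.range_coe (s := b), Finsupp.mem_span_range_iff_exists_finsupp] at hx'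
    obtain ⟨c, hc⟩ := hx'
    have hx2 : x = ∑ i ∈ c.support, φ (c i) • (g i : MvPolynomial σ k) := by
      have h1 : cm φ (MvPolynomial.map (algebraMap k E) x) = x := by
        have := cm_smul_map φ 1 x
        rwa [one_smul, hφ, one_smul] at this
      rw [← h1, ← hc, Finsupp.sum]
      have h2 : ∀ s : Finset b, cm φ (∑ i ∈ s, c i • (i : MvPolynomial σ E)) =
          ∑ i ∈ s, φ (c i) • (g i : MvPolynomial σ k) := by
        classical
        intro s
        induction s using Finset.induction_on with
        | empty => simp [cm]
        | insert a s ha ih =>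
          rw [Finset.sum_insert ha, Finset.sum_insert ha, cm_add, ih, ← hg a, cm_smul_map]
      exact h2 _
    have : (⟨x, hx⟩ : W) = ∑ i ∈ c.support, φ (c i) • g i := by
      apply Subtype.ext
      rw [Submodule.coe_sum]
      exact hx2
    rw [this]
    exact Submodule.sum_mem _ fun i _ => Submodule.smul_mem _ _ (Submodule.subset_span ⟨i, rfl⟩)
  rw [Module.finrank_eq_nat_card_basis (Module.Basis.mk hgli hgsp), ← hspan]
  have hB := Module.Basis.span hli
  rw [Subtype.range_coe] at hB
  rw [Module.finrank_eq_nat_card_basis hB]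

end descent

section assembly

lemma coeff_aeval_mul_X {R S σ : Type*} [CommRing R] [CommRing S] [Algebra R S] (q : σ → S)
    (P : MvPolynomial σ R) (n : ℕ) :
    (MvPolynomial.aeval (fun i => Polynomial.C (q i) * Polynomial.X) P : Polynomial S).coeff n =
      MvPolynomial.aeval q (homogeneousComponent n P) := by
  classical
  induction P using MvPolynomial.induction_on' with
  | monomial m c =>
    rw [homogeneousComponent_of_mem
      (isHomogeneous_monomial c (n := m.degree) rfl : _ ∈ homogeneousSubmodule σ R _)]
    have e : (MvPolynomial.aeval (fun i => Polynomial.C (q i) * Polynomial.X)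
        (MvPolynomial.monomial m c) : Polynomial S) =
        Polynomial.C (MvPolynomial.aeval q (MvPolynomial.monomial m c)) *
          Polynomial.X ^ m.degree := by
      rw [MvPolynomial.aeval_monomial, MvPolynomial.aeval_monomial, Polynomial.C_mul, mul_assoc]
      congr 1
      simp only [Finsupp.prod, mul_pow, Finset.prod_mul_distrib, Finset.prod_pow_eq_pow_sum,
        Finsupp.degree_apply]
      rw [map_prod]
      simp
    rw [e, Polynomial.coeff_C_mul_X_pow]
    split_ifs <;> simp
  | add p q hp hq => simp only [map_add, Polynomial.coeff_add, hp, hq]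

lemma hom_of_pow {R : Type*} [Field R] {σ : Type*} (H : MvPolynomial σ R) (m d : ℕ)
    (hm : m ≠ 0) (hH : H ≠ 0) (h : (H ^ m).IsHomogeneous d) :
    ∃ e, e * m = d ∧ H.IsHomogeneous e := by
  set Θ : MvPolynomial σ R →ₐ[R] Polynomial (MvPolynomial σ R) :=
    MvPolynomial.aeval (fun i => Polynomial.C (X i) * Polynomial.X) with hΘ
  have hc : ∀ P n, (Θ P).coeff n = homogeneousComponent n P := by
    intro P n
    rw [hΘ, coeff_aeval_mul_X]
    simp
  have hpow : Θ (H ^ m) = Polynomial.monomial d (H ^ m) := by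
    ext1 n
    rw [hc, Polynomial.coeff_monomial,
      homogeneousComponent_of_mem (h : _ ∈ homogeneousSubmodule σ R d)]
    congr 1
    exact propext eq_comm
  rw [map_pow] at hpow
  have hne : H ^ m ≠ 0 := pow_ne_zero _ hH
  have h1 : m * (Θ H).natDegree = d := by
    rw [← Polynomial.natDegree_pow, hpow, Polynomial.natDegree_monomial_eq _ hne]
  have h2 : m * (Θ H).natTrailingDegree = d := by
    have hΘ0 : Θ H ≠ 0 := by
      intro h0
      rw [h0, zero_pow hm] at hpow
      exact hne ((Polynomial.monomial_eq_zero_iff _ _).1 hpow.symm)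
    have htr : ∀ n : ℕ, (Θ H ^ n).natTrailingDegree = n * (Θ H).natTrailingDegree := by
      intro n
      induction n with
      | zero => simp
      | succ n ih =>
        rw [pow_succ, Polynomial.natTrailingDegree_mul (pow_ne_zero _ hΘ0) hΘ0, ih]
        ring
    rw [← htr, hpow, Polynomial.natTrailingDegree_monomial hne]
  have h3 : (Θ H).natDegree = (Θ H).natTrailingDegree :=
    Nat.eq_of_mul_eq_mul_left (Nat.pos_of_ne_zero hm) (h1.trans h2.symm)
  refine ⟨(Θ H).natDegree, by rw [mul_comm]; exact h1, ?_⟩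
  have h4 : ∀ n, n ≠ (Θ H).natDegree → homogeneousComponent n H = 0 := by
    intro n hn
    rw [← hc]
    rcases lt_or_gt_of_ne hn with h | h
    · exact Polynomial.coeff_eq_zero_of_lt_natTrailingDegree (h3 ▸ h)
    · exact Polynomial.coeff_eq_zero_of_natDegree_lt h
  have h5 : H = homogeneousComponent (Θ H).natDegree H := by
    conv_lhs => rw [← sum_homogeneousComponent H]
    by_cases hmem : (Θ H).natDegree ∈ Finset.range (H.totalDegree + 1)
    · rw [Finset.sum_eq_single_of_mem _ hmem]
      intro n _ hn
      exact h4 n hn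
    · rw [Finset.sum_eq_zero, homogeneousComponent_eq_zero]
      · simpa [Nat.lt_succ_iff] using hmem
      · intro n hn
        exact h4 n (by rintro rfl; exact hmem hn)
  have h6 := homogeneousComponent_isHomogeneous (Θ H).natDegree H
  rwa [← h5] at h6

lemma planeSubst_coeff {K : Type*} [Field K] (G : MvPolynomial (Fin 3) K) (w v u : Fin 3 → K) :
    eval (![1, 0] : Fin 2 → K) (homogeneousComponent 2 (planeSubst G w v u)) =
      (lineRestrict G w v).coeff 2 := by
  rw [← MvPolynomial.coe_aeval_eq_eval, RingHom.coe_coe, ← coeff_aeval_mul_X]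
  congr 1
  unfold planeSubst lineRestrict
  rw [← AlgHom.comp_apply, MvPolynomial.comp_aeval]
  congr 2
  ext1 i
  simp

variable {k : Type*} [Field k]

lemma mem_anti (F H : MvPolynomial (Fin 3) k) : H ∈ antiCanonicalSections F ↔
    H.IsHomogeneous 3 ∧ ∀ w, IsInflLine (bar F) w → eval w (bar H) = 0 := by
  simp only [antiCanonicalSections, Submodule.mem_inf, Submodule.mem_iInf, LinearMap.mem_ker,
    TC, Set.mem_setOf_eq, bar, MvPolynomial.eval_map, AlgHom.toLinearMap_apply,
    MvPolynomial.aeval_def, mem_homogeneousSubmodule]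

lemma mem_bi (F G : MvPolynomial (Fin 3) k) : G ∈ antiBicanonicalSections F ↔
    G.IsHomogeneous 6 ∧ ∀ w, IsInflLine (bar F) w → SingAt (bar G) w := by
  simp only [antiBicanonicalSections, Submodule.mem_inf, Submodule.mem_iInf, LinearMap.mem_ker,
    TC, Set.mem_setOf_eq, bar, SingAt, MvPolynomial.eval_map, AlgHom.toLinearMap_apply,
    MvPolynomial.aeval_def, mem_homogeneousSubmodule, LinearMap.comp_apply, pderiv_map]
  rfl

lemma hom_eval_smul {K : Type*} [Field K] {d : ℕ} (G : MvPolynomial (Fin 3) K)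
    (hG : G.IsHomogeneous d) (ν : K) (p : Fin 3 → K) : eval (ν • p) G = ν ^ d * eval p G := by
  rw [MvPolynomial.eval_eq, MvPolynomial.eval_eq, Finset.mul_sum]
  refine Finset.sum_congr rfl fun m hm => ?_
  have hd : ∑ i ∈ m.support, m i = d := by
    have := hG (mem_support_iff.1 hm)
    rw [← this]
    simp [Finsupp.weight_apply, Finsupp.sum]
  rw [← hd, ← Finset.prod_pow_eq_pow_sum]
  simp only [Pi.smul_apply, smul_eq_mul, mul_pow, Finset.prod_mul_distrib]
  ring

lemma cm_infl (h3 : (3 : k) ≠ 0) (F : MvPolynomial (Fin 3) k) (hF : IsSmoothCurve (bar F) 3)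
    (φ : AlgebraicClosure k →ₗ[k] k) (d : ℕ) (G : MvPolynomial (Fin 3) (AlgebraicClosure k))
    (hG : G.IsHomogeneous d) (h : ∀ w, IsInflLine (bar F) w → eval w G = 0)
    (w : Fin 3 → AlgebraicClosure k) (hw : IsInflLine (bar F) w) : eval w (bar (cm φ G)) = 0 := by
  obtain ⟨f, rfl⟩ := exists_cub F ((bar_hom F 3).1 hF.1)
  have hb : bar (cub f) = cub (fun i => algebraMap k (AlgebraicClosure k) (f i)) := map_cub _ _
  rw [hb] at hF h hw
  have hs : Smooth (fun i => algebraMap k (AlgebraicClosure k) (f i)) := by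
    intro p hp h0
    obtain ⟨i, hi⟩ := hF.2.2 p hp (by rw [eval_cub, h0])
    obtain ⟨p0, p1, p2⟩ := pderiv_cub (fun i => algebraMap k (AlgebraicClosure k) (f i)) p
    fin_cases i
    · left; rw [← p0]; exact hi
    · right; left; rw [← p1]; exact hi
    · right; right; rw [← p2]; exact hi
  obtain ⟨L, hfd, hsep, p, ν, rfl, hτ⟩ := infl_field h3 f hs w hw
  rw [hom_eval_smul _ ((bar_hom _ d).2 (cm_hom φ G d hG))]
  have hv := cm_vanish φ p G (fun τ => h _ (hτ τ))
  have : eval (fun i => (p i : AlgebraicClosure k)) (bar (cm φ G)) = 0 := by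
    have h1 := congrArg (algebraMap L (AlgebraicClosure k)) hv
    rw [map_zero, ← MvPolynomial.aeval_algebraMap_apply] at h1
    rw [bar, MvPolynomial.eval_map, ← MvPolynomial.aeval_def]
    exact h1
  rw [this, mul_zero]

end assembly

section final

variable {k : Type*} [Field k]

lemma sq_mem (F H : MvPolynomial (Fin 3) k) (hH : H ∈ antiCanonicalSections F) :
    H ^ 2 ∈ antiBicanonicalSections F := by
  rw [mem_anti] at hH
  rw [mem_bi]
  refine ⟨hH.1.pow 2, fun w hw => ?_⟩
  have h0 := hH.2 w hw
  have hb : bar (H ^ 2) = bar H * bar H := by simp [bar, sq]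
  rw [hb]
  refine ⟨by rw [map_mul, h0, zero_mul], fun i => ?_⟩
  rw [Derivation.leibniz]
  simp [h0]

lemma multiple_fib (F H₀ : MvPolynomial (Fin 3) k) (h0 : H₀ ≠ 0)
    (hu : ∀ H ∈ antiCanonicalSections F, ∃ a : k, H = a • H₀)
    (G : MvPolynomial (Fin 3) k) (hG : G ∈ antiBicanonicalSections F) (hG0 : G ≠ 0)
    (m : ℕ) (H : MvPolynomial (Fin 3) k) (c : k) (hm : 2 ≤ m) (hc : c ≠ 0)
    (hH : H.totalDegree ≠ 0) (hGH : G = c • H ^ m) : ∃ d : k, d ≠ 0 ∧ G = d • H₀ ^ 2 := by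
  rw [mem_bi] at hG
  have hH0 : H ≠ 0 := by
    rintro rfl
    simp at hH
  have hpow : (H ^ m).IsHomogeneous 6 := by
    have : H ^ m = c⁻¹ • G := by rw [hGH, smul_smul, inv_mul_cancel₀ hc, one_smul]
    rw [this, MvPolynomial.smul_eq_C_mul]
    exact hG.1.C_mul _
  obtain ⟨e, he, hHe⟩ := hom_of_pow H m 6 (by omega) hH0 hpow
  have he0 : e ≠ 0 := by
    rw [← hHe.totalDegree hH0]; exact hH
  have hv : ∀ w, IsInflLine (bar F) w → eval w (bar H) = 0 := by
    intro w hw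
    have := (hG.2 w hw).1
    have hb : bar G = MvPolynomial.C (algebraMap k _ c) * bar H ^ m := by
      rw [hGH, MvPolynomial.smul_eq_C_mul]; simp [bar]
    rw [hb, map_mul, map_pow, MvPolynomial.eval_C] at this
    rcases mul_eq_zero.1 this with h | h
    · exact absurd ((map_eq_zero _).1 h) hc
    · exact pow_eq_zero_iff (by omega) |>.1 h
  have he3 : e ≤ 3 := by nlinarith
  rcases Nat.lt_or_ge e 3 with hlt | hge
  · exfalso
    have hmem : ∀ i, X i ^ (3 - e) * H ∈ antiCanonicalSections F := by
      intro i
      rw [mem_anti]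
      refine ⟨?_, fun w hw => ?_⟩
      · have := (isHomogeneous_X_pow (R := k) i (3 - e)).mul hHe
        rwa [Nat.sub_add_cancel he3] at this
      · have hb : bar (X i ^ (3 - e) * H) = bar (X i ^ (3 - e)) * bar H := by simp [bar]
        rw [hb, map_mul, hv w hw, mul_zero]
    obtain ⟨a, ha⟩ := hu _ (hmem 0)
    obtain ⟨b, hb⟩ := hu _ (hmem 1)
    have hr : 3 - e ≠ 0 := by omega
    have h1 : (b • X 0 ^ (3 - e) - a • X 1 ^ (3 - e)) * H = 0 := by
      rw [sub_mul, smul_mul_assoc, smul_mul_assoc, ha, hb, smul_smul, smul_smul, mul_comm,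
        sub_self]
    have h2 := (mul_eq_zero.1 h1).resolve_right hH0
    have h3 := congrArg (MvPolynomial.eval (![1, 0, 0] : Fin 3 → k)) h2
    simp [MvPolynomial.smul_eval, hr] at h3
    rw [h3, zero_smul] at hb
    rcases mul_eq_zero.1 hb with h | h
    · exact MvPolynomial.X_ne_zero (R := k) (1 : Fin 3) (pow_eq_zero_iff hr |>.1 h)
    · exact hH0 h
  · have he' : e = 3 := le_antisymm he3 hge
    subst he'
    have hm2 : m = 2 := by omega
    subst hm2
    obtain ⟨a, ha⟩ := hu H ((mem_anti F H).2 ⟨hHe, hv⟩)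
    refine ⟨c * a ^ 2, ?_, ?_⟩
    · refine mul_ne_zero hc (pow_ne_zero _ ?_)
      rintro rfl
      rw [zero_smul] at ha
      exact hH0 ha
    · rw [hGH, ha, _root_.smul_pow, smul_smul]

end final

theorem anti_bicanonical_is_bpf_pencil_with_unique_multiple_fiber
    (k : Type*) [Field k] (h3 : (3 : k) ≠ 0)
    (F : MvPolynomial (Fin 3) k) (hF : IsSmoothCurve (bar F) 3)
    (hj : (2 : k) = 0 → ¬ HasJZero F) :
    -- `|−2K_{S_C}|` is a pencil:
    Module.finrank k (antiBicanonicalSections F) = 2 ∧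
    -- it is base-point free: no common zero outside `T_C`, …
    (∀ z : Fin 3 → AlgebraicClosure k, z ≠ 0 → ¬ IsInflLine (bar F) z →
      ∃ G ∈ antiBicanonicalSections F, eval z (bar G) ≠ 0) ∧
    -- … and no common (infinitely near) base point on the exceptional curves:
    (∀ w v : Fin 3 → AlgebraicClosure k, IsInflLine (bar F) w →
      LinearIndependent (AlgebraicClosure k) ![w, v] →
      ∃ G ∈ antiBicanonicalSections F, ∃ u : Fin 3 → AlgebraicClosure k,
        LinearIndependent (AlgebraicClosure k) ![w, v, u] ∧
        eval (![1, 0] : Fin 2 → AlgebraicClosure k)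
          (homogeneousComponent 2 (planeSubst (bar G) w v u)) ≠ 0) ∧
    -- the associated fibration `S_C → ℙ¹` has a unique multiple fiber, namely twice
    -- the unique effective anticanonical divisor: `|−K_{S_C}|` has a unique member …
    Module.finrank k (antiCanonicalSections F) = 1 ∧
    (∃ H₀ ∈ antiCanonicalSections F, H₀ ≠ 0 ∧
      -- … whose double is a fiber of the pencil …
      H₀ ^ 2 ∈ antiBicanonicalSections F ∧
      -- … and every multiple fiber of the pencil is that double:
      ∀ G ∈ antiBicanonicalSections F, G ≠ 0 →
        (∃ (m : ℕ) (H : MvPolynomial (Fin 3) k) (c : k), 2 ≤ m ∧ c ≠ 0 ∧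
          H.totalDegree ≠ 0 ∧ G = c • H ^ m) →
        ∃ d : k, d ≠ 0 ∧ G = d • H₀ ^ 2) := by
  obtain ⟨D, E, H, hD, hE, hH, hH0, hvan, hsext, hind, hcub, hbp, hexc⟩ := main_bar h3 F hF hj
  have hDE : ∀ G : MvPolynomial (Fin 3) (AlgebraicClosure k), G.IsHomogeneous 6 →
      (∀ w, IsInflLine (bar F) w → SingAt G w) →
      ∀ φ : AlgebraicClosure k →ₗ[k] k, cm φ G ∈ antiBicanonicalSections F := by
    intro G hG hs φ
    rw [mem_bi]
    refine ⟨cm_hom φ G 6 hG, fun w hw => ⟨?_, fun i => ?_⟩⟩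
    · exact cm_infl h3 F hF φ 6 G hG (fun w hw => (hs w hw).1) w hw
    · have h1 : pderiv i (bar (cm φ G)) = bar (cm φ (pderiv i G)) := by
        rw [← cm_pderiv, bar, pderiv_map, bar]
      rw [h1]
      exact cm_infl h3 F hF φ (6 - 1) (pderiv i G) hG.pderiv (fun w hw => (hs w hw).2 i) w hw
  have hDs : D ∈ Submodule.span (AlgebraicClosure k) ((fun P => MvPolynomial.map
      (algebraMap k (AlgebraicClosure k)) P) '' (antiBicanonicalSections F : Set _)) :=
    mem_span_map _ _ (hDE D hD fun w hw => (hvan w hw).1)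
  have hEs : E ∈ Submodule.span (AlgebraicClosure k) ((fun P => MvPolynomial.map
      (algebraMap k (AlgebraicClosure k)) P) '' (antiBicanonicalSections F : Set _)) :=
    mem_span_map _ _ (hDE E hE fun w hw => (hvan w hw).2.1)
  have hHs : H ∈ Submodule.span (AlgebraicClosure k) ((fun P => MvPolynomial.map
      (algebraMap k (AlgebraicClosure k)) P) '' (antiCanonicalSections F : Set _)) := by
    apply mem_span_map
    intro φ
    rw [mem_anti]
    exact ⟨cm_hom φ H 3 hH, cm_infl h3 F hF φ 3 H hH fun w hw => (hvan w hw).2.2⟩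
  -- the spans over the algebraic closure
  have hspanB : Submodule.span (AlgebraicClosure k) ((fun P => MvPolynomial.map
      (algebraMap k (AlgebraicClosure k)) P) '' (antiBicanonicalSections F : Set _)) =
      Submodule.span (AlgebraicClosure k) (Set.range ![D, E]) := by
    apply le_antisymm
    · rw [Submodule.span_le]
      rintro _ ⟨G, hG, rfl⟩
      have hG' := (mem_bi F G).1 hG
      obtain ⟨a, b, e⟩ := hsext (bar G) ((bar_hom G 6).2 hG'.1) hG'.2
      have e' : MvPolynomial.map (algebraMap k (AlgebraicClosure k)) G = a • D + b • E := e
      show MvPolynomial.map (algebraMap k (AlgebraicClosure k)) G ∈ _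
      rw [e']
      exact Submodule.add_mem _
        (Submodule.smul_mem _ _ (Submodule.subset_span ⟨0, rfl⟩))
        (Submodule.smul_mem _ _ (Submodule.subset_span ⟨1, rfl⟩))
    · rw [Submodule.span_le]
      rintro _ ⟨i, rfl⟩
      fin_cases i
      · exact hDs
      · exact hEs
  have hspanC : Submodule.span (AlgebraicClosure k) ((fun P => MvPolynomial.map
      (algebraMap k (AlgebraicClosure k)) P) '' (antiCanonicalSections F : Set _)) =
      Submodule.span (AlgebraicClosure k) {H} := by
    apply le_antisymm
    · rw [Submodule.span_le]
      rintro _ ⟨G, hG, rfl⟩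
      have hG' := (mem_anti F G).1 hG
      obtain ⟨a, e⟩ := hcub (bar G) ((bar_hom G 3).2 hG'.1) hG'.2
      exact Submodule.mem_span_singleton.2 ⟨a, e.symm⟩
    · rw [Submodule.span_le]
      rintro _ rfl
      exact hHs
  have hliDE : LinearIndependent (AlgebraicClosure k) ![D, E] :=
    LinearIndependent.pair_iff.2 hind
  have hfB : Module.finrank k (antiBicanonicalSections F) = 2 := by
    rw [finrank_descent (E := AlgebraicClosure k), hspanB, finrank_span_eq_card hliDE]
    simp
  have hfC : Module.finrank k (antiCanonicalSections F) = 1 := by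
    rw [finrank_descent (E := AlgebraicClosure k), hspanC, finrank_span_singleton hH0]
  -- a linear functional killing all sections kills the span
  have hkill : ∀ ℓ : MvPolynomial (Fin 3) (AlgebraicClosure k) →ₗ[AlgebraicClosure k]
      AlgebraicClosure k, (∀ G ∈ antiBicanonicalSections F, ℓ (bar G) = 0) →
      ℓ D = 0 ∧ ℓ E = 0 := by
    intro ℓ h
    have hle : Submodule.span (AlgebraicClosure k) ((fun P => MvPolynomial.map
        (algebraMap k (AlgebraicClosure k)) P) '' (antiBicanonicalSections F : Set _)) ≤
        LinearMap.ker ℓ := by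
      rw [Submodule.span_le]
      rintro _ ⟨G, hG, rfl⟩
      exact h G hG
    exact ⟨hle hDs, hle hEs⟩
  refine ⟨hfB, ?_, ?_, hfC, ?_⟩
  · intro z hz hzi
    by_contra hcon
    push Not at hcon
    obtain ⟨q1, q2⟩ := hkill (MvPolynomial.aeval z).toLinearMap (fun G hG => by
      simpa using hcon G hG)
    rcases hbp z hz hzi with h | h
    · exact h (by simpa using q1)
    · exact h (by simpa using q2)
  · intro w v hw hwv
    obtain ⟨u, hu⟩ := exists_linearIndependent_snoc_of_lt_finrank hwv (by simp)
    have hsn : (Fin.snoc ![w, v] u : Fin 3 → Fin 3 → AlgebraicClosure k) = ![w, v, u] := by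
      ext1 i
      fin_cases i <;> rfl
    have hu' : LinearIndependent (AlgebraicClosure k) ![w, v, u] := hsn ▸ hu
    by_contra hcon
    push Not at hcon
    let ℓ : MvPolynomial (Fin 3) (AlgebraicClosure k) →ₗ[AlgebraicClosure k] AlgebraicClosure k :=
      { toFun := fun P => (lineRestrict P w v).coeff 2
        map_add' := fun P Q => by rw [lineRestrict_add, Polynomial.coeff_add]
        map_smul' := fun c P => by rw [lineRestrict_smul, Polynomial.coeff_smul]; rfl }
    obtain ⟨q1, q2⟩ := hkill ℓ (fun G hG => by
      have := hcon G hG u hu'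
      rw [planeSubst_coeff] at this
      exact this)
    rcases hexc w v hw hwv with h | h
    · exact h q1
    · exact h q2
  · obtain ⟨⟨H₀, hH₀⟩, hne, hall⟩ := finrank_eq_one_iff'.1 hfC
    have hne' : H₀ ≠ 0 := fun h => hne (Subtype.ext h)
    refine ⟨H₀, hH₀, hne', sq_mem F H₀ hH₀, ?_⟩
    rintro G hG hG0 ⟨m, P, c, hm, hc, hP, e⟩
    refine multiple_fib F H₀ hne' ?_ G hG hG0 m P c hm hc hP e
    intro Q hQ
    obtain ⟨a, ha⟩ := hall ⟨Q, hQ⟩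
    exact ⟨a, (congrArg Subtype.val ha).symm⟩

end Infl
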